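/- arXiv:1507.04359 — 2 statements merged into one kernel-verified Lean document; each statement's English description precedes it below -/
import Mathlib

section
/- For each integer n ≥ 2 and each natural number N, there exists a finite simplicial graph Γ, focused at some vertex c, with trivial graph automorphism group and with more than N vertices, such that there is an injective group homomorphism from PGL_n(ℤ) into Out(Out(A_Γ)). In particular, for each n ≥ 2 there are infinitely many pairwise non-isomorphic focused graphs Γ for which Out(Out(A_Γ)) contains PGL_n(ℤ). -/
noncomputable section

/-- The subgroup of inner automorphisms inside `MulAut G`. -/
def Inn (G : Type) [Group G] : Subgroup (MulAut G) :=
  (MulAut.conj : G →* MulAut G).range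

instance Inn.normal (G : Type) [Group G] : (Inn G).Normal := by
  constructor
  rintro x ⟨g, rfl⟩ φ
  refine ⟨φ g, ?_⟩
  ext h
  simp [MulAut.mul_apply, MulAut.conj_apply, map_mul, map_inv]

/-- The outer automorphism group of `G`. -/
abbrev Out (G : Type) [Group G] := MulAut G ⧸ Inn G

/-- The set of commutator relators defining the RAAG of a graph. -/
def raagRels {V : Type} (G : SimpleGraph V) : Set (FreeGroup V) :=
  {r | ∃ u v : V, G.Adj u v ∧
    r = FreeGroup.of u * FreeGroup.of v * (FreeGroup.of u)⁻¹ * (FreeGroup.of v)⁻¹}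

/-- The right-angled Artin group of a graph. -/
abbrev RAAG {V : Type} (G : SimpleGraph V) := PresentedGroup (raagRels G)

/-- The standard generator of `RAAG G` corresponding to a vertex. -/
def gen {V : Type} (G : SimpleGraph V) (v : V) : RAAG G := PresentedGroup.of v

/-- The star of a vertex: the vertex together with its neighbours. -/
def star {V : Type} (G : SimpleGraph V) (v : V) : Set V := insert v (G.neighborSet v)

/-- `u` dominates `v` if `lk(v) ⊆ st(u)`. -/
def Dominates {V : Type} (G : SimpleGraph V) (u v : V) : Prop :=
  G.neighborSet v ⊆ star G u

/-- A graph has trivial automorphism group. -/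
def TrivialAut {V : Type} (G : SimpleGraph V) : Prop := ∀ e : G ≃g G, ∀ v, e v = v

/-- A graph is focused at a vertex `c`. -/
def Focused {V : Type} (G : SimpleGraph V) (c : V) : Prop :=
  (∀ u v : V, u ≠ v → Dominates G u v → u = c) ∧
  ∀ v : V, v ≠ c → (G.induce (star G v)ᶜ).Connected

/-- A graph is austere. -/
def Austere {V : Type} (G : SimpleGraph V) : Prop :=
  TrivialAut G ∧ (∀ u v : V, u ≠ v → ¬Dominates G u v) ∧
  ∀ v : V, (G.induce (star G v)ᶜ).Connected

/-- `P` is (the vertex set of) a connected component of the induced subgraph on `s`. -/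
def IsCompOf {V : Type} (G : SimpleGraph V) (s : Set V) (P : Set V) : Prop :=
  ∃ x : s, P = Subtype.val '' {y : s | (G.induce s).Reachable x y}

/-- `φ` is the inversion at the vertex `v`. -/
def IsInversion {V : Type} (G : SimpleGraph V) (φ : MulAut (RAAG G)) (v : V) : Prop :=
  φ (gen G v) = (gen G v)⁻¹ ∧ ∀ w : V, w ≠ v → φ (gen G w) = gen G w

/-- `φ` is the transvection `τ_{uv}` (`v ↦ uv`). -/
def IsTransvection {V : Type} (G : SimpleGraph V) (φ : MulAut (RAAG G)) (u v : V) : Prop :=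
  u ≠ v ∧ Dominates G u v ∧ φ (gen G v) = gen G u * gen G v ∧
    ∀ w : V, w ≠ v → φ (gen G w) = gen G w

/-- `φ` is the partial conjugation `χ_{v,P}`. -/
def IsPartialConj {V : Type} (G : SimpleGraph V) (φ : MulAut (RAAG G)) (v : V) (P : Set V) :
    Prop :=
  IsCompOf G (star G v)ᶜ P ∧ (∀ u ∈ P, φ (gen G u) = gen G v * gen G u * (gen G v)⁻¹) ∧
    ∀ w : V, w ∉ P → φ (gen G w) = gen G w

/-- The subgroup `I_Γ` of `Aut(A_Γ)` generated by the inversions. -/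
def InvSubgroup {V : Type} (G : SimpleGraph V) : Subgroup (MulAut (RAAG G)) :=
  Subgroup.closure {φ | ∃ v, IsInversion G φ v}

/-- The subgroup `PCT` of `Aut(A_Γ)` generated by transvections and partial conjugations. -/
def PCT {V : Type} (G : SimpleGraph V) : Subgroup (MulAut (RAAG G)) :=
  Subgroup.closure {φ | (∃ u v, IsTransvection G φ u v) ∨ ∃ v P, IsPartialConj G φ v P}

/-- The number `l` of vertices dominated by but not adjacent to `c`. -/
def lInv {V : Type} (G : SimpleGraph V) (c : V) : ℕ :=
  Nat.card {v : V | v ≠ c ∧ Dominates G c v ∧ ¬G.Adj c v}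

/-- The number `m` of vertices (other than `c`) dominated by `c`. -/
def mInv {V : Type} (G : SimpleGraph V) (c : V) : ℕ :=
  Nat.card {v : V | v ≠ c ∧ Dominates G c v}

/-- The number `k` of connected components of `Γ \ st(c)`. -/
def kInv {V : Type} (G : SimpleGraph V) (c : V) : ℕ :=
  Nat.card ((G.induce (star G c)ᶜ).ConnectedComponent)

/-- `GL_n(ℤ)`. -/
abbrev GLZ (n : ℕ) := Matrix.GeneralLinearGroup (Fin n) ℤ

/-- `PGL_n(ℤ)`, the quotient of `GL_n(ℤ)` by its centre `{±I}`. -/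
abbrev PGLZ (n : ℕ) := GLZ n ⧸ Subgroup.center (GLZ n)

/-- The principal level 2 congruence subgroup `Λ_l[2]` of `GL_l(ℤ)`. -/
def congr2 (l : ℕ) : Subgroup (GLZ l) :=
  (Matrix.GeneralLinearGroup.map (Int.castRingHom (ZMod 2)) :
    GLZ l →* Matrix.GeneralLinearGroup (Fin l) (ZMod 2)).ker

/-- The matrix `(1 1 / 0 -1)`. -/
def Bmat : Matrix (Fin 2) (Fin 2) ℤ := !![1, 1; 0, -1]

/-- A block-diagonal `2l × 2l` matrix whose `i`th `2 × 2` diagonal block is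
`Bmat` if `ε i` and the identity otherwise. -/
def Lmat (l : ℕ) (ε : Fin l → Bool) : Matrix (Fin l × Fin 2) (Fin l × Fin 2) ℤ :=
  fun a b =>
    if a.1 = b.1 then (if ε a.1 then Bmat a.2 b.2 else (1 : Matrix (Fin 2) (Fin 2) ℤ) a.2 b.2)
    else 0

/-- `GL_{2l}(ℤ)`, with rows and columns indexed by `Fin l × Fin 2`. -/
abbrev GL2l (l : ℕ) := Matrix.GeneralLinearGroup (Fin l × Fin 2) ℤ

/-- The subgroup `𝓛 ≤ GL_{2l}(ℤ)`. -/
def scriptL (l : ℕ) : Subgroup (GL2l l) :=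
  Subgroup.closure {M : GL2l l |
    ∃ ε : Fin l → Bool, (M : Matrix (Fin l × Fin 2) (Fin l × Fin 2) ℤ) = Lmat l ε}

/-- The index type realizing the block decomposition `d = 2l + p + q`. -/
abbrev BIdx (l p q : ℕ) := (Fin l × Fin 2) ⊕ (Fin p ⊕ Fin q)

/-- The block-diagonal matrix `Diag(D₁, D₂, ε·I_q)` with `D₁ ∈ 𝓛` given by `ε1`,
`D₂` diagonal with entries `d2`, and `ε = e`. -/
def Dmat (l p q : ℕ) (ε1 : Fin l → Bool) (d2 : Fin p → ℤˣ) (e : ℤˣ) :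
    Matrix (BIdx l p q) (BIdx l p q) ℤ := fun a b =>
  match a, b with
  | Sum.inl a, Sum.inl b => Lmat l ε1 a b
  | Sum.inr (Sum.inl i), Sum.inr (Sum.inl j) => if i = j then (d2 i : ℤ) else 0
  | Sum.inr (Sum.inr i), Sum.inr (Sum.inr j) => if i = j then (e : ℤ) else 0
  | _, _ => 0

/-- The subgroup `D ≤ GL_d(ℤ)` generated by `−I_d` and the block-diagonal matrices
`Diag(D₁, D₂, ε·I_q)`. -/
def DSub (l p q : ℕ) : Subgroup (Matrix.GeneralLinearGroup (BIdx l p q) ℤ) :=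
  Subgroup.closure
    ({M | (M : Matrix (BIdx l p q) (BIdx l p q) ℤ) = -1} ∪
     {M | ∃ ε1 d2 e, (M : Matrix (BIdx l p q) (BIdx l p q) ℤ) = Dmat l p q ε1 d2 e})

section OuterAction

variable {H : Type} [Group H] {n : ℕ}

/-- A group with a translation subgroup `ℤⁿ` and a crossed homomorphism onto it. -/
structure TranslationData (H : Type) [Group H] (n : ℕ) where
  ε : H →* ℤˣ
  χ : Multiplicative (Fin n → ℤ) →* H
  e : H → (Fin n → ℤ)
  e_mul : ∀ g h, e (g * h) = e g + (ε g : ℤ) • e h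
  e_χ : ∀ v, e (χ (Multiplicative.ofAdd v)) = v
  ε_χ : ∀ v, ε (χ v) = 1
  conj_χ : ∀ g v, g * χ (Multiplicative.ofAdd v) =
    χ (Multiplicative.ofAdd ((ε g : ℤ) • v)) * g
  ι : H
  ε_ι : ε ι = -1
  conj_ι : ∀ g, ι * g = χ (Multiplicative.ofAdd ((-2 : ℤ) • e g)) * g * ι

namespace TranslationData

variable (D : TranslationData H n)

/-- `χ` in additive form. -/
def t (v : Fin n → ℤ) : H := D.χ (Multiplicative.ofAdd v)

lemma t_add (v w : Fin n → ℤ) : D.t (v + w) = D.t v * D.t w := by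
  simp [t, ofAdd_add]

lemma t_zero : D.t 0 = 1 := by simp [t]

lemma e_t (v : Fin n → ℤ) : D.e (D.t v) = v := D.e_χ v

lemma t_injective : Function.Injective D.t := fun v w h => by
  rw [← D.e_t v, h, D.e_t]

lemma mul_t (g : H) (v : Fin n → ℤ) : g * D.t v = D.t ((D.ε g : ℤ) • v) * g := D.conj_χ g v

lemma e_t_mul (v : Fin n → ℤ) (h : H) : D.e (D.t v * h) = v + D.e h := by
  rw [D.e_mul, D.e_t]
  simp [t, D.ε_χ]

/-- The endomorphism `h ↦ χ_{(M-1) e(h)} h` as a function. -/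
def act (M : Matrix (Fin n) (Fin n) ℤ) (h : H) : H := D.t ((M - 1).mulVec (D.e h)) * h

lemma e_act (M : Matrix (Fin n) (Fin n) ℤ) (h : H) : D.e (D.act M h) = M.mulVec (D.e h) := by
  rw [act, D.e_t_mul, Matrix.sub_mulVec, Matrix.one_mulVec, sub_add_cancel]

lemma act_mul (M : Matrix (Fin n) (Fin n) ℤ) (g h : H) :
    D.act M (g * h) = D.act M g * D.act M h := by
  simp only [act]
  rw [D.e_mul, Matrix.mulVec_add, D.t_add, Matrix.mulVec_smul]
  simp only [mul_assoc]
  rw [← mul_assoc g, D.mul_t]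
  simp only [mul_assoc]

lemma act_act (M N : Matrix (Fin n) (Fin n) ℤ) (h : H) :
    D.act M (D.act N h) = D.act (M * N) h := by
  rw [act, D.e_act]
  simp only [act]
  rw [← mul_assoc, ← D.t_add]
  simp only [Matrix.sub_mulVec, Matrix.one_mulVec, Matrix.mulVec_mulVec, sub_mul, one_mul]
  congr 2
  abel

lemma act_one (h : H) : D.act 1 h = h := by simp [act, D.t_zero]

lemma act_t (M : Matrix (Fin n) (Fin n) ℤ) (v : Fin n → ℤ) :
    D.act M (D.t v) = D.t (M.mulVec v) := by
  rw [act, D.e_t, ← D.t_add]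
  simp [Matrix.sub_mulVec]

/-- The action of `GL_n(ℤ)` on `H` by automorphisms. -/
def aut : GLZ n →* MulAut H where
  toFun M :=
    { toFun := D.act M.1
      invFun := D.act (M⁻¹).1
      left_inv := fun h => by rw [D.act_act, ← Units.val_mul]; simp [D.act_one]
      right_inv := fun h => by rw [D.act_act, ← Units.val_mul]; simp [D.act_one]
      map_mul' := D.act_mul M.1 }
  map_one' := by ext h; exact D.act_one h
  map_mul' M N := by ext h; exact (D.act_act M.1 N.1 h).symm

lemma aut_apply (M : GLZ n) (h : H) : D.aut M h = D.act M.1 h := rfl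

lemma eq_one_or_neg_one_of_mem_center {M : GLZ n} (hM : M ∈ Subgroup.center (GLZ n)) :
    M.1 = 1 ∨ M.1 = -1 := by
  have h : M.1 ∈ Set.range (Matrix.scalar (Fin n) : ℤ → _) := by
    rw [Matrix.mem_range_scalar_iff_commute_transvectionStruct]
    intro t
    let T : GLZ n := ⟨t.toMatrix, t.inv.toMatrix, t.mul_inv, t.inv_mul⟩
    have := Subgroup.mem_center_iff.1 hM T
    exact congrArg Units.val this
  obtain ⟨a, ha⟩ := h
  rcases Nat.eq_zero_or_pos n with rfl | hn
  · left; ext i; exact i.elim0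
  have hu : IsUnit (M.1.det) := (Matrix.isUnit_iff_isUnit_det _).1 M.isUnit
  rw [← ha] at hu ⊢
  have : IsUnit a := by
    have h2 : (Matrix.scalar (Fin n) a).det = a ^ n := by
      rw [Matrix.scalar_apply, Matrix.det_diagonal]; simp
    rw [h2] at hu
    exact (isUnit_pow_iff hn.ne').1 hu
  rcases Int.isUnit_iff.1 this with rfl | rfl
  · left; simp
  · right; simp

lemma mem_center_of_eq {M : GLZ n} (h : M.1 = 1 ∨ M.1 = -1) : M ∈ Subgroup.center (GLZ n) := by
  rw [Subgroup.mem_center_iff]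
  intro N
  ext1
  rcases h with h | h <;> simp [h]

lemma aut_mem_inn_iff (M : GLZ n) : D.aut M ∈ Inn H ↔ M ∈ Subgroup.center (GLZ n) := by
  constructor
  · rintro ⟨g, hg⟩
    apply mem_center_of_eq
    have key : ∀ v, M.1.mulVec v = (D.ε g : ℤ) • v := fun v => by
      have h1 := DFunLike.congr_fun hg (D.t v)
      rw [D.aut_apply, D.act_t, MulAut.conj_apply, D.mul_t, mul_inv_cancel_right] at h1
      exact (D.t_injective h1).symm
    rcases Int.units_eq_one_or (D.ε g) with h | h
    · left
      refine Matrix.ext_of_mulVec_single fun i => ?_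
      rw [key, h, Matrix.one_mulVec]; simp
    · right
      refine Matrix.ext_of_mulVec_single fun i => ?_
      rw [key, h, Matrix.neg_mulVec, Matrix.one_mulVec]; simp
  · intro hM
    rcases eq_one_or_neg_one_of_mem_center hM with h | h
    · have : M = 1 := Units.ext h
      rw [this, map_one]; exact one_mem _
    · refine ⟨D.ι, ?_⟩
      ext x
      rw [MulAut.conj_apply, D.aut_apply, h, mul_inv_eq_iff_eq_mul, D.conj_ι, act, t]
      congr 4
      simp only [Matrix.sub_mulVec, Matrix.neg_mulVec, Matrix.one_mulVec]
      module

theorem exists_injective_PGLZ (D : TranslationData H n) :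
    ∃ f : PGLZ n →* Out H, Function.Injective f := by
  have hk : ((QuotientGroup.mk' (Inn H)).comp D.aut).ker = Subgroup.center (GLZ n) := by
    ext M
    rw [MonoidHom.mem_ker, MonoidHom.comp_apply, QuotientGroup.mk'_apply,
      QuotientGroup.eq_one_iff, D.aut_mem_inn_iff]
  refine ⟨QuotientGroup.lift _ ((QuotientGroup.mk' (Inn H)).comp D.aut) hk.ge, ?_⟩
  rw [← MonoidHom.ker_eq_bot_iff, QuotientGroup.ker_lift, hk, QuotientGroup.map_mk'_self]

end TranslationData
end OuterAction

section HalfSpace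

open Monoid PushoutI NormalWord CoprodI

variable {ι H : Type} {K : ι → Type} [∀ i, Group (K i)] [Group H] {φ : ∀ i, H →* K i}

open Classical in
/-- The set of elements of an amalgamated product whose normal form ends in the factor `j`. -/
def lastFactor (d : Transversal φ) (j : ι) : Set (PushoutI φ) :=
  {g | (g • (NormalWord.empty : NormalWord d)).toList.getLast?.map Sigma.fst = some j}

open Classical in
lemma toList_rcons (d : Transversal φ) (i : ι) (p : Pair d i) :
    (NormalWord.rcons i p).toList =
      if ((d.compl i).equiv p.head).2.1 = 1 then p.tail.toList
      else ⟨i, ((d.compl i).equiv p.head).2.1⟩ :: p.tail.toList := by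
  simp only [NormalWord.rcons, Word.equivPair_symm, Word.rcons]
  split_ifs <;> rfl

open Classical in
lemma getLast_rcons (d : Transversal φ) (i : ι) (p : Pair d i) (h : p.tail.toList ≠ []) :
    (NormalWord.rcons i p).toList.getLast? = p.tail.toList.getLast? := by
  rw [toList_rcons]
  split_ifs
  · rfl
  · obtain ⟨a, l, hl⟩ := List.exists_cons_of_ne_nil h
    rw [hl, List.getLast?_cons_cons]

/-- The pair with a given head and empty tail. -/
def headPair (d : Transversal φ) (l : ι) (h : K l) : Pair d l :=
  ⟨⟨h, Word.empty, by simp [Word.fstIdx, Word.empty]⟩, by simp [Word.empty]⟩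

open Classical in
lemma equivPair_empty (d : Transversal φ) (l : ι) :
    NormalWord.equivPair l (NormalWord.empty : NormalWord d) = headPair d l 1 := by
  rw [← Equiv.eq_symm_apply]
  change _ = NormalWord.rcons l _
  have h1 : (d.compl l).equiv 1 = (1, ⟨1, d.one_mem l⟩) :=
    Subgroup.IsComplement.equiv_one (d.compl l) (one_mem _) (d.one_mem _)
  apply NormalWord.ext
  · simp only [NormalWord.rcons, headPair]
    rw [h1]
    exact (map_one (MonoidHom.ofInjective (d.injective l)).symm).symm
  · rw [toList_rcons, if_pos]
    · rfl
    · simp only [headPair]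
      rw [h1]

open Classical in
lemma of_smul_empty (d : Transversal φ) (l : ι) (h : K l) :
    of (φ := φ) l h • (NormalWord.empty : NormalWord d) =
      NormalWord.rcons l (headPair d l h) := by
  rw [NormalWord.summand_smul_def, equivPair_empty]
  simp only [headPair, mul_one]
  rfl

open Classical in
lemma of_mul_mem_lastFactor (d : Transversal φ) (j l : ι) (h : K l) (g : PushoutI φ)
    (hg : g ∉ (of (φ := φ) l).range) :
    of l h * g ∈ lastFactor d j ↔ g ∈ lastFactor d j := by
  set w := g • (NormalWord.empty : NormalWord d) with hw
  set p := NormalWord.equivPair l w with hp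
  have e1 : w = NormalWord.rcons l p := ((NormalWord.equivPair l).symm_apply_apply w).symm
  have e2 : of (φ := φ) l h • w = NormalWord.rcons l { p with head := h * p.head } :=
    NormalWord.summand_smul_def h w
  have ht : p.tail.toList ≠ [] := by
    intro ht
    apply hg
    have e3 : w = of (φ := φ) l p.head • (NormalWord.empty : NormalWord d) := by
      rw [of_smul_empty, e1]
      congr 1
      clear_value p
      obtain ⟨⟨a, ⟨t, t1, t2⟩, b⟩, c⟩ := p
      dsimp only at ht
      subst ht
      rfl
    rw [hw] at e3
    have := congrArg NormalWord.prod e3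
    rw [prod_smul, prod_smul, prod_empty, mul_one, mul_one] at this
    exact ⟨_, this.symm⟩
  simp only [lastFactor, Set.mem_ofPred_eq, mul_smul, ← hw]
  rw [e2, e1, getLast_rcons _ _ _ ht, getLast_rcons _ _ _ (by exact ht)]

open Classical in
lemma of_mem_lastFactor (d : Transversal φ) (j l : ι) (h : K l) :
    of l h ∈ lastFactor d j ↔ l = j ∧ h ∉ (φ l).range := by
  simp only [lastFactor, Set.mem_ofPred_eq]
  rw [of_smul_empty, toList_rcons]
  have := Subgroup.IsComplement.coe_equiv_snd_eq_one_iff_mem (d.compl l) (d.one_mem l) (g := h)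
  change Option.map _ (if ((d.compl l).equiv h).2.1 = 1 then [] else _).getLast? = _ ↔ _
  by_cases hc : ((d.compl l).equiv h).2.1 = 1
  · have h2 : h ∈ (φ l).range := this.1 hc
    rw [if_pos hc]
    simp only [h2, not_true, and_false, iff_false]
    exact fun h => by simp at h
  · have h2 : h ∉ (φ l).range := mt this.2 hc
    rw [if_neg hc]
    simp only [h2, not_false_iff, and_true]
    exact ⟨fun h => Option.some_injective _ h, fun h => congrArg some h⟩

end HalfSpace

/-- A decomposition of a group as an amalgam of subgroups `H j` over a common subgroup `F`, recorded
by the half-spaces of its Bass–Serre tree. -/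
structure Splitting (A J : Type) [Group A] where
  H : J → Subgroup A
  F : Subgroup A
  le : ∀ j, F ≤ H j
  iSup_eq : ⨆ j, H j = ⊤
  half : J → Set A
  mul_mem_half : ∀ j l g h, h ∈ H l → g ∉ H l → (g * h ∈ half j ↔ g ∈ half j)
  mem_half : ∀ j l g, g ∈ H l → (g ∈ half j ↔ l = j ∧ g ∉ F)

namespace Splitting

variable {A J : Type} [Group A]

section OfPushout

open Monoid

variable (H : J → Subgroup A) (F : Subgroup A) (le : ∀ j, F ≤ H j)

/-- A group which is the amalgam of its subgroups `H j` has a splitting. -/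
def ofPushout (r : A →* PushoutI fun j => Subgroup.inclusion (le j))
    (hr : Function.Injective r) (hr2 : ∀ j (h : H j), r h = PushoutI.of j h)
    (iSup_eq : ⨆ j, H j = ⊤) : Splitting A J where
  H := H
  F := F
  le := le
  iSup_eq := iSup_eq
  half j := {g | r g⁻¹ ∈ lastFactor (PushoutI.NormalWord.transversal_nonempty _
    fun i => Subgroup.inclusion_injective (le i)).some j}
  mul_mem_half j l g h hh hg := by
    simp only [Set.mem_ofPred_eq, mul_inv_rev, map_mul]
    rw [show r h⁻¹ = PushoutI.of l ⟨h⁻¹, inv_mem hh⟩ from hr2 l ⟨h⁻¹, inv_mem hh⟩]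
    apply of_mul_mem_lastFactor
    rintro ⟨k, hk⟩
    rw [← hr2] at hk
    apply hg
    rw [← inv_mem_iff, ← hr hk]
    exact k.2
  mem_half j l g hg := by
    simp only [Set.mem_ofPred_eq]
    rw [show r g⁻¹ = PushoutI.of l ⟨g⁻¹, inv_mem hg⟩ from hr2 l ⟨g⁻¹, inv_mem hg⟩,
      of_mem_lastFactor]
    simp [Subgroup.inclusion, Subtype.ext_iff]

end OfPushout

variable (T : Splitting A J)

/-- The vertices of the Bass–Serre tree. -/
abbrev Vert : Type := (A ⧸ T.F) ⊕ (Σ j, A ⧸ T.H j)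

/-- A central vertex. -/
abbrev cen (g : A) : T.Vert := Sum.inl (g : A ⧸ T.F)

/-- A peripheral vertex. -/
abbrev per (j : J) (g : A) : T.Vert := Sum.inr ⟨j, (g : A ⧸ T.H j)⟩

/-- The Bass–Serre tree. -/
def tree : SimpleGraph T.Vert where
  Adj x y := ∃ g j, (x = T.cen g ∧ y = T.per j g) ∨ (y = T.cen g ∧ x = T.per j g)
  symm := ⟨fun x y ⟨g, j, h⟩ => ⟨g, j, h.symm⟩⟩
  loopless := ⟨fun x ⟨g, j, h⟩ => by
    rcases h with ⟨h1, h2⟩ | ⟨h1, h2⟩ <;> rw [h1] at h2 <;> cases h2⟩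

lemma smul_cen (a g : A) : a • T.cen g = T.cen (a * g) := rfl

lemma smul_per (a g : A) (j : J) : a • T.per j g = T.per j (a * g) := rfl

lemma cen_eq_iff (g h : A) : T.cen g = T.cen h ↔ g⁻¹ * h ∈ T.F := by
  simp [cen, QuotientGroup.eq]

lemma per_eq_iff (i j : J) (g h : A) :
    T.per i g = T.per j h ↔ i = j ∧ g⁻¹ * h ∈ T.H j := by
  constructor
  · intro e
    have e := Sum.inr_injective e
    obtain rfl := congrArg Sigma.fst e
    exact ⟨rfl, QuotientGroup.eq.1 (eq_of_heq (Sigma.mk.inj e).2)⟩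
  · rintro ⟨rfl, e⟩
    rw [per, QuotientGroup.eq.2 e]

lemma adj_smul (a : A) {x y : T.Vert} (h : T.tree.Adj x y) : T.tree.Adj (a • x) (a • y) := by
  obtain ⟨g, j, h⟩ := h
  refine ⟨a * g, j, ?_⟩
  rcases h with ⟨rfl, rfl⟩ | ⟨rfl, rfl⟩
  · exact Or.inl ⟨rfl, rfl⟩
  · exact Or.inr ⟨rfl, rfl⟩

lemma adj_cen_per (g : A) (j : J) : T.tree.Adj (T.cen g) (T.per j g) :=
  ⟨g, j, Or.inl ⟨rfl, rfl⟩⟩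

lemma forall_vert {p : T.Vert → Prop} (h1 : ∀ g, p (T.cen g)) (h2 : ∀ j g, p (T.per j g))
    (v : T.Vert) : p v := by
  rcases v with v | ⟨j, v⟩
  · obtain ⟨g, rfl⟩ := QuotientGroup.mk_surjective v
    exact h1 g
  · obtain ⟨g, rfl⟩ := QuotientGroup.mk_surjective v
    exact h2 j g

lemma reachable_cen (g : A) : T.tree.Reachable (T.cen 1) (T.cen g) := by
  have hg : g ∈ ⨆ j, T.H j := by rw [T.iSup_eq]; trivial
  have key : ∀ h, h ∈ ⨆ j, T.H j → ∀ g, T.tree.Reachable (T.cen g) (T.cen (g * h)) := by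
    intro h hh
    induction hh using Subgroup.iSup_induction' with
    | hp j h hh =>
      intro g
      have e : T.per j g = T.per j (g * h) := (T.per_eq_iff _ _ _ _).2 ⟨rfl, by simpa using hh⟩
      exact (T.adj_cen_per g j).reachable.trans (e ▸ (T.adj_cen_per (g * h) j).symm.reachable)
    | h1 => intro g; rw [mul_one]
    | hmul x y _ _ hx hy =>
      intro g
      rw [← mul_assoc]
      exact (hx g).trans (hy _)
  simpa using key g hg 1

lemma tree_connected : T.tree.Connected := by
  rw [SimpleGraph.connected_iff_exists_forall_reachable]
  refine ⟨T.cen 1, fun v => ?_⟩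
  refine T.forall_vert (fun g => T.reachable_cen g) (fun j g => ?_) v
  exact (T.reachable_cen g).trans (T.adj_cen_per g j).reachable

/-- The side of a vertex with respect to the edge between `cen 1` and `per j 1`. -/
def side (j : J) : T.Vert → Prop
  | Sum.inl q => ∃ g ∈ T.half j, (g : A ⧸ T.F) = q
  | Sum.inr ⟨l, q⟩ => (l = j ∧ q = (1 : A)) ∨ (q ≠ (1 : A) ∧ ∃ g ∈ T.half j, (g : A ⧸ T.H l) = q)

lemma side_cen (j : J) (g : A) : T.side j (T.cen g) ↔ g ∈ T.half j := by
  refine ⟨fun ⟨h, hh, e⟩ => ?_, fun h => ⟨g, h, rfl⟩⟩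
  have hf0 := QuotientGroup.eq.1 e
  obtain ⟨f, hf, rfl⟩ : ∃ f ∈ T.F, g = h * f := ⟨_, hf0, by simp⟩
  by_cases hj : h ∈ T.H j
  · rw [T.mem_half j j _ hj] at hh
    rw [T.mem_half j j _ (mul_mem hj (T.le j hf))]
    exact ⟨rfl, fun h2 => hh.2 ((Subgroup.mul_mem_cancel_right _ hf).1 h2)⟩
  · exact (T.mul_mem_half j j h f (T.le j hf) hj).2 hh

lemma side_per (j l : J) (g : A) :
    T.side j (T.per l g) ↔ (l = j ∧ g ∈ T.H l) ∨ (g ∉ T.H l ∧ g ∈ T.half j) := by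
  have e1 : (g : A ⧸ T.H l) = (1 : A) ↔ g ∈ T.H l := by simp [QuotientGroup.eq]
  simp only [side, e1, ne_eq]
  refine or_congr Iff.rfl (and_congr_right fun hg => ⟨fun ⟨h, hh, e⟩ => ?_, fun h => ⟨g, h, rfl⟩⟩)
  have hf0 := QuotientGroup.eq.1 e
  obtain ⟨f, hf, rfl⟩ : ∃ f ∈ T.H l, g = h * f := ⟨_, hf0, by simp⟩
  exact (T.mul_mem_half j l h f hf (fun h2 => hg (mul_mem h2 hf))).2 hh

lemma side_eq (j l : J) (g : A) (h : ¬ (l = j ∧ g ∈ T.F)) :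
    T.side j (T.cen g) ↔ T.side j (T.per l g) := by
  rw [side_cen, side_per]
  by_cases hg : g ∈ T.H l
  · rw [T.mem_half j l g hg]
    tauto
  · tauto

lemma tree_isAcyclic : T.tree.IsAcyclic := by
  rw [SimpleGraph.isAcyclic_iff_forall_adj_isBridge]
  suffices key : ∀ g j, T.tree.IsBridge s(T.cen g, T.per j g) by
    rintro v w ⟨g, j, ⟨rfl, rfl⟩ | ⟨rfl, rfl⟩⟩
    · exact key g j
    · rw [Sym2.eq_swap]; exact key g j
  intro g j
  rw [SimpleGraph.isBridge_iff]
  rintro ⟨p⟩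
  have key : ∀ v w, (T.tree.deleteEdges {s(T.cen g, T.per j g)}).Adj v w →
      (T.side j (g⁻¹ • v) ↔ T.side j (g⁻¹ • w)) := by
    intro v w hvw
    rw [SimpleGraph.deleteEdges_adj] at hvw
    obtain ⟨⟨h, l, hh⟩, hn⟩ := hvw
    have key2 : s(v, w) = s(T.cen h, T.per l h) := by
      rcases hh with ⟨rfl, rfl⟩ | ⟨rfl, rfl⟩
      · rfl
      · exact Sym2.eq_swap
    have key3 : ¬ (l = j ∧ g⁻¹ * h ∈ T.F) := by
      rintro ⟨rfl, hF⟩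
      apply hn
      rw [key2, Set.mem_singleton_iff, (T.cen_eq_iff g h).2 hF,
        (T.per_eq_iff l l g h).2 ⟨rfl, T.le _ hF⟩]
    have := T.side_eq j l _ key3
    rcases hh with ⟨rfl, rfl⟩ | ⟨rfl, rfl⟩
    · exact this
    · exact this.symm
  have key2 : ∀ v w, (T.tree.deleteEdges {s(T.cen g, T.per j g)}).Walk v w →
      (T.side j (g⁻¹ • v) ↔ T.side j (g⁻¹ • w)) := by
    intro v w q
    induction q with
    | nil => rfl
    | cons h _ ih => exact (key _ _ h).trans ih
  have := key2 _ _ p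
  rw [smul_cen, smul_per, inv_mul_cancel, side_cen, side_per,
    T.mem_half j j 1 (one_mem _)] at this
  simp [one_mem] at this

lemma tree_isTree : T.tree.IsTree := ⟨T.tree_connected, T.tree_isAcyclic⟩

end Splitting

/-- An action of a group on a tree preserving a proper two-colouring of the vertices. -/
structure TreeAction (A W : Type) [Group A] [MulAction A W] where
  graph : SimpleGraph W
  isTree : graph.IsTree
  adj_smul : ∀ (a : A) {x y : W}, graph.Adj x y → graph.Adj (a • x) (a • y)
  col : W → Bool
  col_smul : ∀ (a : A) x, col (a • x) = col x
  col_ne : ∀ {x y}, graph.Adj x y → col x ≠ col y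

namespace TreeAction

variable {A W : Type} [Group A] [MulAction A W] (T : TreeAction A W)

/-- The distance in the tree. -/
abbrev d (v w : W) : ℕ := T.graph.dist v w

lemma d_comm (v w : W) : T.d v w = T.d w v := SimpleGraph.dist_comm

lemma d_tri (u v w : W) : T.d u w ≤ T.d u v + T.d v w := T.isTree.connected.dist_triangle

lemma d_eq_zero {v w : W} : T.d v w = 0 ↔ v = w := T.isTree.connected.dist_eq_zero_iff

lemma d_self (v : W) : T.d v v = 0 := T.d_eq_zero.2 rfl

lemma d_adj {v w : W} (h : T.graph.Adj v w) : T.d v w = 1 := SimpleGraph.dist_eq_one_iff_adj.2 h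

lemma d_smul_le (a : A) (v w : W) : T.d (a • v) (a • w) ≤ T.d v w := by
  obtain ⟨p, hp⟩ := T.isTree.connected.exists_walk_length_eq_dist v w
  let f : T.graph →g T.graph := ⟨fun x => a • x, fun h => T.adj_smul a h⟩
  rw [d, d, ← hp, ← SimpleGraph.Walk.length_map f p]
  exact SimpleGraph.dist_le (p.map f)

lemma d_smul (a : A) (v w : W) : T.d (a • v) (a • w) = T.d v w := by
  refine le_antisymm (T.d_smul_le a v w) ?_
  simpa using T.d_smul_le a⁻¹ (a • v) (a • w)

/-- `u` is the neighbour of `v` on the way to `w`. -/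
def Closer (v u w : W) : Prop := T.graph.Adj v u ∧ T.d v w = T.d u w + 1

variable {T}

lemma Closer.smul {v u w : W} (h : T.Closer v u w) (a : A) : T.Closer (a • v) (a • u) (a • w) :=
  ⟨T.adj_smul a h.1, by rw [T.d_smul, T.d_smul, h.2]⟩

variable (T)

lemma exists_closer {v w : W} (h : v ≠ w) : ∃ u, T.Closer v u w := by
  obtain ⟨p, hp⟩ := T.isTree.connected.exists_walk_length_eq_dist v w
  cases p with
  | nil => exact absurd rfl h
  | @cons _ u _ hvu q =>
    refine ⟨u, hvu, ?_⟩
    have h1 := T.d_tri v u w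
    rw [T.d_adj hvu] at h1
    have h2 : T.d u w ≤ q.length := SimpleGraph.dist_le q
    rw [SimpleGraph.Walk.length_cons] at hp
    change q.length + 1 = T.d v w at hp
    omega

variable {T}

lemma Closer.unique {v u u' w : W} (h : T.Closer v u w) (h' : T.Closer v u' w) : u = u' := by
  obtain ⟨p, hp⟩ := T.isTree.connected.exists_walk_length_eq_dist u w
  obtain ⟨p', hp'⟩ := T.isTree.connected.exists_walk_length_eq_dist u' w
  have h1 : (SimpleGraph.Walk.cons h.1 p).IsPath := SimpleGraph.Walk.isPath_of_length_eq_dist _ (by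
    rw [SimpleGraph.Walk.length_cons, hp]; exact h.2.symm)
  have h2 : (SimpleGraph.Walk.cons h'.1 p').IsPath :=
    SimpleGraph.Walk.isPath_of_length_eq_dist _ (by
      rw [SimpleGraph.Walk.length_cons, hp']; exact h'.2.symm)
  have := (T.isTree.isAcyclic.subsingleton_path v w).elim ⟨_, h1⟩ ⟨_, h2⟩
  have := congrArg (fun q => q.1.getVert 1) this
  simpa using this

lemma adj_cases {v u : W} (h : T.graph.Adj v u) (w : W) :
    T.d v w = T.d u w + 1 ∨ T.d u w = T.d v w + 1 := by
  rw [T.d_comm v, T.d_comm u]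
  exact T.isTree.dist_eq_dist_add_one_of_adj w h

lemma Closer.fixed {v u w : W} (h : T.Closer v u w) {a : A} (hv : a • v = v) (hw : a • w = w) :
    a • u = u := by
  have := h.smul a
  rw [hv, hw] at this
  exact this.unique h

lemma separation {v w x y : W} (hvw : T.graph.Adj v w) (hxy : T.graph.Adj x y)
    (hx : T.d x v = T.d x w + 1) (hy : T.d y w = T.d y v + 1) : x = w ∧ y = v := by
  have c1 := adj_cases hxy v
  have c2 := adj_cases hxy w
  have hc : T.Closer x y v := ⟨hxy, by omega⟩
  have hxw : x = w := by
    by_contra hne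
    obtain ⟨b, hb⟩ := T.exists_closer hne
    have hb2 := hb.2
    have h1 := T.d_tri b w v
    rw [T.d_adj hvw.symm] at h1
    have h2 := adj_cases hb.1 v
    have : b = y := Closer.unique ⟨hb.1, by omega⟩ hc
    subst this
    omega
  refine ⟨hxw, T.d_eq_zero.1 ?_⟩
  rw [hxw, T.d_self] at hx
  have := hc.2
  rw [hxw] at this
  omega

lemma d_add_of_not_closer {p q a : W} (hq : T.Closer p a q) :
    ∀ n u, T.d p u = n → ¬ T.Closer p a u → T.d q u = T.d q p + T.d p u := by
  intro n
  induction n with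
  | zero =>
    intro u hu _
    rw [hu, T.d_eq_zero.1 hu, add_zero]
  | succ n ih =>
    intro u hu hn
    have hne : u ≠ p := fun h => by rw [h, T.d_self] at hu; omega
    obtain ⟨u', hu'⟩ := T.exists_closer hne
    have e1 := hu'.2
    rw [T.d_comm u p, T.d_comm u' p] at e1
    have hn' : ¬ T.Closer p a u' := by
      intro hc
      apply hn
      refine ⟨hc.1, ?_⟩
      have e2 := hc.2
      have e3 := T.d_tri a u' u
      rw [T.d_adj hu'.1.symm] at e3
      have := adj_cases hc.1 u
      omega
    have e4 := ih u' (by omega) hn'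
    have e5 := adj_cases hu'.1 q
    rw [T.d_comm u, T.d_comm u'] at e5
    rcases e5 with e5 | e5
    · omega
    · exfalso
      have hc : T.Closer u' u q := ⟨hu'.1.symm, by rw [T.d_comm u', T.d_comm u]; exact e5⟩
      by_cases hu'p : u' = p
      · subst hu'p
        have := hc.unique hq
        subst this
        exact hn ⟨hq.1, by rw [T.d_self, T.d_adj hq.1]⟩
      · obtain ⟨u'', hu''⟩ := T.exists_closer hu'p
        have e6 := hu''.2
        have e7 := T.d_tri u'' p q
        have e8 := adj_cases hu''.1 q
        rw [T.d_comm u' q] at e8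
        rw [T.d_comm q p, T.d_comm p u'] at e4
        have : u'' = u := Closer.unique ⟨hu''.1, by rw [T.d_comm u' q]; omega⟩ hc
        subst this
        rw [T.d_comm u'' p, T.d_comm u' p] at e6
        omega

lemma closer_of_add {p q a u : W} (hq : T.Closer p a q) (h : T.d p u = T.d p q + T.d q u) :
    T.Closer p a u := by
  refine ⟨hq.1, ?_⟩
  have e1 := hq.2
  have e2 := T.d_tri a q u
  have := adj_cases hq.1 u
  omega

/-- Commuting elliptic elements have a common fixed vertex. -/
lemma exists_common_fixed (T : TreeAction A W) {x y : A} (hxy : Commute x y) {p q : W}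
    (hp : x • p = p)
    (hq : y • q = q) : ∃ v : W, x • v = v ∧ y • v = v := by
  obtain ⟨n, hn⟩ : ∃ n, T.d p q = n := ⟨_, rfl⟩
  induction n using Nat.strong_induction_on generalizing p q with
  | _ n ih =>
    by_cases hpq : p = q
    · subst hpq; exact ⟨p, hp, hq⟩
    obtain ⟨a, ha⟩ := T.exists_closer hpq
    obtain ⟨a', ha'⟩ := T.exists_closer (Ne.symm hpq)
    by_cases hya : y • a' = a'
    · refine ih (T.d a' p) ?_ hp hya (T.d_comm _ _)
      have := ha'.2
      rw [T.d_comm q p] at this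
      omega
    have hxyp : x • y • p = y • p := by
      rw [← mul_smul, hxy.eq, mul_smul, hp]
    have h1 : ¬ T.Closer q a' (y • p) := by
      intro hc
      have := ha'.smul y
      rw [hq] at this
      exact hya (this.unique hc)
    have h2 := d_add_of_not_closer ha' _ _ rfl h1
    have h3 := closer_of_add ha h2
    refine ih (T.d a q) ?_ (h3.fixed hp hxyp) hq rfl
    have := ha.2
    omega

end TreeAction

namespace TreeAction

variable {A W : Type} [Group A] [MulAction A W] (T : TreeAction A W) {x : A}

/-- The first step from `v` to `x • v`. -/
def step (hx : ∀ v : W, x • v ≠ v) (v : W) : W := (T.exists_closer (hx v).symm).choose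

lemma step_closer (hx : ∀ v : W, x • v ≠ v) (v : W) : T.Closer v (T.step hx v) (x • v) :=
  (T.exists_closer (hx v).symm).choose_spec

lemma smul_step (hx : ∀ v : W, x • v ≠ v) {y : A} (hy : Commute x y) (v : W) :
    y • T.step hx v = T.step hx (y • v) := by
  have h := (T.step_closer hx v).smul y
  rw [← mul_smul, ← hy.eq, mul_smul] at h
  exact h.unique (T.step_closer hx _)

lemma smul_step_iterate (hx : ∀ v : W, x • v ≠ v) {y : A} (hy : Commute x y) (v : W) (n : ℕ) :
    y • (T.step hx)^[n] v = (T.step hx)^[n] (y • v) := by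
  induction n generalizing v with
  | zero => rfl
  | succ n ih => rw [Function.iterate_succ_apply, ih, T.smul_step hx hy,
      Function.iterate_succ_apply]

lemma step_of_adj (hx : ∀ v : W, x • v ≠ v) {v w : W} (h : T.graph.Adj v w) :
    T.step hx v = w ∨ T.step hx w = v := by
  by_contra! hn
  have h1 := T.step_closer hx v
  have h2 := T.step_closer hx w
  have e1 : T.d w (x • v) = T.d v (x • v) + 1 := by
    rcases adj_cases h (x • v) with h' | h'
    · exact absurd (h1.unique ⟨h, h'⟩) hn.1
    · exact h'
  have e2 : T.d v (x • w) = T.d w (x • w) + 1 := by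
    rcases adj_cases h (x • w) with h' | h'
    · exact h'
    · exact absurd (h2.unique ⟨h.symm, h'⟩) hn.2
  have := separation h (T.adj_smul x h.symm) (by rw [T.d_comm, e2, T.d_comm])
    (by rw [T.d_comm, e1, T.d_comm])
  exact hx w this.1

lemma step_iterate_merge (hx : ∀ v : W, x • v ≠ v) (v w : W) :
    ∃ a b, (T.step hx)^[a] v = (T.step hx)^[b] w := by
  obtain ⟨p⟩ := T.isTree.connected v w
  induction p with
  | nil => exact ⟨0, 0, rfl⟩
  | cons h _ ih =>
    obtain ⟨c, e, hce⟩ := ih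
    rcases T.step_of_adj hx h with h' | h'
    · refine ⟨c + 1, e, ?_⟩
      rw [Function.iterate_succ_apply, h', hce]
    · refine ⟨c, e + 1, ?_⟩
      rw [Function.iterate_succ_apply', ← hce, ← Function.iterate_succ_apply' (T.step hx),
        Function.iterate_succ_apply, h']

/-- Pairs `(y, δ)` such that `y` commutes with `x` and eventually shifts the flow line through
`v` by `δ`. -/
def shift (hx : ∀ v : W, x • v ≠ v) (v : W) : Subgroup (A × Multiplicative ℤ) where
  carrier := {p | Commute x p.1 ∧ ∃ a b : ℕ, (b : ℤ) - a = p.2.toAdd ∧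
    p.1 • (T.step hx)^[a] v = (T.step hx)^[b] v}
  one_mem' := ⟨Commute.one_right _, 0, 0, by simp, by simp⟩
  inv_mem' := by
    rintro p ⟨h, a, b, h1, h2⟩
    refine ⟨h.inv_right, b, a, ?_, ?_⟩
    · rw [Prod.snd_inv, toAdd_inv, ← h1]; ring
    · rw [Prod.fst_inv, ← h2, inv_smul_smul]
  mul_mem' := by
    rintro p q ⟨h, a, b, h1, h2⟩ ⟨h', a', b', h1', h2'⟩
    refine ⟨h.mul_right h', a + a', b + b', ?_, ?_⟩
    · rw [Prod.snd_mul, toAdd_mul, ← h1, ← h1']; push_cast; ring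
    · rw [Prod.fst_mul, mul_smul, Function.iterate_add_apply, T.smul_step_iterate hx h', h2',
        ← Function.iterate_add_apply, add_comm a b', Function.iterate_add_apply,
        T.smul_step_iterate hx h, h2, ← Function.iterate_add_apply, add_comm b' b]

lemma exists_shift (hx : ∀ v : W, x • v ≠ v) (v : W) {y : A} (hy : Commute x y) :
    ∃ δ : ℤ, (y, Multiplicative.ofAdd δ) ∈ T.shift hx v := by
  obtain ⟨a, b, hab⟩ := T.step_iterate_merge hx (y • v) v
  exact ⟨(b : ℤ) - a, hy, a, b, rfl, by rw [T.smul_step_iterate hx hy]; exact hab⟩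

lemma fixed_of_shift_zero (hx : ∀ v : W, x • v ≠ v) (v : W) {y : A}
    (hy : (y, 1) ∈ T.shift hx v) :
    Commute x y ∧ ∃ a : ℕ, ∀ t, y • (T.step hx)^[t + a] v = (T.step hx)^[t + a] v := by
  obtain ⟨h, a, b, h1, h2⟩ := hy
  have hab : b = a := by simpa [sub_eq_zero] using h1
  subst hab
  refine ⟨h, b, fun t => ?_⟩
  rw [Function.iterate_add_apply, T.smul_step_iterate hx h, h2]

/-- If `x`, `y`, `z` commute and `x` has no fixed vertex, then some combinations of `x`, `y` and of
`x`, `z` fix a common edge. -/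
lemma exists_fixed_edge (hx : ∀ v : W, x • v ≠ v) {y z : A} (hy : Commute x y)
    (hz : Commute x z) :
    ∃ k l m : ℤ, k ≠ 0 ∧ ∃ v w : W, T.graph.Adj v w ∧
      (y ^ k * x ^ l) • v = v ∧ (y ^ k * x ^ l) • w = w ∧
      (z ^ k * x ^ m) • v = v ∧ (z ^ k * x ^ m) • w = w := by
  obtain ⟨v⟩ := T.isTree.connected.nonempty
  obtain ⟨k, hk⟩ := T.exists_shift hx v (Commute.refl x)
  obtain ⟨l, hl⟩ := T.exists_shift hx v hy
  obtain ⟨m, hm⟩ := T.exists_shift hx v hz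
  have hk0 : k ≠ 0 := by
    rintro rfl
    obtain ⟨-, a, ha⟩ := T.fixed_of_shift_zero hx v hk
    exact hx _ (ha 0)
  have key : ∀ (u : A) (l : ℤ), (u, Multiplicative.ofAdd l) ∈ T.shift hx v →
      ∃ a : ℕ, ∀ t, (u ^ k * x ^ (-l)) • (T.step hx)^[t + a] v = (T.step hx)^[t + a] v := by
    intro u l hl
    have := mul_mem (zpow_mem hl k) (zpow_mem hk (-l))
    refine (T.fixed_of_shift_zero hx v (y := u ^ k * x ^ (-l)) ?_).2
    convert! this using 1
    ext1
    · rfl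
    · change _ = Multiplicative.ofAdd l ^ k * Multiplicative.ofAdd k ^ (-l)
      rw [← ofAdd_zsmul, ← ofAdd_zsmul, ← ofAdd_add]
      simp [mul_comm]
  obtain ⟨a, ha⟩ := key y l hl
  obtain ⟨b, hb⟩ := key z m hm
  refine ⟨k, -l, -m, hk0, (T.step hx)^[b + a] v, (T.step hx)^[(b + 1) + a] v, ?_, ha b, ha (b + 1),
    ?_, ?_⟩
  · rw [add_right_comm, Function.iterate_succ_apply']
    exact (T.step_closer hx _).1
  · rw [add_comm b a]; exact hb a
  · have := hb (a + 1)
    rwa [show b + 1 + a = a + 1 + b by ring]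

end TreeAction

namespace Splitting

variable {A J : Type} [Group A] (T : Splitting A J)

/-- The action of a group on the Bass–Serre tree of a splitting. -/
def treeAction : TreeAction A T.Vert where
  graph := T.tree
  isTree := T.tree_isTree
  adj_smul := T.adj_smul
  col := Sum.isLeft
  col_smul := by rintro a (x | x) <;> rfl
  col_ne := by rintro x y ⟨g, j, ⟨rfl, rfl⟩ | ⟨rfl, rfl⟩⟩ <;> simp

lemma smul_cen_eq_iff (a g : A) : a • T.cen g = T.cen g ↔ g⁻¹ * a * g ∈ T.F := by
  rw [smul_cen, eq_comm, cen_eq_iff, mul_assoc]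

lemma smul_per_eq_iff (a g : A) (j : J) : a • T.per j g = T.per j g ↔ g⁻¹ * a * g ∈ T.H j := by
  rw [smul_per, eq_comm, per_eq_iff, mul_assoc]
  simp

lemma exists_cen_of_adj {v w : T.Vert} (h : T.treeAction.graph.Adj v w) :
    ∃ g, v = T.cen g ∨ w = T.cen g := by
  obtain ⟨g, j, ⟨rfl, rfl⟩ | ⟨rfl, rfl⟩⟩ := h
  · exact ⟨g, Or.inl rfl⟩
  · exact ⟨g, Or.inr rfl⟩

/-- Elements fixing two distinct vertices fix a common central vertex next to the first one or equal
to it. -/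
lemma exists_cen_fixed {v w : T.Vert} (h : v ≠ w) :
    ∃ g, ∀ a : A, a • v = v → a • w = w → a • T.cen g = T.cen g := by
  obtain ⟨u, hu⟩ := T.treeAction.exists_closer h
  obtain ⟨g, rfl | rfl⟩ := T.exists_cen_of_adj hu.1
  · exact ⟨g, fun a h1 _ => h1⟩
  · exact ⟨g, fun a h1 h2 => hu.fixed h1 h2⟩

end Splitting

lemma FreeGroup.eq_of_commute_of {X : Type} {a b : X}
    (h : Commute (FreeGroup.of a) (FreeGroup.of b)) : a = b := by
  classical
  by_contra hne
  let f : FreeGroup X →* Equiv.Perm (Fin 3) :=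
    FreeGroup.lift fun x => if x = a then Equiv.swap 0 1 else Equiv.swap 1 2
  have ha : f (FreeGroup.of a) = Equiv.swap 0 1 := by simp [f]
  have hb : f (FreeGroup.of b) = Equiv.swap 1 2 := by simp [f, Ne.symm hne]
  have h1 : f (FreeGroup.of a) * f (FreeGroup.of b) = f (FreeGroup.of b) * f (FreeGroup.of a) := by
    rw [← _root_.map_mul, h.eq, _root_.map_mul]
  rw [ha, hb] at h1
  revert h1
  decide

/-- Commuting elements of a free group satisfy a nontrivial relation. -/
lemma FreeGroup.exists_zpow_eq_of_commute {X : Type} {x y : FreeGroup X} (h : Commute x y) :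
    ∃ a b : ℤ, (a ≠ 0 ∨ b ≠ 0) ∧ x ^ a = y ^ b := by
  let K : Subgroup (FreeGroup X) := Subgroup.closure {x, y}
  have hcomm : ∀ u v : K, Commute u v := by
    have : ∀ u ∈ ({x, y} : Set (FreeGroup X)), ∀ v ∈ ({x, y} : Set (FreeGroup X)),
        u * v = v * u := by
      rintro u (rfl | rfl) v (rfl | rfl)
      exacts [rfl, h.eq, h.eq.symm, rfl]
    intro u v
    have := Subgroup.isMulCommutative_closure this
    exact mul_comm' u v
  let e := IsFreeGroup.toFreeGroup K
  have hsub : Subsingleton (IsFreeGroup.Generators K) := by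
    refine ⟨fun a b => FreeGroup.eq_of_commute_of ?_⟩
    have := (hcomm (e.symm (FreeGroup.of a)) (e.symm (FreeGroup.of b))).map e
    simpa using this
  have hx : x ∈ K := Subgroup.subset_closure (by simp)
  have hy : y ∈ K := Subgroup.subset_closure (by simp)
  have hcyc : IsCyclic K := by
    rcases isEmpty_or_nonempty (IsFreeGroup.Generators K) with hE | ⟨⟨g⟩⟩
    · have : Subsingleton K := e.toEquiv.subsingleton
      infer_instance
    · let : Unique (IsFreeGroup.Generators K) := ⟨⟨g⟩, fun _ => Subsingleton.elim _ _⟩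
      exact isCyclic_of_surjective e.symm e.symm.surjective
  obtain ⟨z, hz⟩ := hcyc.exists_generator
  obtain ⟨m, hm⟩ := hz ⟨x, hx⟩
  obtain ⟨k, hk⟩ := hz ⟨y, hy⟩
  have hm' : (z : FreeGroup X) ^ m = x := congrArg Subtype.val hm
  have hk' : (z : FreeGroup X) ^ k = y := congrArg Subtype.val hk
  by_cases h0 : m = 0 ∧ k = 0
  · refine ⟨1, 0, Or.inl one_ne_zero, ?_⟩
    rw [← hm', h0.1]; simp
  · refine ⟨k, m, by tauto, ?_⟩
    rw [← hm', ← hk', ← zpow_mul, ← zpow_mul, mul_comm]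

namespace RAAG

variable {V : Type} {G : SimpleGraph V}

lemma commute_gen {u v : V} (h : G.Adj u v) : Commute (gen G u) (gen G v) := by
  have : PresentedGroup.mk (raagRels G) _ = 1 := PresentedGroup.one_of_mem ⟨u, v, h, rfl⟩
  simp only [map_mul, map_inv] at this
  change gen G u * gen G v * (gen G u)⁻¹ * (gen G v)⁻¹ = 1 at this
  rw [mul_inv_eq_one, mul_inv_eq_iff_eq_mul] at this
  exact this

/-- The universal property of a right-angled Artin group. -/
def lift {H : Type} [Group H] (f : V → H) (hf : ∀ u v, G.Adj u v → Commute (f u) (f v)) :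
    RAAG G →* H :=
  PresentedGroup.toGroup (f := f) (by
    rintro r ⟨u, v, h, rfl⟩
    simp only [map_mul, map_inv, FreeGroup.lift_apply_of]
    rw [(hf u v h).eq]
    group)

@[simp]
lemma lift_gen {H : Type} [Group H] (f : V → H) (hf : ∀ u v, G.Adj u v → Commute (f u) (f v))
    (v : V) : lift f hf (gen G v) = f v :=
  PresentedGroup.toGroup.of _

lemma hom_ext {H : Type} [Group H] {f g : RAAG G →* H} (h : ∀ v, f (gen G v) = g (gen G v)) :
    f = g :=
  PresentedGroup.ext h

lemma mem_of_gen_mem {K : Subgroup (RAAG G)} (h : ∀ v, gen G v ∈ K) (g : RAAG G) : g ∈ K := by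
  have : Subgroup.closure (Set.range (gen G)) ≤ K := by
    rw [Subgroup.closure_le]
    rintro _ ⟨v, rfl⟩
    exact h v
  apply this
  rw [show gen G = PresentedGroup.of from rfl, PresentedGroup.closure_range_of]
  trivial

variable (G) in
/-- The subgroup generated by a set of vertices. -/
def par (S : Set V) : Subgroup (RAAG G) := Subgroup.closure (gen G '' S)

lemma gen_mem_par {S : Set V} {v : V} (h : v ∈ S) : gen G v ∈ par G S :=
  Subgroup.subset_closure ⟨v, h, rfl⟩

lemma par_le {S : Set V} {K : Subgroup (RAAG G)} (h : ∀ v ∈ S, gen G v ∈ K) : par G S ≤ K := by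
  rw [par, Subgroup.closure_le]
  rintro _ ⟨v, hv, rfl⟩
  exact h v hv

lemma par_mono {S T : Set V} (h : S ⊆ T) : par G S ≤ par G T :=
  par_le fun _ hv => gen_mem_par (h hv)

lemma map_eq_of_mem_par {H : Type} [Group H] {S : Set V} {f g : RAAG G →* H}
    (h : ∀ v ∈ S, f (gen G v) = g (gen G v)) {x : RAAG G} (hx : x ∈ par G S) : f x = g x :=
  par_le (K := f.eqLocus g) h hx

open Classical in
variable (G) in
/-- The retraction killing the vertices outside `S`. -/
def retr (S : Set V) : RAAG G →* RAAG G :=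
  lift (fun v => if v ∈ S then gen G v else 1) fun u v h => by
    split_ifs
    exacts [commute_gen h, Commute.one_right _, Commute.one_left _, Commute.one_left _]

lemma retr_gen_of_mem {S : Set V} {v : V} (h : v ∈ S) : retr G S (gen G v) = gen G v := by
  simp [retr, h]

lemma retr_gen_of_notMem {S : Set V} {v : V} (h : v ∉ S) : retr G S (gen G v) = 1 := by
  simp [retr, h]

lemma retr_eq {S : Set V} {x : RAAG G} (hx : x ∈ par G S) : retr G S x = x :=
  map_eq_of_mem_par (f := retr G S) (g := MonoidHom.id _) (fun _ => retr_gen_of_mem) hx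

lemma mem_par_inter {S T : Set V} {x : RAAG G} (hS : x ∈ par G S) (hT : x ∈ par G T) :
    x ∈ par G (S ∩ T) := by
  rw [← retr_eq hT]
  refine par_le (K := (par G (S ∩ T)).comap (retr G T)) (fun v hv => ?_) hS
  rw [Subgroup.mem_comap]
  by_cases h : v ∈ T
  · rw [retr_gen_of_mem h]; exact gen_mem_par ⟨hv, h⟩
  · rw [retr_gen_of_notMem h]; exact one_mem _

open Classical in
variable (G) in
/-- The abelianisation. -/
def ab : RAAG G →* Multiplicative (V → ℤ) :=
  lift (fun v => Multiplicative.ofAdd (Pi.single v 1)) fun _ _ _ => Commute.all _ _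

/-- The exponent sum of a vertex. -/
def expo (v : V) (g : RAAG G) : ℤ := (ab G g).toAdd v

lemma expo_mul (v : V) (g h : RAAG G) : expo v (g * h) = expo v g + expo v h := by
  simp [expo]

lemma expo_inv (v : V) (g : RAAG G) : expo v g⁻¹ = - expo v g := by
  simp [expo]

lemma expo_one (v : V) : expo v (1 : RAAG G) = 0 := by
  simp [expo]

lemma expo_zpow (v : V) (g : RAAG G) (k : ℤ) : expo v (g ^ k) = k * expo v g := by
  simp [expo]

lemma expo_gen_self (v : V) : expo v (gen G v) = 1 := by
  simp [expo, ab]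

lemma expo_gen_of_ne {u v : V} (h : u ≠ v) : expo v (gen G u) = 0 := by
  simp [expo, ab, h.symm]

lemma expo_conj (v : V) (g h : RAAG G) : expo v (g * h * g⁻¹) = expo v h := by
  rw [expo_mul, expo_mul, expo_inv]; ring

lemma expo_conj' (v : V) (g h : RAAG G) : expo v (g⁻¹ * h * g) = expo v h := by
  rw [expo_mul, expo_mul, expo_inv]; ring

lemma expo_eq_zero {S : Set V} {v : V} (hv : v ∉ S) {g : RAAG G} (hg : g ∈ par G S) :
    expo v g = 0 := by
  let f : RAAG G →* Multiplicative ℤ :=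
    { toFun := fun g => Multiplicative.ofAdd (expo v g)
      map_one' := by rw [expo_one]; rfl
      map_mul' := fun g h => by rw [expo_mul]; rfl }
  have := map_eq_of_mem_par (f := f) (g := 1) (S := S) (fun u hu => by
    change Multiplicative.ofAdd (expo v (gen G u)) = 1
    rw [expo_gen_of_ne (by rintro rfl; exact hv hu)]; rfl) hg
  exact this

/-- The linear map induced on the abelianisation. -/
def lin [Fintype V] (φ : RAAG G →* RAAG G) : (V → ℤ) →ₗ[ℤ] (V → ℤ) :=
  Fintype.linearCombination ℤ fun v => (ab G (φ (gen G v))).toAdd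

lemma lin_ab [Fintype V] (φ : RAAG G →* RAAG G) (g : RAAG G) :
    lin φ (ab G g).toAdd = (ab G (φ g)).toAdd := by
  classical
  have : ((AddMonoidHom.toMultiplicative (lin φ).toAddMonoidHom).comp (ab G)) = (ab G).comp φ := by
    refine hom_ext fun v => ?_
    apply Multiplicative.toAdd.injective
    simp [ab, lin]
  exact congrArg Multiplicative.toAdd (DFunLike.congr_fun this g)

lemma lin_injective [Fintype V] (φ : MulAut (RAAG G)) :
    Function.Injective (lin φ.toMonoidHom) := by
  classical
  have : (lin (φ⁻¹).toMonoidHom) ∘ₗ (lin φ.toMonoidHom) = LinearMap.id := by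
    refine LinearMap.pi_ext' fun v => LinearMap.ext_ring ?_
    have h1 : (Pi.single v 1 : V → ℤ) = (ab G (gen G v)).toAdd := by simp [ab]
    simp only [LinearMap.comp_apply, LinearMap.single_apply, LinearMap.id_apply]
    rw [h1, lin_ab, lin_ab]
    congr 2
    exact φ.symm_apply_apply _
  exact Function.LeftInverse.injective (g := lin (φ⁻¹).toMonoidHom) (LinearMap.congr_fun this)

lemma ncard_le_of_map_le [Fintype V] (φ : MulAut (RAAG G)) {S T : Set V} {g : RAAG G}
    (h : ∀ x ∈ par G S, g⁻¹ * φ x * g ∈ par G T) : S.ncard ≤ T.ncard := by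
  classical
  let f : (S → ℤ) →ₗ[ℤ] (T → ℤ) :=
    LinearMap.funLeft ℤ ℤ (Subtype.val : T → V) ∘ₗ lin φ.toMonoidHom ∘ₗ
      Function.ExtendByZero.linearMap ℤ (Subtype.val : S → V)
  have hf : Function.Injective f := by
    rw [injective_iff_map_eq_zero]
    intro c hc
    let x : V → ℤ := Function.ExtendByZero.linearMap ℤ (Subtype.val : S → V) c
    have hx : x = fun v => if h : v ∈ S then c ⟨v, h⟩ else 0 := by
      ext v
      by_cases hv : v ∈ S
      · simpa [x, hv] using Subtype.val_injective.extend_apply c 0 ⟨v, hv⟩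
      · simp only [x, Function.ExtendByZero.linearMap_apply, hv, dite_false]
        exact Function.extend_apply' _ _ _ (by rintro ⟨a, rfl⟩; exact hv a.2)
    have h0 : lin φ.toMonoidHom x = 0 := by
      ext v
      by_cases hv : v ∈ T
      · exact congrFun hc ⟨v, hv⟩
      · simp only [lin, Fintype.linearCombination_apply, Finset.sum_apply, Pi.smul_apply,
          smul_eq_mul, Pi.zero_apply]
        refine Finset.sum_eq_zero fun u _ => ?_
        by_cases hu : u ∈ S
        · have := expo_eq_zero hv (h _ (gen_mem_par hu))
          rw [expo_conj'] at this
          exact mul_eq_zero_of_right _ this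
        · rw [hx]; simp [hu]
    have h1 : x = 0 := lin_injective φ (h0.trans (map_zero _).symm)
    ext s
    simpa [hx] using congrFun h1 s
  have := card_le_of_injective ℤ f hf
  simpa [Set.ncard_eq_toFinset_card'] using this

/-- Commuting elements of the free subgroup on an independent set of vertices satisfy a nontrivial
relation. -/
lemma exists_zpow_eq_of_commute {L : Set V} (hL : ∀ u ∈ L, ∀ v ∈ L, ¬ G.Adj u v) {x y : RAAG G}
    (hx : x ∈ par G L) (hy : y ∈ par G L) (h : Commute x y) :
    ∃ a b : ℤ, (a ≠ 0 ∨ b ≠ 0) ∧ x ^ a = y ^ b := by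
  classical
  let f : RAAG G →* FreeGroup V := lift (fun v => if v ∈ L then FreeGroup.of v else 1)
    fun u v huv => by
      by_cases hu : u ∈ L
      · have hv : v ∉ L := fun hv => hL u hu v hv huv
        simp [hv]
      · simp [hu]
  let k : FreeGroup V →* RAAG G := FreeGroup.lift (gen G)
  have hk : ∀ z ∈ par G L, k (f z) = z := fun z hz =>
    map_eq_of_mem_par (f := k.comp f) (g := MonoidHom.id _) (fun v hv => by simp [f, k, hv]) hz
  obtain ⟨a, b, hab, he⟩ := FreeGroup.exists_zpow_eq_of_commute (h.map f)
  refine ⟨a, b, hab, ?_⟩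
  simpa only [map_zpow, hk x hx, hk y hy] using congrArg k he

section Splitting

open Monoid

variable {J : Type} (Q : J → Set V) (L : Set V)

/-- A covering of a graph by subsets meeting pairwise in `L` and containing all the edges induces
a splitting of the right-angled Artin group. -/
def splitting (hLQ : ∀ j, L ⊆ Q j) (hQ : ∀ i j, i ≠ j → Q i ∩ Q j ⊆ L)
    (hv : ∀ v, ∃ j, v ∈ Q j) (he : ∀ u v, G.Adj u v → ∃ j, u ∈ Q j ∧ v ∈ Q j) :
    Splitting (RAAG G) J := by
  let le : ∀ j, par G L ≤ par G (Q j) := fun j => par_mono (hLQ j)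
  let o : ∀ v, PushoutI fun j => Subgroup.inclusion (le j) := fun v =>
    PushoutI.of (hv v).choose ⟨gen G v, gen_mem_par (hv v).choose_spec⟩
  have ho : ∀ v j (h : v ∈ Q j), o v = PushoutI.of j ⟨gen G v, gen_mem_par h⟩ := by
    intro v j h
    by_cases hj : (hv v).choose = j
    · subst hj; rfl
    · have hvL : v ∈ L := hQ _ _ hj ⟨(hv v).choose_spec, h⟩
      have h1 := PushoutI.of_apply_eq_base (fun j => Subgroup.inclusion (le j)) j
        ⟨gen G v, gen_mem_par hvL⟩
      have h2 := PushoutI.of_apply_eq_base (fun j => Subgroup.inclusion (le j)) (hv v).choose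
        ⟨gen G v, gen_mem_par hvL⟩
      exact h2.trans h1.symm
  let r : RAAG G →* PushoutI fun j => Subgroup.inclusion (le j) := lift o fun u v h => by
    obtain ⟨j, hu, hv⟩ := he u v h
    rw [ho u j hu, ho v j hv]
    refine Commute.map ?_ _
    exact Subtype.ext (commute_gen h).eq
  refine Splitting.ofPushout (fun j => par G (Q j)) (par G L) le r ?_ ?_ ?_
  · let s : (PushoutI fun j => Subgroup.inclusion (le j)) →* RAAG G :=
      PushoutI.lift (fun j => (par G (Q j)).subtype) (par G L).subtype fun j => by ext; rfl
    refine Function.LeftInverse.injective (g := s) fun g => ?_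
    refine DFunLike.congr_fun (f := s.comp r) (g := MonoidHom.id _) (hom_ext fun v => ?_) g
    obtain ⟨j, hj⟩ := hv v
    simp [r, s, ho v j hj]
  · rintro j ⟨h, hh⟩
    change h ∈ Subgroup.closure _ at hh
    induction hh using Subgroup.closure_induction with
    | mem x hx =>
      obtain ⟨v, hvj, rfl⟩ := hx
      simp only [r, lift_gen]
      exact ho v j hvj
    | one => rw [map_one]; exact (map_one (PushoutI.of j)).symm
    | mul x y hx hy ihx ihy =>
      rw [map_mul, ihx, ihy]
      exact (map_mul (PushoutI.of (φ := fun j => Subgroup.inclusion (le j)) j)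
        (⟨x, hx⟩ : par G (Q j)) ⟨y, hy⟩).symm
    | inv x hx ih =>
      rw [map_inv, ih]
      exact (map_inv (PushoutI.of (φ := fun j => Subgroup.inclusion (le j)) j)
        (⟨x, hx⟩ : par G (Q j))).symm
  · rw [eq_top_iff]
    intro g _
    refine mem_of_gen_mem (fun v => ?_) g
    obtain ⟨j, hj⟩ := hv v
    exact le_iSup (fun j => par G (Q j)) j (gen_mem_par hj)

end Splitting

/-- The centraliser of a vertex is generated by its star. -/
lemma mem_par_of_commute_gen {v : V} {g : RAAG G} (h : Commute g (gen G v)) :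
    g ∈ par G (insert v (G.neighborSet v)) := by
  let Q : Bool → Set V := fun b => if b then insert v (G.neighborSet v) else {v}ᶜ
  have hQt : Q true = insert v (G.neighborSet v) := rfl
  have hQf : Q false = {v}ᶜ := rfl
  have hnv : v ∉ G.neighborSet v := G.loopless.irrefl v
  let T : Splitting (RAAG G) Bool := splitting (G := G) Q (G.neighborSet v)
    (by
      rintro (_ | _)
      · rintro u hu rfl; exact hnv hu
      · exact Set.subset_insert _ _)
    (by
      rintro (_ | _) (_ | _) hij
      · exact absurd rfl hij
      · rintro u ⟨h1, rfl | h2⟩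
        exacts [absurd rfl h1, h2]
      · rintro u ⟨rfl | h2, h1⟩
        exacts [absurd rfl h1, h2]
      · exact absurd rfl hij)
    (by
      intro u
      by_cases hu : u = v
      · exact ⟨true, Or.inl hu⟩
      · exact ⟨false, hu⟩)
    (by
      intro u w huw
      by_cases hu : u = v
      · subst hu; exact ⟨true, Or.inl rfl, Or.inr huw⟩
      · by_cases hw : w = v
        · subst hw; exact ⟨true, Or.inr huw.symm, Or.inl rfl⟩
        · exact ⟨false, hu, hw⟩)
  have hT : T.H true = par G (insert v (G.neighborSet v)) := rfl
  have hv : gen G v ∈ T.H true := by rw [hT]; exact gen_mem_par (Set.mem_insert _ _)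
  have h1 : gen G v • T.per true 1 = T.per true 1 := by
    rw [T.smul_per_eq_iff]; simpa using hv
  have h2 : gen G v • T.per true g = T.per true g := by
    rw [T.smul_per_eq_iff, mul_assoc, ← h.eq]; simpa using hv
  have h3 : T.per true 1 = T.per true g := by
    by_contra hne
    obtain ⟨k, hk⟩ := T.exists_cen_fixed hne
    have h4 := (T.smul_cen_eq_iff _ _).1 (hk _ h1 h2)
    have h5 : expo v (k⁻¹ * gen G v * k) = 0 := expo_eq_zero hnv h4
    rw [expo_conj', expo_gen_self] at h5
    exact one_ne_zero h5
  rw [T.per_eq_iff] at h3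
  rw [← hT]; simpa using h3.2

lemma retr_mem (S : Set V) (g : RAAG G) : retr G S g ∈ par G S := by
  refine mem_of_gen_mem (K := (par G S).comap (retr G S)) (fun v => ?_) g
  rw [Subgroup.mem_comap]
  by_cases h : v ∈ S
  · rw [retr_gen_of_mem h]; exact gen_mem_par h
  · rw [retr_gen_of_notMem h]; exact one_mem _

lemma mem_par_iInter {I : Type} {S : Set I} (hS : S.Finite) {T : I → Set V} {x : RAAG G}
    (h : ∀ a ∈ S, x ∈ par G (T a)) : x ∈ par G {w | ∀ a ∈ S, w ∈ T a} := by
  induction S, hS using Set.Finite.induction_on with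
  | empty => exact mem_of_gen_mem (fun v => gen_mem_par (by simp)) x
  | insert _ _ ih =>
    refine par_mono ?_ (mem_par_inter (h _ (Set.mem_insert _ _))
      (ih fun a ha => h a (Set.mem_insert_of_mem _ ha)))
    rintro w ⟨h1, h2⟩ a (rfl | ha)
    exacts [h1, h2 a ha]

lemma commute_of_mem_par {S : Set V} {x y : RAAG G} (h : ∀ v ∈ S, Commute x (gen G v))
    (hy : y ∈ par G S) : Commute x y := by
  have := par_le (K := Subgroup.centralizer {x}) (fun v hv => by
    rw [Subgroup.mem_centralizer_singleton_iff]; exact (h v hv).eq.symm) hy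
  rw [Subgroup.mem_centralizer_singleton_iff] at this
  exact this.symm

/-- Two commuting elements generating a free abelian group of rank two. -/
def Indep {A : Type} [Group A] (x y : A) : Prop :=
  Commute x y ∧ ∀ a b : ℤ, x ^ a = y ^ b → a = 0 ∧ b = 0

lemma Indep.map {A B : Type} [Group A] [Group B] {x y : A} (h : Indep x y) {f : A →* B}
    (hf : Function.Injective f) : Indep (f x) (f y) :=
  ⟨h.1.map f, fun a b e => h.2 a b (hf (by rw [map_zpow, map_zpow, e]))⟩

lemma indep_gen {p q s : V} (hpq : G.Adj p q) (hps : G.Adj p s) (hqs : G.Adj q s) {k : ℤ}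
    (hk : k ≠ 0) (l m : ℤ) :
    Indep (gen G q ^ k * gen G p ^ l) (gen G s ^ k * gen G p ^ m) := by
  have c1 := commute_gen hpq
  have c2 := commute_gen hps
  have c3 := commute_gen hqs
  refine ⟨?_, fun a b h => ?_⟩
  · refine Commute.mul_left (Commute.mul_right ?_ ?_) (Commute.mul_right ?_ ?_)
    exacts [c3.zpow_zpow _ _, c1.symm.zpow_zpow _ _, c2.zpow_zpow _ _,
      (Commute.refl _).zpow_zpow _ _]
  · have e1 := congrArg (expo q) h
    have e2 := congrArg (expo s) h
    simp only [expo_zpow, expo_mul, expo_gen_self, expo_gen_of_ne hpq.ne, expo_gen_of_ne hps.ne,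
      expo_gen_of_ne hqs.ne, expo_gen_of_ne hqs.ne.symm, mul_zero, mul_one, add_zero, zero_eq_mul,
      mul_eq_zero, hk, or_false] at e1 e2
    exact ⟨e1, e2⟩

lemma indep_gen_gen {p q : V} (h : G.Adj p q) : Indep (gen G p) (gen G q) := by
  refine ⟨commute_gen h, fun a b e => ?_⟩
  have e1 := congrArg (expo p) e
  have e2 := congrArg (expo q) e
  simp only [expo_zpow, expo_gen_self, expo_gen_of_ne h.ne, expo_gen_of_ne h.ne.symm,
    mul_zero, mul_one] at e1 e2
  exact ⟨e1, e2.symm⟩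

end RAAG

open RAAG

/-- The block of the blob `i`: its vertices and the link of `c`. -/
def block {V : Type} {n : ℕ} (G : SimpleGraph V) (c : V) (b : V → Option (Fin (n + 1)))
    (i : Fin (n + 1)) : Set V :=
  {u | G.Adj c u ∨ b u = some i}

/-- The graph is a cone from `c` over an independent set, to which disjoint cliques ("blobs"),
labelled by `b`, are attached. -/
structure BlobGraph {V : Type} {n : ℕ} (G : SimpleGraph V) (c : V)
    (b : V → Option (Fin (n + 1))) : Prop where
  eq_none_iff : ∀ u, b u = none ↔ u = c ∨ G.Adj c u
  indep : ∀ u v, G.Adj c u → G.Adj c v → ¬ G.Adj u v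
  adj_iff : ∀ u w i j, b u = some i → b w = some j → (G.Adj u w ↔ i = j ∧ u ≠ w)
  three : ∀ i, ∃ p q s, b p = some i ∧ b q = some i ∧ b s = some i ∧ p ≠ q ∧ p ≠ s ∧ q ≠ s
  two : ∀ u, G.Adj c u → ∀ i, ∃ p q, b p = some i ∧ b q = some i ∧ p ≠ q ∧ G.Adj u p ∧ G.Adj u q
  cone : ∀ w, (∀ a, G.Adj c a → w = a ∨ G.Adj a w) → w = c
  card : Function.Injective fun i => (block G c b i).ncard

namespace BlobGraph

variable {V : Type} {n : ℕ} {G : SimpleGraph V} {c : V} {b : V → Option (Fin (n + 1))}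

lemma notMem_block (B : BlobGraph G c b) (i : Fin (n + 1)) : c ∉ block G c b i := by
  rintro (h | h)
  · exact G.loopless.irrefl c h
  · rw [(B.eq_none_iff c).2 (Or.inl rfl)] at h
    cases h

lemma link_subset_block (i : Fin (n + 1)) : G.neighborSet c ⊆ block G c b i := fun _ => Or.inl

lemma ne_none (B : BlobGraph G c b) {u : V} {i : Fin (n + 1)} (h : b u = some i) :
    u ≠ c ∧ ¬ G.Adj c u := by
  have := (B.eq_none_iff u).not.1 (by simp [h])
  tauto

lemma adj (B : BlobGraph G c b) {u w : V} {i : Fin (n + 1)} (hu : b u = some i) (hw : b w = some i)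
    (h : u ≠ w) : G.Adj u w := (B.adj_iff u w i i hu hw).2 ⟨rfl, h⟩

lemma exists_mem_block (B : BlobGraph G c b) {u : V} (h : u ≠ c) : ∃ i, u ∈ block G c b i := by
  rcases hb : b u with _ | i
  · exact ⟨0, Or.inl (((B.eq_none_iff u).1 hb).resolve_left h)⟩
  · exact ⟨i, Or.inr hb⟩

/-- The pieces of the splitting: the star of `c` and the blocks. -/
def piece (G : SimpleGraph V) (c : V) (b : V → Option (Fin (n + 1))) :
    Option (Fin (n + 1)) → Set V
  | none => insert c (G.neighborSet c)
  | some i => block G c b i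

/-- The splitting over the link of `c`. -/
def split (B : BlobGraph G c b) : Splitting (RAAG G) (Option (Fin (n + 1))) :=
  splitting (G := G) (piece G c b) (G.neighborSet c)
    (by
      rintro (_ | i)
      · exact Set.subset_insert _ _
      · exact link_subset_block i)
    (by
      rintro (_ | i) (_ | j) hij u ⟨h1, h2⟩
      · exact absurd rfl hij
      · rcases h1 with rfl | h1
        · exact absurd h2 (B.notMem_block j)
        · exact h1
      · rcases h2 with rfl | h2
        · exact absurd h1 (B.notMem_block i)
        · exact h2
      · rcases h1 with h1 | h1
        · exact h1
        · rcases h2 with h2 | h2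
          · exact h2
          · exact absurd (h1.symm.trans h2) hij)
    (by
      intro v
      by_cases h : v = c
      · exact ⟨none, Or.inl h⟩
      · obtain ⟨i, hi⟩ := B.exists_mem_block h
        exact ⟨some i, hi⟩)
    (by
      intro u v huv
      by_cases h : u = c
      · subst h; exact ⟨none, Or.inl rfl, Or.inr huv⟩
      by_cases h' : v = c
      · subst h'; exact ⟨none, Or.inr huv.symm, Or.inl rfl⟩
      obtain ⟨i, hi⟩ := B.exists_mem_block h
      obtain ⟨j, hj⟩ := B.exists_mem_block h'
      rcases hi with hi | hi
      · exact ⟨some j, Or.inl hi, hj⟩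
      · rcases hj with hj | hj
        · exact ⟨some i, Or.inr hi, Or.inl hj⟩
        · obtain ⟨rfl, _⟩ := (B.adj_iff u v i j hi hj).1 huv
          exact ⟨some i, Or.inr hi, Or.inr hj⟩)

lemma split_F (B : BlobGraph G c b) : B.split.F = par G (G.neighborSet c) := rfl

lemma split_H_none (B : BlobGraph G c b) :
    B.split.H none = par G (insert c (G.neighborSet c)) := rfl

lemma split_H_some (B : BlobGraph G c b) (i : Fin (n + 1)) :
    B.split.H (some i) = par G (block G c b i) := rfl

lemma commute_link {x : RAAG G} (hx : x ∈ par G (G.neighborSet c)) : Commute (gen G c) x :=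
  commute_of_mem_par (fun _ hv => commute_gen hv) hx

lemma commute_star {x : RAAG G} (hx : x ∈ par G (insert c (G.neighborSet c))) :
    Commute (gen G c) x :=
  commute_of_mem_par (by
    rintro v (rfl | hv)
    exacts [Commute.refl _, commute_gen hv]) hx

lemma exists_zpow_of_commute_link [Finite V] (B : BlobGraph G c b) {x : RAAG G}
    (h : ∀ y ∈ par G (G.neighborSet c), Commute x y) : ∃ k : ℤ, x = gen G c ^ k := by
  have h1 := mem_par_iInter (Set.toFinite (G.neighborSet c)) fun a ha =>
    mem_par_of_commute_gen (h _ (gen_mem_par ha))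
  have h2 : x ∈ par G {c} := par_mono (fun w hw => B.cone w hw) h1
  rw [par, Set.image_singleton, Subgroup.mem_closure_singleton] at h2
  obtain ⟨k, hk⟩ := h2
  exact ⟨k, hk.symm⟩

lemma eq_one_of_commute_block [Finite V] (B : BlobGraph G c b) {x : RAAG G} {i : Fin (n + 1)}
    (h : ∀ y ∈ par G (block G c b i), Commute x y) : x = 1 := by
  obtain ⟨k, rfl⟩ := B.exists_zpow_of_commute_link fun y hy =>
    h y (par_mono (link_subset_block i) hy)
  obtain ⟨p, -, -, hp, -⟩ := B.three i
  have h1 := mem_par_of_commute_gen (h _ (gen_mem_par (Or.inr hp)))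
  have hc : c ∉ insert p (G.neighborSet p) := by
    rintro (h | h)
    · exact (B.ne_none hp).1 h.symm
    · exact (B.ne_none hp).2 (G.adj_symm h)
  have h2 := expo_eq_zero hc h1
  rw [expo_zpow, expo_gen_self, mul_one] at h2
  rw [h2, zpow_zero]

section Fixed

variable (B : BlobGraph G c b) {x y : RAAG G} {v w : B.split.Vert}

lemma not_fixed_cen (h : Indep x y) (g : RAAG G)
    (hx : x • B.split.cen g = B.split.cen g) (hy : y • B.split.cen g = B.split.cen g) : False := by
  rw [Splitting.smul_cen_eq_iff, split_F] at hx hy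
  have hi := h.map (f := (MulAut.conj g⁻¹).toMonoidHom) (MulAut.conj g⁻¹).injective
  simp only [MulEquiv.toMonoidHom_eq_coe, MonoidHom.coe_coe, MulAut.conj_apply, inv_inv] at hi
  obtain ⟨k, l, hkl, e⟩ := exists_zpow_eq_of_commute (fun u hu v hv => B.indep u v hu hv) hx hy hi.1
  have := hi.2 k l e
  tauto

lemma eq_of_fixed (h : Indep x y) (hxv : x • v = v) (hyv : y • v = v) (hxw : x • w = w)
    (hyw : y • w = w) : v = w := by
  by_contra hne
  obtain ⟨g, hg⟩ := B.split.exists_cen_fixed hne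
  exact B.not_fixed_cen h g (hg _ hxv hxw) (hg _ hyv hyw)

lemma fixed_of_commute (h : Indep x y) (hxv : x • v = v) (hyv : y • v = v) {z : RAAG G}
    (hx : Commute z x) (hy : Commute z y) : z • v = v := by
  refine B.eq_of_fixed h ?_ ?_ hxv hyv
  · rw [← mul_smul, ← hx.eq, mul_smul, hxv]
  · rw [← mul_smul, ← hy.eq, mul_smul, hyv]

lemma exists_fixed (φ : MulAut (RAAG G)) {p q s : V} (hpq : G.Adj p q) (hps : G.Adj p s)
    (hqs : G.Adj q s) : ∃ v : B.split.Vert, φ (gen G p) • v = v := by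
  by_contra! hx
  obtain ⟨k, l, m, hk, v, w, hvw, h1, h2, h3, h4⟩ := B.split.treeAction.exists_fixed_edge hx
    ((commute_gen hpq).map φ) ((commute_gen hps).map φ)
  obtain ⟨g, hg⟩ := B.split.exists_cen_fixed hvw.ne
  have hi := (indep_gen hpq hps hqs hk l m).map (f := φ.toMonoidHom) φ.injective
  refine B.not_fixed_cen hi g ?_ ?_
  · simpa using hg _ h1 h2
  · simpa using hg _ h3 h4

lemma exists_fixed_block (φ : MulAut (RAAG G)) (i : Fin (n + 1)) :
    ∃ v : B.split.Vert, ∀ x ∈ par G (block G c b i), φ x • v = v := by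
  obtain ⟨p, q, s, hp, hq, hs, hpq, hps, hqs⟩ := B.three i
  have apq := B.adj hp hq hpq
  have aps := B.adj hp hs hps
  have aqs := B.adj hq hs hqs
  obtain ⟨v1, h1⟩ := B.exists_fixed φ apq aps aqs
  obtain ⟨v2, h2⟩ := B.exists_fixed φ apq.symm aqs aps
  obtain ⟨v, hv1, hv2⟩ := B.split.treeAction.exists_common_fixed ((commute_gen apq).map φ) h1 h2
  have hI : ∀ {p q : V}, G.Adj p q → Indep (φ (gen G p)) (φ (gen G q)) := fun h =>
    (indep_gen_gen h).map (f := φ.toMonoidHom) φ.injective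
  have hP : ∀ u, b u = some i → φ (gen G u) • v = v := by
    intro u hu
    by_cases e1 : u = p
    · rw [e1, hv1]
    by_cases e2 : u = q
    · rw [e2, hv2]
    exact B.fixed_of_commute (hI apq) hv1 hv2 ((commute_gen (B.adj hu hp e1)).map φ)
      ((commute_gen (B.adj hu hq e2)).map φ)
  refine ⟨v, par_le (K := (MulAction.stabilizer _ v).comap φ.toMonoidHom) ?_⟩
  rintro u (hu | hu)
  · obtain ⟨p', q', hp', hq', hne, h1, h2⟩ := B.two u hu i
    exact B.fixed_of_commute (hI (B.adj hp' hq' hne)) (hP _ hp') (hP _ hq')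
      ((commute_gen h1).map φ) ((commute_gen h2).map φ)
  · exact hP u hu

lemma eq_of_fixed_block (φ : MulAut (RAAG G)) (i : Fin (n + 1))
    (hv : ∀ x ∈ par G (block G c b i), φ x • v = v)
    (hw : ∀ x ∈ par G (block G c b i), φ x • w = w) : v = w := by
  obtain ⟨p, q, s, hp, hq, hs, hpq, hps, hqs⟩ := B.three i
  have hI := (indep_gen_gen (B.adj hp hq hpq)).map (f := φ.toMonoidHom) φ.injective
  have mp := gen_mem_par (G := G) (S := block G c b i) (Or.inr hp)
  have mq := gen_mem_par (G := G) (S := block G c b i) (Or.inr hq)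
  exact B.eq_of_fixed hI (hv _ mp) (hv _ mq) (hw _ mp) (hw _ mq)

lemma fixed_per_iff (φ : MulAut (RAAG G)) (i j : Fin (n + 1)) (g : RAAG G) :
    (∀ x ∈ par G (block G c b i), φ x • B.split.per (some j) g = B.split.per (some j) g) ↔
      ∀ x ∈ par G (block G c b i), g⁻¹ * φ x * g ∈ par G (block G c b j) := by
  simp only [Splitting.smul_per_eq_iff, split_H_some]

lemma exists_block [Finite V] (B : BlobGraph G c b) (φ : MulAut (RAAG G)) (i : Fin (n + 1)) :
    ∃ j g, ∀ x ∈ par G (block G c b i), g⁻¹ * φ x * g ∈ par G (block G c b j) := by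
  obtain ⟨v, hv⟩ := B.exists_fixed_block φ i
  have key : ∀ g, (∀ x ∈ par G (block G c b i), Commute (gen G c) (g⁻¹ * φ x * g)) → False := by
    intro g hg
    have h1 : φ⁻¹ (g * gen G c * g⁻¹) = 1 := B.eq_one_of_commute_block (i := i) fun y hy => by
      have := ((hg y hy).map (MulAut.conj g)).map φ⁻¹
      simp only [MulAut.conj_apply] at this
      convert this using 1
      rw [show g * (g⁻¹ * φ y * g) * g⁻¹ = φ y by group, MulAut.inv_apply_self]
    rw [map_eq_one_iff _ φ⁻¹.injective] at h1
    have h2 := congrArg (expo c) h1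
    rw [expo_conj, expo_gen_self, expo_one] at h2
    exact one_ne_zero h2
  revert hv
  refine B.split.forall_vert (p := fun v => (∀ x ∈ par G (block G c b i), φ x • v = v) → _)
    (fun g hv => ?_) (fun j g hv => ?_) v
  · refine (key g fun x hx => ?_).elim
    have := hv x hx
    rw [Splitting.smul_cen_eq_iff, split_F] at this
    exact commute_link this
  · rcases j with _ | j
    · refine (key g fun x hx => ?_).elim
      have := hv x hx
      rw [Splitting.smul_per_eq_iff, split_H_none] at this
      exact commute_star this
    · exact ⟨j, g, (B.fixed_per_iff φ i j g).1 hv⟩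

lemma exists_conj_block [Finite V] (B : BlobGraph G c b) (φ : MulAut (RAAG G)) (i : Fin (n + 1)) :
    ∃ g, ∀ x ∈ par G (block G c b i), g⁻¹ * φ x * g ∈ par G (block G c b i) := by
  have := Fintype.ofFinite V
  obtain ⟨j, g, hg⟩ := B.exists_block φ i
  obtain ⟨k, h, hh⟩ := B.exists_block φ⁻¹ j
  have hk : B.split.per (some i) 1 = B.split.per (some k) (φ⁻¹ g * h) := by
    refine B.eq_of_fixed_block 1 i ((B.fixed_per_iff 1 i i 1).2 (by simp))
      ((B.fixed_per_iff 1 i k _).2 fun x hx => ?_)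
    have := hh _ (hg x hx)
    simp only [map_mul, map_inv, MulAut.inv_apply_self] at this
    convert this using 1
    simp only [MulAut.one_apply]
    group
  have hik : i = k := by
    have := ((B.split.per_eq_iff _ _ _ _).1 hk).1
    exact Option.some_injective _ this
  subst hik
  have h1 := ncard_le_of_map_le φ hg
  have h2 := ncard_le_of_map_le φ⁻¹ hh
  have : j = i := B.card (le_antisymm h2 h1)
  subst this
  exact ⟨g, hg⟩

end Fixed

lemma hom_ext (B : BlobGraph G c b) {H : Type} [Group H] {f g : RAAG G →* H}
    (hc : f (gen G c) = g (gen G c))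
    (h : ∀ i, ∀ x ∈ par G (block G c b i), f x = g x) : f = g := by
  refine RAAG.hom_ext fun v => ?_
  by_cases hv : v = c
  · rw [hv, hc]
  · obtain ⟨i, hi⟩ := B.exists_mem_block hv
    exact h i _ (gen_mem_par hi)

lemma aut_ext (B : BlobGraph G c b) {φ ψ : MulAut (RAAG G)} (hc : φ (gen G c) = ψ (gen G c))
    (h : ∀ i, ∀ x ∈ par G (block G c b i), φ x = ψ x) : φ = ψ := by
  have := B.hom_ext (f := φ.toMonoidHom) (g := ψ.toMonoidHom) hc h
  exact MulEquiv.ext fun x => DFunLike.congr_fun this x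

variable (G c b) in
/-- `φ` maps `c` to `c ^ ε` and the block `i` into its conjugate by `c ^ m i`. -/
structure Adapted (φ : MulAut (RAAG G)) (ε : ℤˣ) (m : Fin (n + 1) → ℤ) : Prop where
  map_center : φ (gen G c) = gen G c ^ (ε : ℤ)
  map_block : ∀ i, ∀ x ∈ par G (block G c b i),
    (gen G c ^ m i)⁻¹ * φ x * gen G c ^ m i ∈ par G (block G c b i)

lemma Adapted.exists_eq {φ : MulAut (RAAG G)} {ε : ℤˣ} {m : Fin (n + 1) → ℤ}
    (h : Adapted G c b φ ε m) {i : Fin (n + 1)} {x : RAAG G} (hx : x ∈ par G (block G c b i)) :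
    ∃ y ∈ par G (block G c b i), φ x = gen G c ^ m i * y * (gen G c ^ m i)⁻¹ :=
  ⟨_, h.map_block i x hx, by group⟩

lemma Adapted.of_exists_eq {φ : MulAut (RAAG G)} {ε : ℤˣ} {m : Fin (n + 1) → ℤ}
    (hc : φ (gen G c) = gen G c ^ (ε : ℤ))
    (h : ∀ i, ∀ x ∈ par G (block G c b i), ∃ y ∈ par G (block G c b i),
      φ x = gen G c ^ m i * y * (gen G c ^ m i)⁻¹) : Adapted G c b φ ε m := by
  refine ⟨hc, fun i x hx => ?_⟩
  obtain ⟨y, hy, e⟩ := h i x hx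
  rw [e]
  convert hy using 1
  group

lemma Adapted.mul {φ φ' : MulAut (RAAG G)} {ε ε' : ℤˣ} {m m' : Fin (n + 1) → ℤ}
    (h' : Adapted G c b φ' ε' m') (h : Adapted G c b φ ε m) :
    Adapted G c b (φ' * φ) (ε' * ε) (m' + (ε' : ℤ) • m) := by
  refine .of_exists_eq ?_ fun i x hx => ?_
  · rw [MulAut.mul_apply, h.map_center, map_zpow, h'.map_center, ← zpow_mul]
    simp
  · obtain ⟨y, hy, e⟩ := h.exists_eq hx
    obtain ⟨z, hz, e'⟩ := h'.exists_eq hy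
    refine ⟨z, hz, ?_⟩
    rw [MulAut.mul_apply, e]
    simp only [map_mul, map_inv, map_zpow, h'.map_center, e', Pi.add_apply, Pi.smul_apply,
      smul_eq_mul]
    rw [add_comm, zpow_add, zpow_mul]
    group

lemma Adapted.unique (B : BlobGraph G c b) {φ : MulAut (RAAG G)} {ε ε' : ℤˣ}
    {m m' : Fin (n + 1) → ℤ} (h : Adapted G c b φ ε m) (h' : Adapted G c b φ ε' m') :
    ε = ε' ∧ m = m' := by
  constructor
  · have := congrArg (expo c) (h.map_center.symm.trans h'.map_center)
    simp only [expo_zpow, expo_gen_self, mul_one] at this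
    exact Units.ext this
  · ext i
    have h1 := B.eq_of_fixed_block φ i ((B.fixed_per_iff φ i i _).2 (h.map_block i))
      ((B.fixed_per_iff φ i i _).2 (h'.map_block i))
    have h2 := ((B.split.per_eq_iff _ _ _ _).1 h1).2
    rw [split_H_some] at h2
    have h3 := expo_eq_zero (B.notMem_block i) h2
    rw [expo_mul, expo_inv, expo_zpow, expo_zpow, expo_gen_self] at h3
    linarith

lemma eq_zpow_mul_retr {k : RAAG G} (hk : k ∈ par G (insert c (G.neighborSet c))) :
    k = gen G c ^ expo c k * retr G (G.neighborSet c) k := by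
  have hnc : c ∉ G.neighborSet c := G.loopless.irrefl c
  change k ∈ Subgroup.closure _ at hk
  induction hk using Subgroup.closure_induction with
  | mem x hx =>
    obtain ⟨v, rfl | hv, rfl⟩ := hx
    · rw [expo_gen_self, retr_gen_of_notMem hnc]; simp
    · rw [expo_gen_of_ne (G.ne_of_adj hv).symm, retr_gen_of_mem hv]; simp
  | one => simp [expo_one]
  | mul x y hx hy ihx ihy =>
    have := (commute_link (retr_mem (G.neighborSet c) x)).zpow_left (expo c y)
    rw [expo_mul, zpow_add, map_mul]
    conv_lhs => rw [ihx, ihy]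
    rw [mul_assoc, ← mul_assoc _ (gen G c ^ expo c y), ← this.eq]
    group
  | inv x hx ih =>
    have := (commute_link (retr_mem (G.neighborSet c) x)).zpow_left (expo c x)
    rw [expo_inv, map_inv]
    conv_lhs => rw [ih, this.eq]
    group

lemma adapted_conj {g : RAAG G} {k : ℤ} {l : RAAG G}
    (hl : l ∈ par G (G.neighborSet c)) (hg : g = gen G c ^ k * l) :
    Adapted G c b (MulAut.conj g) 1 fun _ => k := by
  subst hg
  refine .of_exists_eq ?_ fun i x hx => ⟨l * x * l⁻¹, ?_, ?_⟩
  · rw [MulAut.conj_apply, mul_inv_rev, mul_assoc _ l, ← (commute_link hl).eq]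
    simp only [Units.val_one, zpow_one]
    group
  · have := par_mono (link_subset_block (b := b) i) hl
    exact mul_mem (mul_mem this hx) (inv_mem this)
  · rw [MulAut.conj_apply]
    group

lemma Adapted.conj_const (B : BlobGraph G c b) {g : RAAG G} {ε : ℤˣ} {m : Fin (n + 1) → ℤ}
    (h : Adapted G c b (MulAut.conj g) ε m) : ε = 1 ∧ ∃ k, ∀ i, m i = k := by
  have h1 := h.map_center
  have h2 := congrArg (expo c) h1
  rw [MulAut.conj_apply, expo_conj, expo_zpow, expo_gen_self, mul_one] at h2
  have h3 : ε = 1 := Units.ext h2.symm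
  subst h3
  rw [MulAut.conj_apply, Units.val_one, zpow_one, mul_inv_eq_iff_eq_mul] at h1
  have h4 := eq_zpow_mul_retr (mem_par_of_commute_gen h1)
  exact ⟨rfl, _, congrFun (h.unique B (adapted_conj (retr_mem _ _) h4)).2⟩

lemma exists_adapted [Finite V] (B : BlobGraph G c b) (hn : n ≠ 0) (φ : MulAut (RAAG G)) :
    ∃ h ε m, Adapted G c b (MulAut.conj h * φ) ε m := by
  obtain ⟨h, hh⟩ : ∃ h, ∀ x ∈ par G (G.neighborSet c),
      MulAut.conj h (φ x) ∈ par G (G.neighborSet c) := by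
    obtain ⟨g, hg⟩ := B.exists_conj_block φ 0
    obtain ⟨g', hg'⟩ := B.exists_conj_block φ (Fin.last n)
    have hne : B.split.per (some 0) g ≠ B.split.per (some (Fin.last n)) g' := by
      intro e
      have := Option.some_injective _ ((B.split.per_eq_iff _ _ _ _).1 e).1
      exact hn (by simpa using (congrArg Fin.val this).symm)
    obtain ⟨k, hk⟩ := B.split.exists_cen_fixed hne
    refine ⟨k⁻¹, fun x hx => ?_⟩
    have := hk (φ x) ((B.fixed_per_iff φ _ _ g).2 hg x (par_mono (link_subset_block _) hx))
      ((B.fixed_per_iff φ _ _ g').2 hg' x (par_mono (link_subset_block _) hx))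
    rw [Splitting.smul_cen_eq_iff, split_F] at this
    simpa using this
  refine ⟨h, ?_⟩
  generalize hψ : MulAut.conj h * φ = ψ
  have hL : ∀ x ∈ par G (G.neighborSet c), ψ x ∈ par G (G.neighborSet c) := by
    rw [← hψ]; exact hh
  have hψψ : ∀ x, ψ (ψ⁻¹ x) = x := fun x => MulAut.apply_inv_self _ ψ x
  have hψψ' : ∀ x, ψ⁻¹ (ψ x) = x := fun x => MulAut.inv_apply_self _ ψ x
  have hcent : ∀ y, (∀ x ∈ par G (G.neighborSet c), Commute y (ψ x)) →
      ∃ k : ℤ, y = ψ (gen G c) ^ k := by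
    intro y hy
    obtain ⟨k, hk⟩ := B.exists_zpow_of_commute_link (x := ψ⁻¹ y) fun x hx => by
      have := (hy x hx).map ψ⁻¹
      rwa [hψψ'] at this
    exact ⟨k, by rw [← map_zpow, ← hk, hψψ]⟩
  obtain ⟨ε, hε⟩ : ∃ ε : ℤˣ, ψ (gen G c) = gen G c ^ (ε : ℤ) := by
    obtain ⟨k, hk⟩ := hcent (gen G c) fun x hx => commute_link (hL x hx)
    have h1 := congrArg (expo c) hk
    rw [expo_gen_self, expo_zpow] at h1
    obtain ⟨u, hu⟩ : IsUnit k := IsUnit.of_mul_eq_one _ h1.symm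
    refine ⟨u, ?_⟩
    conv_rhs => rw [hk, ← zpow_mul, ← hu]
    simp [← Units.val_mul, Int.units_mul_self]
  have hm : ∀ i, ∃ m : ℤ, ∀ x ∈ par G (block G c b i),
      (gen G c ^ m)⁻¹ * ψ x * gen G c ^ m ∈ par G (block G c b i) := by
    intro i
    obtain ⟨g, hg⟩ := B.exists_conj_block ψ i
    obtain ⟨u, hu⟩ := B.split.treeAction.exists_closer
      (show B.split.per (some i) g ≠ B.split.cen 1 from Sum.inr_ne_inl)
    obtain ⟨k, hk1, hk2⟩ : ∃ k, B.split.per (some i) k = B.split.per (some i) g ∧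
        u = B.split.cen k := by
      obtain ⟨k, j, ⟨h1, h2⟩ | ⟨h1, h2⟩⟩ := hu.1
      · cases h1
      · obtain ⟨rfl, h3⟩ := (B.split.per_eq_iff _ _ _ _).1 h2
        exact ⟨k, h2.symm, h1⟩
    subst hk2
    have hfix : ∀ x ∈ par G (G.neighborSet c), k⁻¹ * ψ x * k ∈ par G (G.neighborSet c) := by
      intro x hx
      have h1 := (B.fixed_per_iff ψ i i g).2 hg x (par_mono (link_subset_block _) hx)
      have h2 : ψ x • B.split.cen 1 = B.split.cen 1 := by
        rw [Splitting.smul_cen_eq_iff, split_F]; simpa using hL x hx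
      have h3 := hu.fixed h1 h2
      rwa [Splitting.smul_cen_eq_iff, split_F] at h3
    have hkc : Commute k (gen G c) := by
      obtain ⟨l, hl⟩ := hcent (k * gen G c * k⁻¹) fun x hx => by
        have := (commute_link (hfix x hx)).map (MulAut.conj k)
        simpa [mul_assoc] using this
      rw [hε, ← zpow_mul] at hl
      have h1 := congrArg (expo c) hl
      rw [expo_conj, expo_zpow, expo_gen_self, mul_one] at h1
      rw [← h1, zpow_one, mul_inv_eq_iff_eq_mul] at hl
      exact hl
    have hk3 := eq_zpow_mul_retr (mem_par_of_commute_gen hkc)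
    refine ⟨expo c k, (B.fixed_per_iff ψ i i _).1 ?_⟩
    have : B.split.per (some i) (gen G c ^ expo c k) = B.split.per (some i) g := by
      rw [← hk1, Splitting.per_eq_iff]
      refine ⟨rfl, ?_⟩
      rw [show (gen G c ^ expo c k)⁻¹ * k = retr G (G.neighborSet c) k from
        inv_mul_eq_iff_eq_mul.2 hk3]
      exact B.split.le _ (retr_mem _ _)
    rw [this]
    exact (B.fixed_per_iff ψ i i _).2 hg
  choose m hm using hm
  exact ⟨ε, m, hε, hm⟩

/-- The power of `c` by which `twist m` conjugates the vertex `u`. -/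
def twistExp (b : V → Option (Fin (n + 1))) (m : Fin (n + 1) → ℤ) (u : V) : ℤ :=
  (b u).elim 0 m

lemma conj_gen_eq (m : Fin (n + 1) → ℤ) {i : Fin (n + 1)} {u : V}
    (hu : u ∈ block G c b i) :
    gen G c ^ twistExp b m u * gen G u * (gen G c ^ twistExp b m u)⁻¹ =
      MulAut.conj (gen G c ^ m i) (gen G u) := by
  rw [MulAut.conj_apply]
  rcases hu with hu | hu
  · rw [((commute_gen hu).zpow_left (m i)).eq, ((commute_gen hu).zpow_left _).eq,
      mul_inv_cancel_right, mul_inv_cancel_right]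
  · rw [twistExp, hu]; rfl

/-- The endomorphism conjugating the blob `i` by `c ^ m i`. -/
def twistHom (B : BlobGraph G c b) (m : Fin (n + 1) → ℤ) : RAAG G →* RAAG G :=
  lift (fun u => gen G c ^ twistExp b m u * gen G u * (gen G c ^ twistExp b m u)⁻¹) (by
    have hc : ∀ v, G.Adj c v → gen G c ^ twistExp b m v * gen G v * (gen G c ^ twistExp b m v)⁻¹ =
        gen G v := fun v hv => by
      rw [((commute_gen hv).zpow_left _).eq, mul_inv_cancel_right]
    have hcc : gen G c ^ twistExp b m c * gen G c * (gen G c ^ twistExp b m c)⁻¹ = gen G c := by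
      rw [((Commute.refl (gen G c)).zpow_left _).eq, mul_inv_cancel_right]
    intro u v huv
    by_cases h : u = c
    · subst h; rw [hc v huv, hcc]; exact commute_gen huv
    by_cases h' : v = c
    · subst h'; rw [hc u huv.symm, hcc]; exact commute_gen huv
    obtain ⟨i, hi, hj⟩ : ∃ i, u ∈ block G c b i ∧ v ∈ block G c b i := by
      obtain ⟨i, hi⟩ := B.exists_mem_block h
      obtain ⟨j, hj⟩ := B.exists_mem_block h'
      rcases hi with hi | hi
      · exact ⟨j, Or.inl hi, hj⟩
      · rcases hj with hj | hj
        · exact ⟨i, Or.inr hi, Or.inl hj⟩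
        · obtain ⟨rfl, _⟩ := (B.adj_iff u v i j hi hj).1 huv
          exact ⟨i, Or.inr hi, Or.inr hj⟩
    rw [conj_gen_eq m hi, conj_gen_eq m hj]
    exact (commute_gen huv).map _)

lemma twistHom_center (B : BlobGraph G c b) (m : Fin (n + 1) → ℤ) :
    B.twistHom m (gen G c) = gen G c := by
  rw [twistHom, lift_gen, ((Commute.refl (gen G c)).zpow_left _).eq, mul_inv_cancel_right]

lemma twistHom_block (B : BlobGraph G c b) (m : Fin (n + 1) → ℤ) {i : Fin (n + 1)} {x : RAAG G}
    (hx : x ∈ par G (block G c b i)) :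
    B.twistHom m x = gen G c ^ m i * x * (gen G c ^ m i)⁻¹ :=
  map_eq_of_mem_par (f := B.twistHom m) (g := (MulAut.conj (gen G c ^ m i)).toMonoidHom)
    (fun u hu => by rw [twistHom, lift_gen, conj_gen_eq m hu]; rfl) hx

lemma twistHom_comp (B : BlobGraph G c b) (m m' : Fin (n + 1) → ℤ) :
    (B.twistHom m).comp (B.twistHom m') = B.twistHom (m + m') := by
  refine B.hom_ext ?_ fun i x hx => ?_
  · simp only [MonoidHom.comp_apply, twistHom_center]
  · rw [MonoidHom.comp_apply, B.twistHom_block m' hx, B.twistHom_block _ hx, map_mul, map_mul,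
      map_inv, map_zpow, twistHom_center, B.twistHom_block m hx, Pi.add_apply, add_comm, zpow_add]
    group

lemma twistHom_zero (B : BlobGraph G c b) : B.twistHom 0 = MonoidHom.id _ := by
  refine B.hom_ext (B.twistHom_center 0) fun i x hx => ?_
  rw [B.twistHom_block _ hx]
  simp

/-- The automorphism conjugating the blob `i` by `c ^ m i`. -/
def twist (B : BlobGraph G c b) (m : Fin (n + 1) → ℤ) : MulAut (RAAG G) :=
  MonoidHom.toMulEquiv (B.twistHom m) (B.twistHom (-m))
    (by rw [twistHom_comp, neg_add_cancel, twistHom_zero])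
    (by rw [twistHom_comp, add_neg_cancel, twistHom_zero])

lemma twist_center (B : BlobGraph G c b) (m : Fin (n + 1) → ℤ) :
    B.twist m (gen G c) = gen G c := B.twistHom_center m

lemma twist_block (B : BlobGraph G c b) (m : Fin (n + 1) → ℤ) {i : Fin (n + 1)} {x : RAAG G}
    (hx : x ∈ par G (block G c b i)) :
    B.twist m x = gen G c ^ m i * x * (gen G c ^ m i)⁻¹ := B.twistHom_block m hx

lemma twist_add (B : BlobGraph G c b) (m m' : Fin (n + 1) → ℤ) :
    B.twist (m + m') = B.twist m * B.twist m' :=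
  MulEquiv.ext fun x => (DFunLike.congr_fun (B.twistHom_comp m m') x).symm

lemma twist_const (B : BlobGraph G c b) (k : ℤ) :
    B.twist (fun _ => k) = MulAut.conj (gen G c ^ k) := by
  refine B.aut_ext ?_ fun i x hx => ?_
  · rw [twist_center, MulAut.conj_apply, ((Commute.refl (gen G c)).zpow_left _).eq,
      mul_inv_cancel_right]
  · rw [B.twist_block _ hx, MulAut.conj_apply]

lemma adapted_twist (B : BlobGraph G c b) (m : Fin (n + 1) → ℤ) :
    Adapted G c b (B.twist m) 1 m :=
  .of_exists_eq (by simp [twist_center]) fun _ x hx => ⟨x, hx, B.twist_block m hx⟩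

lemma Adapted.mul_twist (B : BlobGraph G c b) {φ : MulAut (RAAG G)} {ε : ℤˣ}
    {m : Fin (n + 1) → ℤ} (h : Adapted G c b φ ε m) (v : Fin (n + 1) → ℤ) :
    φ * B.twist v = B.twist ((ε : ℤ) • v) * φ := by
  refine B.aut_ext ?_ fun i x hx => ?_
  · simp only [MulAut.mul_apply, twist_center, h.map_center, map_zpow]
  · obtain ⟨y, hy, e⟩ := h.exists_eq hx
    simp only [MulAut.mul_apply, B.twist_block _ hx, B.twist_block _ hy, twist_center, e, map_mul,
      map_inv, map_zpow, h.map_center, Pi.smul_apply, smul_eq_mul]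
    group

open Classical in
variable (G c) in
/-- The endomorphism inverting `c`. -/
def flipHom : RAAG G →* RAAG G :=
  lift (fun u => if u = c then (gen G c)⁻¹ else gen G u) fun u v huv => by
    by_cases h : u = c
    · subst h; simpa [huv.ne.symm] using (commute_gen huv).inv_left
    · by_cases h' : v = c
      · subst h'; simpa [h] using (commute_gen huv).inv_right
      · simpa [h, h'] using commute_gen huv

variable (G c) in
lemma flipHom_center : flipHom G c (gen G c) = (gen G c)⁻¹ := by simp [flipHom]

lemma flipHom_block (B : BlobGraph G c b) {i : Fin (n + 1)} {x : RAAG G}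
    (hx : x ∈ par G (block G c b i)) : flipHom G c x = x :=
  map_eq_of_mem_par (f := flipHom G c) (g := MonoidHom.id _)
    (fun u hu => by
      have : u ≠ c := by rintro rfl; exact B.notMem_block i hu
      simp [flipHom, this]) hx

lemma flipHom_comp (B : BlobGraph G c b) : (flipHom G c).comp (flipHom G c) = MonoidHom.id _ := by
  refine B.hom_ext ?_ fun i x hx => ?_
  · simp [flipHom_center]
  · simp [B.flipHom_block hx]

/-- The inversion of `c`. -/
def flip (B : BlobGraph G c b) : MulAut (RAAG G) :=
  MonoidHom.toMulEquiv (flipHom G c) (flipHom G c) B.flipHom_comp B.flipHom_comp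

lemma flip_center (B : BlobGraph G c b) : B.flip (gen G c) = (gen G c)⁻¹ := flipHom_center G c

lemma flip_block (B : BlobGraph G c b) {i : Fin (n + 1)} {x : RAAG G}
    (hx : x ∈ par G (block G c b i)) : B.flip x = x := B.flipHom_block hx

lemma adapted_flip (B : BlobGraph G c b) : Adapted G c b B.flip (-1) 0 :=
  .of_exists_eq (by simp [flip_center]) fun _ x hx => ⟨x, hx, by simp [B.flip_block hx]⟩

lemma Adapted.flip_mul (B : BlobGraph G c b) {φ : MulAut (RAAG G)} {ε : ℤˣ}
    {m : Fin (n + 1) → ℤ} (h : Adapted G c b φ ε m) :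
    B.flip * φ = B.twist ((-2 : ℤ) • m) * φ * B.flip := by
  refine B.aut_ext ?_ fun i x hx => ?_
  · simp only [MulAut.mul_apply, flip_center, twist_center, h.map_center, map_zpow, map_inv]
    group
  · obtain ⟨y, hy, e⟩ := h.exists_eq hx
    simp only [MulAut.mul_apply, B.flip_block hx, B.flip_block hy, B.twist_block _ hy, flip_center,
      twist_center, e, map_mul, map_inv, map_zpow, Pi.smul_apply, smul_eq_mul]
    group

/-- The differences of the entries of a vector with its first entry. -/
def diff (m : Fin (n + 1) → ℤ) (i : Fin n) : ℤ := m i.succ - m 0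

lemma diff_add_smul (m m' : Fin (n + 1) → ℤ) (k : ℤ) :
    diff (m + k • m') = diff m + k • diff m' := by
  ext i; simp [diff]; ring

variable (G c b) in
/-- The outer class `q` has an adapted representative with parameters `ε` and `e`. -/
def OutAdapted (q : Out (RAAG G)) (p : ℤˣ × (Fin n → ℤ)) : Prop :=
  ∃ φ m, Adapted G c b φ p.1 m ∧ (φ : Out (RAAG G)) = q ∧ p.2 = diff m

lemma conj_mul_eq (g : RAAG G) (φ : MulAut (RAAG G)) :
    ((MulAut.conj g * φ : MulAut (RAAG G)) : Out (RAAG G)) = φ := by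
  have : ((MulAut.conj g : MulAut (RAAG G)) : Out (RAAG G)) = 1 :=
    (QuotientGroup.eq_one_iff _).2 ⟨g, rfl⟩
  rw [QuotientGroup.mk_mul, this, one_mul]

lemma exists_outAdapted [Finite V] (B : BlobGraph G c b) (hn : n ≠ 0) (q : Out (RAAG G)) :
    ∃ p, OutAdapted G c b q p := by
  obtain ⟨φ, rfl⟩ := QuotientGroup.mk_surjective q
  obtain ⟨h, ε, m, hm⟩ := B.exists_adapted hn φ
  exact ⟨(ε, diff m), _, m, hm, conj_mul_eq h φ, rfl⟩

lemma OutAdapted.unique [Finite V] (B : BlobGraph G c b) (hn : n ≠ 0) {q : Out (RAAG G)}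
    {p p' : ℤˣ × (Fin n → ℤ)} (h : OutAdapted G c b q p) (h' : OutAdapted G c b q p') : p = p' := by
  obtain ⟨φ, m, hm, hφ, e⟩ := h
  obtain ⟨φ', m', hm', hφ', e'⟩ := h'
  obtain ⟨k, ε, l, hl⟩ := B.exists_adapted hn φ⁻¹
  have key : ∀ {ψ m' ε'}, Adapted G c b ψ ε' m' → (ψ : Out (RAAG G)) = q →
      ε * ε' = 1 ∧ diff l + (ε : ℤ) • diff m' = 0 := by
    intro ψ m' ε' hm' hψ
    obtain ⟨g, hg⟩ := QuotientGroup.eq.1 (hφ.trans hψ.symm)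
    have h1 := hl.mul hm'
    rw [mul_assoc, ← hg, ← map_mul] at h1
    obtain ⟨h2, d, h3⟩ := h1.conj_const B
    refine ⟨h2, ?_⟩
    rw [← diff_add_smul]
    ext i
    change (l + (ε : ℤ) • m') i.succ - (l + (ε : ℤ) • m') 0 = 0
    rw [h3, h3, sub_self]
  obtain ⟨a1, a2⟩ := key hm hφ
  obtain ⟨b1, b2⟩ := key hm' hφ'
  refine Prod.ext (mul_left_cancel (a1.trans b1.symm)) ?_
  rw [e, e']
  have := add_left_cancel (a2.trans b2.symm)
  have h3 := congrArg (fun v : Fin n → ℤ => (ε : ℤ) • v) this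
  simpa only [smul_smul, ← Units.val_mul, Int.units_mul_self, Units.val_one, one_smul] using h3

lemma OutAdapted.mul {q q' : Out (RAAG G)} {p p' : ℤˣ × (Fin n → ℤ)} (h : OutAdapted G c b q p)
    (h' : OutAdapted G c b q' p') :
    OutAdapted G c b (q * q') (p.1 * p'.1, p.2 + (p.1 : ℤ) • p'.2) := by
  obtain ⟨φ, m, hm, rfl, e⟩ := h
  obtain ⟨φ', m', hm', rfl, e'⟩ := h'
  exact ⟨_, _, hm.mul hm', rfl, by rw [diff_add_smul, e, e']⟩

/-- The outer class of a twist. -/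
def outTwist (B : BlobGraph G c b) : Multiplicative (Fin n → ℤ) →* Out (RAAG G) :=
  MonoidHom.mk' (fun v => (B.twist (Fin.cons 0 v.toAdd) : Out (RAAG G))) fun v w => by
    rw [← QuotientGroup.mk_mul, ← twist_add]
    congr 2
    ext i
    refine Fin.cases ?_ (fun i => ?_) i <;> simp

lemma mk_twist (B : BlobGraph G c b) (m : Fin (n + 1) → ℤ) :
    (B.twist m : Out (RAAG G)) = B.outTwist (Multiplicative.ofAdd (diff m)) := by
  have : m = (fun _ => m 0) + (Fin.cons 0 (diff m) : Fin (n + 1) → ℤ) := by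
    ext i
    refine Fin.cases ?_ (fun i => ?_) i <;> simp [diff]
  conv_lhs => rw [this]
  rw [twist_add, twist_const, conj_mul_eq]
  rfl

lemma diff_cons (v : Fin n → ℤ) : diff (Fin.cons 0 v : Fin (n + 1) → ℤ) = v := by
  ext i; simp [diff]

lemma diff_smul (k : ℤ) (m : Fin (n + 1) → ℤ) : diff (k • m) = k • diff m := by
  ext i; simp [diff]; ring

lemma outAdapted_outTwist (B : BlobGraph G c b) (v : Multiplicative (Fin n → ℤ)) :
    OutAdapted G c b (B.outTwist v) (1, v.toAdd) :=
  ⟨_, _, B.adapted_twist _, rfl, (diff_cons _).symm⟩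

/-- The structure of the outer automorphism group. -/
def translationData [Finite V] (B : BlobGraph G c b) (hn : n ≠ 0) :
    TranslationData (Out (RAAG G)) n :=
  have hp := fun q => (B.exists_outAdapted hn q).choose_spec
  { ε := MonoidHom.mk' (fun q => (B.exists_outAdapted hn q).choose.1) fun q q' =>
      congrArg Prod.fst ((hp (q * q')).unique B hn ((hp q).mul (hp q')))
    χ := B.outTwist
    e := fun q => (B.exists_outAdapted hn q).choose.2
    e_mul := fun q q' => congrArg Prod.snd ((hp (q * q')).unique B hn ((hp q).mul (hp q')))
    e_χ := fun v => congrArg Prod.snd ((hp _).unique B hn (B.outAdapted_outTwist _))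
    ε_χ := fun v => congrArg Prod.fst ((hp _).unique B hn (B.outAdapted_outTwist _))
    conj_χ := fun q v => by
      obtain ⟨φ, m, hm, hq, -⟩ := hp q
      change q * B.outTwist (Multiplicative.ofAdd v) =
        B.outTwist (Multiplicative.ofAdd (((B.exists_outAdapted hn q).choose.1 : ℤ) • v)) * q
      have := congrArg (QuotientGroup.mk (s := Inn (RAAG G)))
        (hm.mul_twist B (Fin.cons 0 v : Fin (n + 1) → ℤ))
      rw [QuotientGroup.mk_mul, QuotientGroup.mk_mul, hq, mk_twist, mk_twist, diff_smul,
        diff_cons] at this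
      exact this
    ι := (B.flip : Out (RAAG G))
    ε_ι := congrArg Prod.fst ((hp _).unique B hn
      (⟨_, _, B.adapted_flip, rfl, rfl⟩ : OutAdapted G c b _ (-1, diff 0)))
    conj_ι := fun q => by
      obtain ⟨φ, m, hm, hq, he⟩ := hp q
      have := congrArg (QuotientGroup.mk (s := Inn (RAAG G))) (hm.flip_mul B)
      rw [QuotientGroup.mk_mul, QuotientGroup.mk_mul, QuotientGroup.mk_mul, hq, mk_twist,
        diff_smul, ← he] at this
      exact this }

lemma eq_center_of_triangle_free (B : BlobGraph G c b) {v : V}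
    (h : ∀ x y, G.Adj v x → G.Adj v y → ¬ G.Adj x y) : v = c := by
  by_contra hv
  rcases hb : b v with _ | i
  · obtain ⟨p, q, hp, hq, hpq, h1, h2⟩ := B.two v (((B.eq_none_iff v).1 hb).resolve_left hv) 0
    exact h p q h1 h2 (B.adj hp hq hpq)
  · obtain ⟨p, q, s, hp, hq, hs, hpq, hps, hqs⟩ := B.three i
    by_cases e1 : v = p
    · subst e1
      exact h q s (B.adj hp hq hpq) (B.adj hp hs hps) (B.adj hq hs hqs)
    · by_cases e2 : v = q
      · subst e2
        exact h p s (B.adj hq hp hpq.symm) (B.adj hq hs hqs) (B.adj hp hs hps)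
      · exact h p q (B.adj hb hp e1) (B.adj hb hq e2) (B.adj hp hq hpq)

lemma iso_center (B : BlobGraph G c b) (e : G ≃g G) : e c = c := by
  refine B.eq_center_of_triangle_free fun x y hx hy hxy => ?_
  have h1 : ∀ z, G.Adj (e c) z → G.Adj c (e.symm z) := fun z hz => by
    rw [← e.map_adj_iff, e.apply_symm_apply]; exact hz
  exact B.indep _ _ (h1 x hx) (h1 y hy) (e.symm.map_adj_iff.2 hxy)

lemma iso_ncard_le [Finite V] (B : BlobGraph G c b) (e : G ≃g G) {u : V} {i k : Fin (n + 1)}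
    (hu : b u = some i) (hk : b (e u) = some k) :
    (block G c b i).ncard ≤ (block G c b k).ncard := by
  refine Set.ncard_le_ncard_of_injOn e ?_ e.injective.injOn (Set.toFinite _)
  rintro w (hw | hw)
  · left
    rw [← B.iso_center e, e.map_adj_iff]
    exact hw
  · right
    by_cases h : u = w
    · rw [← h, hk]
    · have h1 := e.map_adj_iff.2 (B.adj hu hw h)
      rcases hb : b (e w) with _ | l
      · rcases (B.eq_none_iff _).1 hb with h2 | h2
        · exact absurd (e.injective (h2.trans (B.iso_center e).symm)) (B.ne_none hw).1
        · rw [← B.iso_center e, e.map_adj_iff] at h2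
          exact absurd h2 (B.ne_none hw).2
      · rw [((B.adj_iff _ _ k l hk hb).1 h1).1]

lemma iso_label [Finite V] (B : BlobGraph G c b) (e : G ≃g G) {u : V} {i : Fin (n + 1)}
    (hu : b u = some i) : b (e u) = some i := by
  rcases hb : b (e u) with _ | k
  · rcases (B.eq_none_iff _).1 hb with h2 | h2
    · exact absurd (e.injective (h2.trans (B.iso_center e).symm)) (B.ne_none hu).1
    · rw [← B.iso_center e, e.map_adj_iff] at h2
      exact absurd h2 (B.ne_none hu).2
  · have h1 := B.iso_ncard_le e hu hb
    have h2 := B.iso_ncard_le e.symm hb (by rw [e.symm_apply_apply]; exact hu)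
    rw [B.card (le_antisymm h1 h2)]

end BlobGraph

/-- A family of set systems giving rise to a graph. -/
structure BlobFamily {n r : ℕ} (Z : Fin (n + 1) → Finset (Finset (Fin r))) : Prop where
  pos : 0 < r
  antichain : ∀ i, ∀ s ∈ Z i, ∀ t ∈ Z i, s ⊆ t → s = t
  nonempty : ∀ i, ∀ s ∈ Z i, s.Nonempty
  two : ∀ i j, ∃ s ∈ Z i, ∃ t ∈ Z i, s ≠ t ∧ j ∉ s ∧ j ∉ t
  single : ∀ j, ∃ i, {j} ∈ Z i
  compl : ∀ i, ∀ s ∈ Z i, ∀ j, ∃ k, k ≠ j ∧ k ∉ s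
  card : Function.Injective fun i => (Z i).card
  rigid : ∀ f : Fin r → Fin r, Function.Injective f →
    (∀ i, ∀ s ∈ Z i, s.image f ∈ Z i) → ∀ j, f j = j

namespace BlobFamily

variable {n r : ℕ} {Z : Fin (n + 1) → Finset (Finset (Fin r))}

variable (Z) in
/-- The vertices: the center, its neighbours, and a blob for each set system. -/
abbrev Vert : Type := Option (Fin r ⊕ Σ i, {s // s ∈ Z i})

/-- A neighbour of the center. -/
abbrev lnk (j : Fin r) : Vert Z := some (Sum.inl j)

/-- A member of a blob. -/
abbrev blb (x : Σ i, {s // s ∈ Z i}) : Vert Z := some (Sum.inr x)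

variable (Z) in
/-- Adjacency: a blob vertex is joined to the neighbours of the center it does not contain. -/
def adj : Vert Z → Vert Z → Prop
  | none, some (Sum.inl _) => True
  | some (Sum.inl _), none => True
  | some (Sum.inl j), some (Sum.inr x) => j ∉ x.2.1
  | some (Sum.inr x), some (Sum.inl j) => j ∉ x.2.1
  | some (Sum.inr x), some (Sum.inr y) => x.1 = y.1 ∧ x ≠ y
  | none, none => False
  | none, some (Sum.inr _) => False
  | some (Sum.inr _), none => False
  | some (Sum.inl _), some (Sum.inl _) => False

variable (Z) in
/-- The graph of a family of set systems. -/
def graph : SimpleGraph (Vert Z) where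
  Adj := adj Z
  symm := ⟨by
    rintro (_ | j | x) (_ | k | y) h <;> first | exact h | exact ⟨h.1.symm, h.2.symm⟩⟩
  loopless := ⟨by
    rintro (_ | j | x) h <;> first | exact h | exact h.2 rfl⟩

@[simp] lemma adj_none_lnk (j : Fin r) : (graph Z).Adj none (lnk j) := trivial
@[simp] lemma adj_lnk_none (j : Fin r) : (graph Z).Adj (lnk j) none := trivial
@[simp] lemma adj_lnk_blb (j : Fin r) (x : Σ i, {s // s ∈ Z i}) :
    (graph Z).Adj (lnk j) (blb x) ↔ j ∉ x.2.1 := Iff.rfl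
@[simp] lemma adj_blb_lnk (j : Fin r) (x : Σ i, {s // s ∈ Z i}) :
    (graph Z).Adj (blb x) (lnk j) ↔ j ∉ x.2.1 := Iff.rfl
@[simp] lemma adj_blb_blb (x y : Σ i, {s // s ∈ Z i}) :
    (graph Z).Adj (blb x) (blb y) ↔ x.1 = y.1 ∧ x ≠ y := Iff.rfl
@[simp] lemma adj_none_blb (x : Σ i, {s // s ∈ Z i}) : ¬ (graph Z).Adj none (blb x) := id
@[simp] lemma adj_blb_none (x : Σ i, {s // s ∈ Z i}) : ¬ (graph Z).Adj (blb x) none := id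
@[simp] lemma adj_lnk_lnk (j k : Fin r) : ¬ (graph Z).Adj (lnk j) (lnk k) := id

/-- The blob of a vertex. -/
def label : Vert Z → Option (Fin (n + 1))
  | some (Sum.inr x) => some x.1
  | _ => none

@[simp] lemma label_none : label (none : Vert Z) = none := rfl
@[simp] lemma label_lnk (j : Fin r) : label (lnk j : Vert Z) = none := rfl
@[simp] lemma label_blb (x : Σ i, {s // s ∈ Z i}) : label (blb x) = some x.1 := rfl

lemma three (F : BlobFamily Z) (i : Fin (n + 1)) :
    ∃ s ∈ Z i, ∃ t ∈ Z i, ∃ u ∈ Z i, s ≠ t ∧ s ≠ u ∧ t ≠ u := by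
  obtain ⟨s, hs, -⟩ := F.two i ⟨0, F.pos⟩
  obtain ⟨k, hk⟩ := F.nonempty i s hs
  obtain ⟨t, ht, u, hu, htu, h1, h2⟩ := F.two i k
  exact ⟨s, hs, t, ht, u, hu, fun h => h1 (h ▸ hk), fun h => h2 (h ▸ hk), htu⟩

lemma ncard_block (i : Fin (n + 1)) :
    (block (graph Z) none label i).ncard = r + (Z i).card := by
  let f : Fin r ⊕ {s // s ∈ Z i} → Vert Z := Sum.elim lnk fun s => blb ⟨i, s⟩
  have hf : Function.Injective f := by
    rintro (j | s) (k | t) h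
    · cases h; rfl
    · cases h
    · cases h
    · simp only [f, Sum.elim_inr, blb, Option.some.injEq, Sum.inr.injEq, Sigma.mk.injEq, heq_eq_eq,
        true_and] at h
      rw [h]
  have : block (graph Z) none label i = Set.range f := by
    ext v
    constructor
    · rcases v with _ | j | ⟨k, s⟩
      · rintro (h | h)
        · exact absurd h (graph Z).irrefl
        · cases h
      · exact fun _ => ⟨Sum.inl j, rfl⟩
      · rintro (h | h)
        · exact absurd h (adj_none_blb _)
        · simp only [label_blb, Option.some.injEq] at h
          subst h
          exact ⟨Sum.inr s, rfl⟩
    · rintro ⟨j | s, rfl⟩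
      · exact Or.inl (adj_none_lnk j)
      · exact Or.inr rfl
  rw [this, ← Nat.card_coe_set_eq, Nat.card_range_of_injective hf]
  simp

lemma blobGraph (F : BlobFamily Z) : BlobGraph (graph Z) none label where
  eq_none_iff := by rintro (_ | j | x) <;> simp
  indep := by rintro (_ | j | x) (_ | k | y) <;> simp
  adj_iff := by
    rintro (_ | j | x) (_ | k | y) i i' hi hi' <;>
      simp only [label_none, label_lnk, reduceCtorEq, label_blb, Option.some.injEq] at hi hi'
    subst hi hi'
    simp
  three i := by
    obtain ⟨s, hs, t, ht, u, hu, h1, h2, h3⟩ := F.three i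
    exact ⟨blb ⟨i, s, hs⟩, blb ⟨i, t, ht⟩, blb ⟨i, u, hu⟩, rfl, rfl, rfl, by simpa, by simpa,
      by simpa⟩
  two := by
    rintro (_ | j | x) h i
    · simp at h
    · obtain ⟨s, hs, t, ht, hst, h1, h2⟩ := F.two i j
      exact ⟨blb ⟨i, s, hs⟩, blb ⟨i, t, ht⟩, rfl, rfl, by simpa, by simpa, by simpa⟩
    · simp at h
  cone := by
    rintro (_ | j | x) h
    · rfl
    · obtain ⟨i, hi⟩ := F.single j
      obtain ⟨k, hk, -⟩ := F.compl i _ hi j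
      have := h (lnk k) (adj_none_lnk k)
      simp [hk.symm] at this
    · obtain ⟨j, hj⟩ := F.nonempty _ _ x.2.2
      have := h (lnk j) (adj_none_lnk j)
      simp [hj] at this
  card i k h := by
    simp only [ncard_block, Nat.add_left_cancel_iff] at h
    exact F.card h

lemma trivialAut (F : BlobFamily Z) : TrivialAut (graph Z) := by
  intro e
  have hB := F.blobGraph
  have h0 : e none = none := hB.iso_center e
  have hl : ∀ j, ∃ k, e (lnk j) = lnk k := by
    intro j
    have h1 : (graph Z).Adj (e none) (e (lnk j)) := e.map_adj_iff.2 (adj_none_lnk j)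
    rw [h0] at h1
    rcases h : e (lnk j) with _ | k | y
    · simp [h] at h1
    · exact ⟨k, rfl⟩
    · simp [h] at h1
  choose f hf using hl
  have hfi : Function.Injective f := fun j k h => by
    have : e (lnk j) = e (lnk k) := by rw [hf, hf, h]
    simpa using e.injective this
  have hfs := Finite.surjective_of_injective hfi
  have hb : ∀ x : Σ i, {s // s ∈ Z i}, ∃ h : x.2.1.image f ∈ Z x.1,
      e (blb x) = blb ⟨x.1, _, h⟩ := by
    intro x
    have h1 := hB.iso_label e (label_blb x)
    rcases h : e (blb x) with _ | k | ⟨i, t⟩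
    · simp [h] at h1
    · simp [h] at h1
    · simp only [h, label_blb, Option.some.injEq] at h1
      subst h1
      have h2 : t.1 = x.2.1.image f := by
        ext k
        obtain ⟨j, rfl⟩ := hfs k
        have h3 := e.map_adj_iff (v := lnk j) (w := blb x)
        rw [h, hf, adj_lnk_blb, adj_lnk_blb, not_iff_not] at h3
        rw [h3, hfi.mem_finset_image]
      obtain ⟨t, ht⟩ := t
      simp only at h2
      subst h2
      exact ⟨ht, rfl⟩
  have hid : f = id := funext (F.rigid f hfi fun i s hs => (hb ⟨i, s, hs⟩).1)
  rintro (_ | j | x)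
  · exact h0
  · exact (hf j).trans (by rw [hid]; rfl)
  · obtain ⟨h, h'⟩ := hb x
    rw [h']
    subst hid
    simp

lemma not_dominates (F : BlobFamily Z) {u v : Vert Z} (huv : u ≠ v)
    (h : Dominates (graph Z) u v) : u = none := by
  rcases u with _ | j | x
  · rfl
  · exfalso
    obtain ⟨i, hi⟩ := F.single j
    rcases v with _ | k | y
    · obtain ⟨k, hk, -⟩ := F.compl i _ hi j
      rcases h (show lnk k ∈ (graph Z).neighborSet none from adj_none_lnk (Z := Z) k) with h1 | h1
      · simp [hk] at h1
      · exact adj_lnk_lnk (Z := Z) j k h1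
    · have hkj : k ≠ j := by rintro rfl; exact huv rfl
      rcases h (show blb ⟨i, _, hi⟩ ∈ (graph Z).neighborSet (lnk k) by simp [hkj]) with h1 | h1
      · cases h1
      · simp at h1
    · obtain ⟨k, hk, hky⟩ := F.compl _ _ y.2.2 j
      rcases h (show lnk k ∈ (graph Z).neighborSet (blb y) from hky) with h1 | h1
      · simp [hk] at h1
      · exact adj_lnk_lnk (Z := Z) j k h1
  · exfalso
    rcases v with _ | k | y
    · obtain ⟨j, hj⟩ := F.nonempty _ _ x.2.2
      rcases h (show lnk j ∈ (graph Z).neighborSet none from adj_none_lnk (Z := Z) j) with h1 | h1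
      · cases h1
      · exact h1 hj
    · rcases h (show none ∈ (graph Z).neighborSet (lnk k) from adj_lnk_none (Z := Z) k) with h1 | h1
      · cases h1
      · exact adj_blb_none (Z := Z) x h1
    · by_cases hi : x.1 = y.1
      · have hsub : x.2.1 ⊆ y.2.1 := by
          intro k hk
          by_contra hky
          rcases h (show lnk k ∈ (graph Z).neighborSet (blb y) from hky) with h1 | h1
          · cases h1
          · exact h1 hk
        obtain ⟨i, s, hs⟩ := x
        obtain ⟨i', t, ht⟩ := y
        simp only at hi hsub
        subst hi
        have := F.antichain _ s hs t ht hsub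
        subst this
        exact huv rfl
      · obtain ⟨j, hj⟩ := F.nonempty _ _ y.2.2
        obtain ⟨s, hs, -, -, -, hjs, -⟩ := F.two y.1 j
        have hne : y ≠ ⟨y.1, s, hs⟩ := by
          intro e
          rw [e] at hj
          exact hjs hj
        rcases h (show blb ⟨y.1, s, hs⟩ ∈ (graph Z).neighborSet (blb y) from ⟨rfl, hne⟩)
          with h1 | h1
        · simp only [Option.some.injEq, Sum.inr.injEq] at h1
          rw [← h1] at hi
          exact hi rfl
        · exact hi h1.1

lemma connected_compl_lnk (F : BlobFamily Z) (j : Fin r) :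
    ((graph Z).induce (star (graph Z) (lnk j))ᶜ).Connected := by
  obtain ⟨i, hi⟩ := F.single j
  have hmem : ∀ x : Σ i, {s // s ∈ Z i}, j ∈ x.2.1 → blb x ∈ (star (graph Z) (lnk j))ᶜ := by
    rintro x hx (h | h)
    · cases h
    · exact h hx
  have hl : ∀ k, k ≠ j → lnk k ∈ (star (graph Z) (lnk j))ᶜ := by
    rintro k hk (h | h)
    · simp [hk] at h
    · exact adj_lnk_lnk (Z := Z) j k h
  rw [SimpleGraph.connected_iff_exists_forall_reachable]
  refine ⟨⟨blb ⟨i, _, hi⟩, hmem _ (by simp)⟩, ?_⟩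
  have h1 : ∀ k (hk : k ≠ j), ((graph Z).induce (star (graph Z) (lnk j))ᶜ).Reachable
      ⟨blb ⟨i, _, hi⟩, hmem _ (by simp)⟩ ⟨lnk k, hl k hk⟩ := fun k hk =>
    SimpleGraph.Adj.reachable (by simp [hk])
  rintro ⟨_ | k | x, hv⟩
  · exact absurd (Or.inr (adj_lnk_none (Z := Z) j)) hv
  · exact h1 k (by rintro rfl; exact hv (Or.inl rfl))
  · obtain ⟨k, hk, hkx⟩ := F.compl _ _ x.2.2 j
    exact (h1 k hk).trans (SimpleGraph.Adj.reachable (by simp [hkx]))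

lemma connected_compl_blb (F : BlobFamily Z) (x : Σ i, {s // s ∈ Z i}) :
    ((graph Z).induce (star (graph Z) (blb x))ᶜ).Connected := by
  have h0 : none ∈ (star (graph Z) (blb x))ᶜ := by
    rintro (h | h)
    · cases h
    · exact h
  have hl : ∀ k, k ∈ x.2.1 → lnk k ∈ (star (graph Z) (blb x))ᶜ := by
    rintro k hk (h | h)
    · cases h
    · exact h hk
  have hmem : ∀ y : Σ i, {s // s ∈ Z i}, x.1 ≠ y.1 → blb y ∈ (star (graph Z) (blb x))ᶜ := by
    rintro y hy (h | h)
    · simp only [Option.some.injEq, Sum.inr.injEq] at h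
      exact hy (by rw [h])
    · exact hy h.1
  rw [SimpleGraph.connected_iff_exists_forall_reachable]
  refine ⟨⟨none, h0⟩, ?_⟩
  have h1 : ∀ k (hk : k ∈ x.2.1), ((graph Z).induce (star (graph Z) (blb x))ᶜ).Reachable
      ⟨none, h0⟩ ⟨lnk k, hl k hk⟩ := fun k hk => SimpleGraph.Adj.reachable (by simp)
  rintro ⟨_ | k | y, hv⟩
  · rfl
  · refine h1 k ?_
    by_contra hk
    exact hv (Or.inr hk)
  · obtain ⟨k, hk⟩ := F.nonempty _ _ x.2.2
    obtain ⟨s, hs, -, -, -, hks, -⟩ := F.two y.1 k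
    have hxy : x.1 ≠ y.1 := by
      intro h
      refine hv ?_
      by_cases e : x = y
      · exact Or.inl (by rw [e])
      · exact Or.inr ⟨h, e⟩
    have h2 : ((graph Z).induce (star (graph Z) (blb x))ᶜ).Reachable
        ⟨none, h0⟩ ⟨blb ⟨y.1, s, hs⟩, hmem _ hxy⟩ :=
      (h1 k hk).trans (SimpleGraph.Adj.reachable (by simp [hks]))
    by_cases e : ⟨y.1, s, hs⟩ = y
    · simp only [e] at h2
      exact h2
    · exact h2.trans (SimpleGraph.Adj.reachable (by simp [e]))

lemma focused (F : BlobFamily Z) : Focused (graph Z) none := by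
  refine ⟨fun u v huv h => F.not_dominates huv h, ?_⟩
  rintro (_ | j | x) h
  · exact absurd rfl h
  · exact F.connected_compl_lnk j
  · exact F.connected_compl_blb x

end BlobFamily

/-- The least element occurring in the `i`th system of singletons. -/
def singletonBound (s i : ℕ) : ℕ := if i = 1 then s else i - 2

/-- A rigid family: one system of pairs, the threshold graph on `2 * s` points, and systems of
singletons of different sizes. -/
def thresholdFamily (n s : ℕ) (i : Fin (n + 1)) : Finset (Finset (Fin (2 * s))) :=
  if i = 0 then Finset.univ.filter fun t => ∃ a b, a ≠ b ∧ t = {a, b} ∧ 2 * s ≤ a.val + b.val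
  else (Finset.univ.filter fun j : Fin (2 * s) => singletonBound s i ≤ j.val).image singleton

section ThresholdFamily

variable {n s : ℕ}

lemma mem_thresholdFamily_zero {t : Finset (Fin (2 * s))} :
    t ∈ thresholdFamily n s 0 ↔ ∃ a b, a ≠ b ∧ t = {a, b} ∧ 2 * s ≤ a.val + b.val := by
  simp [thresholdFamily]

lemma mem_thresholdFamily {i : Fin (n + 1)} (hi : i ≠ 0) {t : Finset (Fin (2 * s))} :
    t ∈ thresholdFamily n s i ↔ ∃ j : Fin (2 * s), singletonBound s i ≤ j.val ∧ {j} = t := by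
  simp [thresholdFamily, hi]

lemma card_of_mem_thresholdFamily {i : Fin (n + 1)} {t : Finset (Fin (2 * s))}
    (ht : t ∈ thresholdFamily n s i) : t.card = if i = 0 then 2 else 1 := by
  split_ifs with hi
  · subst hi
    obtain ⟨a, b, hab, rfl, -⟩ := mem_thresholdFamily_zero.1 ht
    exact Finset.card_pair hab
  · obtain ⟨j, -, rfl⟩ := (mem_thresholdFamily hi).1 ht
    exact Finset.card_singleton j

lemma singletonBound_le {i : ℕ} (hns : n ≤ s) (hi : i < n + 1) : singletonBound s i ≤ s := by
  unfold singletonBound; split_ifs <;> omega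

lemma Fin.card_filter_val_le (r k : ℕ) :
    (Finset.univ.filter fun j : Fin r => k ≤ j.val).card = r - k := by
  have h := Finset.card_map (s := Finset.univ.filter fun j : Fin r => k ≤ j.val) Fin.valEmbedding
  rw [← h, ← Nat.card_Ico]
  congr 1
  ext x
  simp only [Finset.mem_map, Finset.mem_filter, Finset.mem_univ, true_and, Fin.valEmbedding_apply,
    Finset.mem_Ico]
  exact ⟨by rintro ⟨j, hj, rfl⟩; exact ⟨hj, j.2⟩, fun h => ⟨⟨x, h.2⟩, h.1, rfl⟩⟩

lemma card_thresholdFamily {i : Fin (n + 1)} (hi : i ≠ 0) :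
    (thresholdFamily n s i).card = 2 * s - singletonBound s i := by
  rw [thresholdFamily, if_neg hi, Finset.card_image_of_injective _ Finset.singleton_injective,
    Fin.card_filter_val_le]

lemma lt_card_thresholdFamily_zero (hs : 6 ≤ s) : 2 * s < (thresholdFamily n s 0).card := by
  have h : Finset.powersetCard 2 (Finset.univ.filter fun j : Fin (2 * s) => s ≤ j.val) ⊆
      thresholdFamily n s 0 := by
    intro t ht
    rw [Finset.mem_powersetCard] at ht
    obtain ⟨a, b, hab, rfl⟩ := Finset.card_eq_two.1 ht.2
    have ha := ht.1 (Finset.mem_insert_self _ _)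
    have hb := ht.1 (Finset.mem_insert_of_mem (Finset.mem_singleton_self _))
    simp only [Finset.mem_filter, Finset.mem_univ, true_and] at ha hb
    exact mem_thresholdFamily_zero.2 ⟨a, b, hab, rfl, by omega⟩
  have h1 := Finset.card_le_card h
  rw [Finset.card_powersetCard, Fin.card_filter_val_le, show 2 * s - s = s by omega,
    Nat.choose_two_right] at h1
  refine lt_of_lt_of_le ?_ h1
  obtain ⟨k, rfl⟩ := Nat.exists_eq_add_of_le hs
  rw [Nat.lt_iff_add_one_le, Nat.le_div_iff_mul_le two_pos, show 6 + k - 1 = 5 + k by omega]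
  nlinarith

lemma card_thresholdFamily_injective (hns : n ≤ s) (hs : 6 ≤ s) :
    Function.Injective fun i => (thresholdFamily n s i).card := by
  have h0 := lt_card_thresholdFamily_zero (n := n) hs
  intro i k h
  simp only at h
  by_cases hi : i = 0 <;> by_cases hk : k = 0
  · rw [hi, hk]
  · rw [hi, card_thresholdFamily hk] at h
    omega
  · rw [hk, card_thresholdFamily hi] at h
    omega
  · rw [card_thresholdFamily hi, card_thresholdFamily hk] at h
    have hi' : i.val ≠ 0 := fun e => hi (Fin.ext e)
    have hk' : k.val ≠ 0 := fun e => hk (Fin.ext e)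
    have := i.2
    have := k.2
    refine Fin.ext ?_
    unfold singletonBound at h
    split_ifs at h <;> omega

lemma eq_self_of_threshold {r : ℕ} {f : Fin r → Fin r} (hf : Function.Injective f)
    (h : ∀ i j : Fin r, r ≤ i.val + j.val → r ≤ (f i).val + (f j).val) (j : Fin r) : f j = j := by
  have hle : ∀ j : Fin r, j.val ≤ (f j).val := by
    intro j
    have key : (Finset.univ.filter fun i : Fin r => r - j.val ≤ i.val).card ≤
        (Finset.univ.filter fun i : Fin r => r - (f j).val ≤ i.val).card := by
      refine Finset.card_le_card_of_injOn f ?_ hf.injOn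
      intro i hi
      simp only [Finset.coe_filter, Finset.mem_univ, true_and, Set.mem_ofPred_eq] at hi ⊢
      have := h i j (by omega)
      omega
    rw [Fin.card_filter_val_le, Fin.card_filter_val_le] at key
    have := j.2
    have := (f j).2
    omega
  have hsum : ∑ j : Fin r, j.val = ∑ j, (f j).val :=
    ((Equiv.ofBijective f (Finite.injective_iff_bijective.1 hf)).sum_comp fun j => j.val).symm
  exact Fin.ext ((Finset.sum_eq_sum_iff_of_le fun j _ => hle j).1 hsum j (Finset.mem_univ j)).symm

lemma thresholdFamily_rigid (hn : n ≠ 0) {f : Fin (2 * s) → Fin (2 * s)}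
    (hf : Function.Injective f)
    (h : ∀ i, ∀ t ∈ thresholdFamily n s i, t.image f ∈ thresholdFamily n s i) (j : Fin (2 * s)) :
    f j = j := by
  refine eq_self_of_threshold hf (fun i j hij => ?_) j
  by_cases e : i = j
  · subst e
    have h1 : (⟨1, by omega⟩ : Fin (n + 1)) ≠ 0 := by simp [Fin.ext_iff]
    have h2 := h ⟨1, by omega⟩ {i} ((mem_thresholdFamily h1).2
      ⟨i, by simp only [singletonBound, if_true]; omega, rfl⟩)
    obtain ⟨k, hk, hki⟩ := (mem_thresholdFamily h1).1 h2
    rw [Finset.image_singleton, Finset.singleton_inj] at hki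
    simp only [singletonBound, if_true] at hk
    rw [← hki]
    omega
  · have h2 := h 0 {i, j} (mem_thresholdFamily_zero.2 ⟨i, j, e, rfl, hij⟩)
    obtain ⟨a, b, hab, he, hle⟩ := mem_thresholdFamily_zero.1 h2
    have h3 := congrArg (fun t => ∑ x ∈ t, x.val) he
    simp only [Finset.image_insert, Finset.image_singleton] at h3
    rw [Finset.sum_pair hab, Finset.sum_pair (hf.ne e)] at h3
    omega

lemma blobFamily_thresholdFamily (hn : 2 ≤ n) (hns : n ≤ s) (hs : 6 ≤ s) :
    BlobFamily (thresholdFamily n s) where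
  pos := by omega
  antichain i t ht u hu h := Finset.eq_of_subset_of_card_le h (by
    rw [card_of_mem_thresholdFamily ht, card_of_mem_thresholdFamily hu])
  nonempty i t ht := by
    rw [← Finset.card_pos, card_of_mem_thresholdFamily ht]
    split_ifs <;> omega
  two i j := by
    have h3 : 2 < ((Finset.univ.filter fun k : Fin (2 * s) => s ≤ k.val).erase j).card := by
      have := Finset.pred_card_le_card_erase
        (s := Finset.univ.filter fun k : Fin (2 * s) => s ≤ k.val) (a := j)
      rw [Fin.card_filter_val_le] at this
      omega
    obtain ⟨a, b, c, ha, hb, hc, hab, hac, hbc⟩ := Finset.two_lt_card_iff.1 h3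
    simp only [Finset.mem_erase, Finset.mem_filter, Finset.mem_univ, true_and] at ha hb hc
    by_cases hi : i = 0
    · subst hi
      refine ⟨{a, b}, mem_thresholdFamily_zero.2 ⟨a, b, hab, rfl, by omega⟩,
        {a, c}, mem_thresholdFamily_zero.2 ⟨a, c, hac, rfl, by omega⟩, ?_, ?_, ?_⟩
      · intro h
        have : b ∈ ({a, c} : Finset (Fin (2 * s))) := h ▸ by simp
        simp [hab.symm, hbc] at this
      · simp [ha.1.symm, hb.1.symm]
      · simp [ha.1.symm, hc.1.symm]
    · have hle := singletonBound_le hns i.2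
      exact ⟨{a}, (mem_thresholdFamily hi).2 ⟨a, by omega, rfl⟩,
        {b}, (mem_thresholdFamily hi).2 ⟨b, by omega, rfl⟩, by simpa, by simpa using ha.1.symm,
        by simpa using hb.1.symm⟩
  single j := ⟨⟨2, by omega⟩, (mem_thresholdFamily (by simp [Fin.ext_iff])).2
    ⟨j, by simp [singletonBound], rfl⟩⟩
  compl i t ht j := by
    have h1 : (insert j t).card < Fintype.card (Fin (2 * s)) := by
      have := Finset.card_insert_le j t
      have h2 := card_of_mem_thresholdFamily ht
      rw [Fintype.card_fin]
      split_ifs at h2 <;> omega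
    obtain ⟨k, hk⟩ := Finset.exists_mem_notMem_of_card_lt_card (s := insert j t)
      (t := Finset.univ) h1
    exact ⟨k, by simpa using hk⟩
  card := card_thresholdFamily_injective hns hs
  rigid f hf h := thresholdFamily_rigid (by omega) hf h

end ThresholdFamily

/-- Theorem A: for each `n ≥ 2` there are focused graphs with arbitrarily many vertices,
trivial graph automorphism group, and `PGL_n(ℤ) ≤ Out(Out(A_Γ))`. -/
theorem stmt0 (n : ℕ) (hn : 2 ≤ n) (N : ℕ) :
    ∃ (V : Type) (_ : Fintype V) (G : SimpleGraph V) (c : V),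
      Focused G c ∧ TrivialAut G ∧ N < Nat.card V ∧
      ∃ f : PGLZ n →* Out (Out (RAAG G)), Function.Injective f := by
  have F := blobFamily_thresholdFamily (s := n + N + 6) hn (by omega) (by omega)
  refine ⟨_, inferInstance, _, none, F.focused, F.trivialAut, ?_,
    (F.blobGraph.translationData (by omega)).exists_injective_PGLZ⟩
  have h := Nat.card_le_card_of_injective
    (BlobFamily.lnk : Fin (2 * (n + N + 6)) → BlobFamily.Vert (thresholdFamily n (n + N + 6)))
    fun j k h => by simpa using h
  rw [Nat.card_fin] at h
  exact lt_of_lt_of_le (by omega) h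
end
end

section
/- If Γ is an austere finite simplicial graph with n = |V| > 1 vertices, then the group Out(Aut(A_Γ)) has cardinality at least 2^n. -/
noncomputable section

namespace RaagAut

theorem mem_star {V : Type} {G : SimpleGraph V} {u v : V} :
    u ∈ _root_.star G v ↔ u = v ∨ G.Adj v u := by
  simp [_root_.star]

section Basics

variable {V : Type} {G : SimpleGraph V} {H : Type*} [Group H]

/-- The homomorphism out of a RAAG determined by pairwise commuting images of adjacent vertices. -/
def lift (f : V → H) (hf : ∀ u v, G.Adj u v → Commute (f u) (f v)) : RAAG G →* H :=
  PresentedGroup.toGroup (f := f) (by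
    rintro r ⟨u, v, h, rfl⟩
    have := (hf u v h).eq
    simp [this])

@[simp]
theorem lift_gen (f : V → H) (hf : ∀ u v, G.Adj u v → Commute (f u) (f v)) (v : V) :
    lift (G := G) f hf (gen G v) = f v :=
  PresentedGroup.toGroup.of _

theorem hom_ext {f g : RAAG G →* H} (h : ∀ v, f (gen G v) = g (gen G v)) : f = g :=
  PresentedGroup.ext h

theorem mem_of_gen_mem {K : Subgroup (RAAG G)} (h : ∀ v, gen G v ∈ K) (g : RAAG G) : g ∈ K := by
  have : Subgroup.closure (Set.range (PresentedGroup.of (rels := raagRels G))) ≤ K := by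
    rw [Subgroup.closure_le]
    rintro _ ⟨v, rfl⟩
    exact h v
  rw [PresentedGroup.closure_range_of] at this
  exact this trivial

theorem commute_gen {u v : V} (h : G.Adj u v) : Commute (gen G u) (gen G v) := by
  have h1 : (PresentedGroup.mk (raagRels G)) (FreeGroup.of u * FreeGroup.of v *
      (FreeGroup.of u)⁻¹ * (FreeGroup.of v)⁻¹) = 1 :=
    PresentedGroup.one_of_mem ⟨u, v, h, rfl⟩
  simp only [map_mul, map_inv] at h1
  exact (mul_inv_eq_iff_eq_mul.mp (mul_inv_eq_one.mp h1))

variable (G) in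
open Classical in
/-- The retraction of a RAAG killing the vertices outside `S`. -/
def retr (S : Set V) : RAAG G →* RAAG G :=
  lift (fun v => if v ∈ S then gen G v else 1) (by
    intro u v h
    split_ifs <;> simp [commute_gen h])

theorem retr_gen_of_mem {S : Set V} {v : V} (h : v ∈ S) : retr G S (gen G v) = gen G v := by
  simp [retr, h]

theorem retr_gen_of_notMem {S : Set V} {v : V} (h : v ∉ S) : retr G S (gen G v) = 1 := by
  simp [retr, h]

theorem retr_retr (S T : Set V) (g : RAAG G) : retr G S (retr G T g) = retr G (S ∩ T) g := by
  have : (retr G S).comp (retr G T) = retr G (S ∩ T) := by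
    refine hom_ext fun v => ?_
    by_cases hT : v ∈ T <;> by_cases hS : v ∈ S <;> simp [retr, hS, hT]
  exact DFunLike.congr_fun this g

variable (G) in
/-- The standard parabolic subgroup on `S`, as the fixed subgroup of the retraction. -/
def par (S : Set V) : Subgroup (RAAG G) := (retr G S).eqLocus (MonoidHom.id _)

theorem mem_par {S : Set V} {g : RAAG G} : g ∈ par G S ↔ retr G S g = g := Iff.rfl

theorem retr_mem_par_inter (S : Set V) {T : Set V} {g : RAAG G} (hg : g ∈ par G T) :
    retr G S g ∈ par G (S ∩ T) := by
  rw [mem_par, retr_retr]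
  rw [mem_par] at hg
  conv_rhs => rw [← hg, retr_retr]
  congr 2
  ext; simp; tauto

theorem retr_mem_par (S : Set V) (g : RAAG G) : retr G S g ∈ par G S := by
  rw [mem_par, retr_retr, Set.inter_self]

theorem par_mono {S T : Set V} (h : S ⊆ T) : par G S ≤ par G T := by
  intro g hg
  rw [mem_par] at hg ⊢
  conv_lhs => rw [← hg, retr_retr, Set.inter_eq_right.mpr h]
  exact hg

theorem par_inter {S T : Set V} {g : RAAG G} (hS : g ∈ par G S) (hT : g ∈ par G T) :
    g ∈ par G (S ∩ T) := by
  have := retr_mem_par_inter S hT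
  rwa [mem_par.mp hS] at this

theorem retr_mem_par_of_mem (S : Set V) {T : Set V} {g : RAAG G} (hg : g ∈ par G T) :
    retr G S g ∈ par G T :=
  par_mono Set.inter_subset_right (retr_mem_par_inter S hg)

theorem gen_mem_par {S : Set V} {v : V} (h : v ∈ S) : gen G v ∈ par G S :=
  mem_par.mpr (retr_gen_of_mem h)

theorem par_le {S : Set V} {K : Subgroup (RAAG G)} (h : ∀ v ∈ S, gen G v ∈ K) :
    par G S ≤ K := by
  intro g hg
  rw [mem_par] at hg
  rw [← hg]
  refine mem_of_gen_mem (K := K.comap (retr G S)) (fun v => ?_) g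
  by_cases hv : v ∈ S
  · simpa [retr_gen_of_mem hv] using h v hv
  · simp [retr_gen_of_notMem hv]

theorem mem_par_univ (g : RAAG G) : g ∈ par G Set.univ :=
  mem_of_gen_mem (fun _ => gen_mem_par trivial) g

theorem par_empty {g : RAAG G} (hg : g ∈ par G ∅) : g = 1 := by
  have := par_le (G := G) (S := ∅) (K := ⊥) (by simp) hg
  simpa using this

/-- An element conjugate into two parabolic subgroups is conjugate into their intersection. -/
theorem conj_into_inter {S T : Set V} {g : RAAG G} (hS : ∃ c, c * g * c⁻¹ ∈ par G S)
    (hT : ∃ c, c * g * c⁻¹ ∈ par G T) : ∃ c, c * g * c⁻¹ ∈ par G (S ∩ T) := by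
  obtain ⟨a, ha⟩ := hS
  obtain ⟨b, hb⟩ := hT
  refine ⟨retr G S (b * a⁻¹) * a, ?_⟩
  have := retr_mem_par_inter S hb
  convert this using 1
  have h2 : b * g * b⁻¹ = (b * a⁻¹) * (a * g * a⁻¹) * (b * a⁻¹)⁻¹ := by group
  conv_rhs => rw [h2, map_mul, map_mul, mem_par.mp ha, map_inv]
  group

end Basics

section Cover

variable {V : Type} (G : SimpleGraph V) (w : V)

/-- The defining graph of the kernel of the exponent homomorphism at `w`
(with redundant copies of the neighbours of `w`). -/
def coverGraph : SimpleGraph (V × ℤ) where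
  Adj p q := G.Adj p.1 q.1 ∧ (p.2 = q.2 ∨ G.Adj w p.1 ∨ G.Adj w q.1)
  symm := ⟨fun p q h => ⟨h.1.symm, by have := h.2; tauto⟩⟩
  loopless := ⟨fun p h => G.loopless.irrefl _ h.1⟩

open Classical in
/-- Translation of the vertices of `coverGraph G w`. -/
def shiftPt (n : ℤ) (p : V × ℤ) : V × ℤ := if G.Adj w p.1 then p else (p.1, p.2 + n)

theorem shiftPt_shiftPt (m n : ℤ) (p : V × ℤ) :
    shiftPt G w m (shiftPt G w n p) = shiftPt G w (m + n) p := by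
  by_cases h : G.Adj w p.1 <;> simp [shiftPt, h]
  ring

theorem coverGraph_adj_shiftPt (n : ℤ) {p q : V × ℤ} (h : (coverGraph G w).Adj p q) :
    (coverGraph G w).Adj (shiftPt G w n p) (shiftPt G w n q) := by
  obtain ⟨h1, h2⟩ := h
  by_cases hp : G.Adj w p.1 <;> by_cases hq : G.Adj w q.1 <;>
    simp_all [coverGraph, shiftPt]

/-- The endomorphism induced by `shiftPt`. -/
def shiftHom (n : ℤ) : RAAG (coverGraph G w) →* RAAG (coverGraph G w) :=
  lift (fun p => gen _ (shiftPt G w n p))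
    (fun _ _ h => commute_gen (coverGraph_adj_shiftPt G w n h))

theorem shiftHom_shiftHom (m n : ℤ) (g : RAAG (coverGraph G w)) :
    shiftHom G w m (shiftHom G w n g) = shiftHom G w (m + n) g := by
  have : (shiftHom G w m).comp (shiftHom G w n) = shiftHom G w (m + n) :=
    hom_ext fun v => by simp [shiftHom, shiftPt_shiftPt]
  exact DFunLike.congr_fun this g

theorem shiftHom_zero (g : RAAG (coverGraph G w)) : shiftHom G w 0 g = g := by
  have : shiftHom G w 0 = MonoidHom.id _ :=
    hom_ext fun v => by simp [shiftHom, shiftPt]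
  exact DFunLike.congr_fun this g

/-- The action of `ℤ` on the cover by translations. -/
def shift : Multiplicative ℤ →* MulAut (RAAG (coverGraph G w)) where
  toFun n :=
    { shiftHom G w n.toAdd with
      invFun := shiftHom G w (-n.toAdd)
      left_inv := fun g => by simp [shiftHom_shiftHom, shiftHom_zero]
      right_inv := fun g => by simp [shiftHom_shiftHom, shiftHom_zero] }
  map_one' := by ext g; exact shiftHom_zero G w g
  map_mul' m n := by ext g; exact (shiftHom_shiftHom G w m.toAdd n.toAdd g).symm

theorem shift_apply (n : Multiplicative ℤ) (g : RAAG (coverGraph G w)) :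
    shift G w n g = shiftHom G w n.toAdd g := rfl

open Classical in
/-- The embedding of a RAAG in the semidirect product of the cover with `ℤ`. -/
def toCover : RAAG G →* RAAG (coverGraph G w) ⋊[shift G w] Multiplicative ℤ :=
  lift (fun u => if u = w then SemidirectProduct.inr (Multiplicative.ofAdd 1)
    else SemidirectProduct.inl (gen _ (u, 0))) (by
    have key : ∀ v, G.Adj w v → Commute
        (SemidirectProduct.inr (Multiplicative.ofAdd 1) :
          RAAG (coverGraph G w) ⋊[shift G w] Multiplicative ℤ)
        (SemidirectProduct.inl (gen _ (v, 0))) := by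
      intro v h
      have : shift G w (Multiplicative.ofAdd 1) (gen _ (v, 0)) = gen _ (v, 0) := by
        simp [shift_apply, shiftHom, shiftPt, h]
      ext <;> simp [this]
    intro u v h
    split_ifs with h1 h2 h2
    · exact Commute.refl _
    · exact key v (h1 ▸ h)
    · exact (key u (h2 ▸ h.symm)).symm
    · exact (commute_gen (G := coverGraph G w) (u := (u, 0)) (v := (v, 0))
        ⟨h, Or.inl rfl⟩).map SemidirectProduct.inl)

/-- The projection of the cover back to the RAAG. -/
def ofCover : RAAG (coverGraph G w) →* RAAG G :=
  lift (fun p => gen G w ^ p.2 * gen G p.1 * (gen G w ^ p.2)⁻¹) (by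
    have key : ∀ (i : ℤ) (u : V), G.Adj w u →
        gen G w ^ i * gen G u * (gen G w ^ i)⁻¹ = gen G u := by
      intro i u h
      rw [((commute_gen h).zpow_left i).eq, mul_inv_cancel_right]
    have conj : ∀ (i : ℤ) (u v : V), G.Adj u v → Commute
        (gen G w ^ i * gen G u * (gen G w ^ i)⁻¹) (gen G w ^ i * gen G v * (gen G w ^ i)⁻¹) := by
      intro i u v h
      exact (commute_gen h).map (MulAut.conj (gen G w ^ i))
    rintro ⟨u, i⟩ ⟨v, j⟩ ⟨h, h'⟩
    dsimp only at h h' ⊢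
    rcases h' with rfl | h' | h'
    · exact conj i u v h
    · rw [key i u h', ← key j u h']
      exact conj j u v h
    · rw [key j v h', ← key i v h']
      exact conj i u v h)

/-- The projection of the semidirect product of the cover back to the RAAG. -/
def ofSemi : RAAG (coverGraph G w) ⋊[shift G w] Multiplicative ℤ →* RAAG G :=
  SemidirectProduct.lift (ofCover G w) (zpowersHom _ (gen G w)) (by
    intro n
    refine hom_ext fun p => ?_
    by_cases hp : G.Adj w p.1
    · have h1 : ∀ i : ℤ, gen G w ^ i * gen G p.1 * (gen G w ^ i)⁻¹ = gen G p.1 := by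
        intro i
        rw [((commute_gen hp).zpow_left i).eq, mul_inv_cancel_right]
      simp [shift_apply, shiftHom, shiftPt, ofCover, hp, zpowersHom_apply, h1, -map_zpow]
    · simp [shift_apply, shiftHom, shiftPt, ofCover, hp, zpowersHom_apply, -map_zpow]
      group)

theorem ofSemi_toCover (g : RAAG G) : ofSemi G w (toCover G w g) = g := by
  have : (ofSemi G w).comp (toCover G w) = MonoidHom.id _ := by
    refine hom_ext fun v => ?_
    by_cases h : v = w
    · subst h; simp [toCover, ofSemi]
    · simp [toCover, h, ofSemi, ofCover]
  exact DFunLike.congr_fun this g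

/-- The exponent sum of the vertex `w`. -/
def expo : RAAG G →* Multiplicative ℤ :=
  (SemidirectProduct.rightHom).comp (toCover G w)

theorem expo_gen_self : expo G w (gen G w) = Multiplicative.ofAdd 1 := by
  simp [expo, toCover]

variable {w} in
theorem expo_gen_of_ne {v : V} (h : v ≠ w) : expo G w (gen G v) = 1 := by
  simp [expo, toCover, h]

variable {G w}

theorem toCover_eq_inl {g : RAAG G} (h : expo G w g = 1) :
    toCover G w g = SemidirectProduct.inl (toCover G w g).left := by
  ext
  · simp
  · simpa [expo] using h

theorem expo_eq_one_of_mem_par {S : Set V} (hw : w ∉ S) {g : RAAG G} (hg : g ∈ par G S) :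
    expo G w g = 1 := by
  refine par_le (K := (expo G w).ker) (fun v hv => ?_) hg
  exact expo_gen_of_ne G (fun h => hw (h ▸ hv))

theorem exists_bounded_par (g : RAAG (coverGraph G w)) :
    ∃ N : ℕ, g ∈ par (coverGraph G w) {p | |p.2| ≤ N} := by
  have hmono : ∀ {M N : ℕ}, M ≤ N → par (coverGraph G w) {p | |p.2| ≤ M} ≤
      par (coverGraph G w) {p | |p.2| ≤ N} := fun h =>
    par_mono fun p (hp : |p.2| ≤ _) => show |p.2| ≤ _ by omega
  let K : Subgroup (RAAG (coverGraph G w)) :=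
    { carrier := {g | ∃ N : ℕ, g ∈ par (coverGraph G w) {p | |p.2| ≤ N}}
      one_mem' := ⟨0, one_mem _⟩
      mul_mem' := by
        rintro a b ⟨M, ha⟩ ⟨N, hb⟩
        exact ⟨max M N, mul_mem (hmono (le_max_left _ _) ha) (hmono (le_max_right _ _) hb)⟩
      inv_mem' := by
        rintro a ⟨M, ha⟩
        exact ⟨M, inv_mem ha⟩ }
  refine mem_of_gen_mem (K := K) (fun p => ⟨p.2.natAbs, gen_mem_par ?_⟩) g
  simp

theorem shiftHom_mem_par (n : ℤ) {S T : Set (V × ℤ)} (h : ∀ p ∈ S, shiftPt G w n p ∈ T)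
    {g : RAAG (coverGraph G w)} (hg : g ∈ par _ S) : shiftHom G w n g ∈ par _ T := by
  refine par_le (K := (par _ T).comap (shiftHom G w n)) (fun p hp => ?_) hg
  simpa [shiftHom] using gen_mem_par (h p hp)

theorem ofCover_mem_par {g : RAAG (coverGraph G w)} (hg : g ∈ par _ {p | G.Adj w p.1}) :
    ofCover G w g ∈ par G (G.neighborSet w) := by
  refine par_le (K := (par G _).comap (ofCover G w)) (fun p hp => ?_) hg
  have hp : G.Adj w p.1 := hp
  have : gen G w ^ p.2 * gen G p.1 * (gen G w ^ p.2)⁻¹ = gen G p.1 := by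
    rw [((commute_gen hp).zpow_left _).eq, mul_inv_cancel_right]
  simpa [ofCover, this] using gen_mem_par (S := G.neighborSet w) hp

theorem bounded_inter_shift_subset {N : ℕ} {m : ℤ} (hm : 2 * N < |m|) :
    {p : V × ℤ | |p.2| ≤ N} ∩ shiftPt G w m '' {p | |p.2| ≤ N} ⊆ {p | G.Adj w p.1} := by
  rintro _ ⟨h1, ⟨u, i⟩, h2, rfl⟩
  by_contra h3
  by_cases hu : G.Adj w u
  · simp [shiftPt, hu] at h3
  · simp only [shiftPt, hu, if_false, Set.mem_ofPred_eq] at h1 h2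
    grind

theorem lt_abs_mul_natCast {n : ℤ} (hn : n ≠ 0) (N : ℕ) :
    2 * (N : ℤ) < |n * (2 * N + 1 : ℕ)| := by
  rw [abs_mul]
  have := Int.one_le_abs hn
  push_cast
  rw [abs_of_nonneg (by positivity : (0 : ℤ) ≤ 2 * N + 1)]
  nlinarith

/-- If `g` has zero exponent at `w` and commutes with an element of nonzero exponent at `w`, then
`g` is conjugate into the parabolic subgroup on the link of `w`. -/
theorem conj_into_link {g h : RAAG G} (hc : Commute h g) (hg : expo G w g = 1)
    (hh : expo G w h ≠ 1) : ∃ c, c * g * c⁻¹ ∈ par G (G.neighborSet w) := by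
  set g' := (toCover G w g).left with hg'
  have hgl : toCover G w g = SemidirectProduct.inl g' := toCover_eq_inl hg
  obtain ⟨N, hN⟩ := exists_bounded_par g'
  set t : Multiplicative ℤ := expo G w h
  have ht : t.toAdd ≠ 0 := hh
  have hc' := ((hc.pow_left (2 * N + 1)).map (toCover G w)).eq
  rw [hgl] at hc'
  set k := (toCover G w (h ^ (2 * N + 1))).left
  have hr : (toCover G w (h ^ (2 * N + 1))).right = t ^ (2 * N + 1) := by
    change expo G w (h ^ (2 * N + 1)) = _
    rw [map_pow]
  have hl := congrArg SemidirectProduct.left hc'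
  simp only [SemidirectProduct.mul_left, SemidirectProduct.left_inl,
    SemidirectProduct.right_inl, map_one, MulAut.one_apply, hr] at hl
  rw [shift_apply] at hl
  have hm : 2 * (N : ℤ) < |(t ^ (2 * N + 1)).toAdd| := by
    rw [toAdd_pow, nsmul_eq_mul, mul_comm ((2 * N + 1 : ℕ) : ℤ)]
    exact lt_abs_mul_natCast ht N
  have h1 := shiftHom_mem_par (G := G) (w := w) (t ^ (2 * N + 1)).toAdd
    (T := shiftPt G w (t ^ (2 * N + 1)).toAdd '' {p | |p.2| ≤ N})
    (fun p hp => Set.mem_image_of_mem _ hp) hN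
  have h2 : shiftHom G w (t ^ (2 * N + 1)).toAdd g' = k⁻¹ * g' * k⁻¹⁻¹ := by
    rw [inv_inv, mul_assoc, ← hl, inv_mul_cancel_left]
  rw [h2] at h1
  obtain ⟨c, hcc⟩ := conj_into_inter (g := g') ⟨1, by simpa using hN⟩ ⟨_, h1⟩
  refine ⟨ofCover G w c, ?_⟩
  have h3 : ofCover G w g' = g := by
    rw [← ofSemi_toCover G w g, hgl]
    simp [ofSemi]
  have h4 := ofCover_mem_par (par_mono (bounded_inter_shift_subset hm) hcc)
  rwa [map_mul, map_mul, map_inv, h3] at h4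

/-- Centralizers of generators. -/
theorem exists_zpow_mul_mem_par {h : RAAG G} (hc : Commute (gen G w) h) :
    ∃ k : ℤ, gen G w ^ k * h ∈ par G (G.neighborSet w) := by
  refine ⟨-(expo G w h).toAdd, ?_⟩
  set g := gen G w ^ (-(expo G w h).toAdd) * h with hgdef
  have hcg : Commute (gen G w) g := ((Commute.refl _).zpow_right _).mul_right hc
  have hg : expo G w g = 1 := by
    rw [hgdef, map_mul, map_zpow, expo_gen_self, ← ofAdd_zsmul]
    simp
  clear_value g
  set g' := (toCover G w g).left with hg'
  have hgl : toCover G w g = SemidirectProduct.inl g' := toCover_eq_inl hg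
  obtain ⟨N, hN⟩ := exists_bounded_par g'
  have hc' := ((hcg.pow_left (2 * N + 1)).map (toCover G w)).eq
  rw [hgl, map_pow] at hc'
  have hw : toCover G w (gen G w) = SemidirectProduct.inr (Multiplicative.ofAdd 1) := by
    simp [toCover]
  rw [hw, ← map_pow] at hc'
  have hl := congrArg SemidirectProduct.left hc'
  simp only [SemidirectProduct.mul_left, SemidirectProduct.left_inl, SemidirectProduct.left_inr,
    SemidirectProduct.right_inl, SemidirectProduct.right_inr, map_one, one_mul, mul_one] at hl
  rw [shift_apply] at hl
  have hm : 2 * (N : ℤ) < |(Multiplicative.ofAdd (1 : ℤ) ^ (2 * N + 1)).toAdd| := by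
    rw [toAdd_pow, nsmul_eq_mul, mul_comm ((2 * N + 1 : ℕ) : ℤ)]
    exact lt_abs_mul_natCast one_ne_zero N
  have h1 := shiftHom_mem_par (G := G) (w := w) (Multiplicative.ofAdd (1 : ℤ) ^ (2 * N + 1)).toAdd
    (T := shiftPt G w (Multiplicative.ofAdd (1 : ℤ) ^ (2 * N + 1)).toAdd '' {p | |p.2| ≤ N})
    (fun p hp => Set.mem_image_of_mem _ hp) hN
  rw [hl] at h1
  have h3 : ofCover G w g' = g := by
    rw [← ofSemi_toCover G w g, hgl]
    simp [ofSemi]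
  rw [← h3]
  exact ofCover_mem_par (par_mono (bounded_inter_shift_subset hm) (par_inter hN h1))

theorem mem_par_star_of_commute {h : RAAG G} (hc : Commute (gen G w) h) :
    h ∈ par G (_root_.star G w) := by
  obtain ⟨k, hk⟩ := exists_zpow_mul_mem_par hc
  have h1 : gen G w ^ k ∈ par G (_root_.star G w) :=
    zpow_mem (gen_mem_par (mem_star.mpr (Or.inl rfl))) k
  have h2 := par_mono (T := _root_.star G w) (fun u hu => mem_star.mpr (Or.inr hu)) hk
  exact ((par G _).mul_mem_cancel_left h1).mp h2

end Cover

section Abelianization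

variable {V : Type} {G : SimpleGraph V}

variable (G) in
/-- The integer exponent sum of the vertex `w`. -/
def ex (w : V) (g : RAAG G) : ℤ := (expo G w g).toAdd

theorem ex_mul (w : V) (g h : RAAG G) : ex G w (g * h) = ex G w g + ex G w h := by
  simp [ex]

theorem ex_one (w : V) : ex G w 1 = 0 := by simp [ex]

theorem ex_inv (w : V) (g : RAAG G) : ex G w g⁻¹ = -ex G w g := by simp [ex]

theorem ex_zpow (w : V) (g : RAAG G) (n : ℤ) : ex G w (g ^ n) = n * ex G w g := by
  simp [ex]

theorem ex_conj (w : V) (c g : RAAG G) : ex G w (c * g * c⁻¹) = ex G w g := by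
  simp [ex_mul, ex_inv]

theorem ex_gen_self (w : V) : ex G w (gen G w) = 1 := by simp [ex, expo_gen_self]

theorem ex_gen_of_ne {v w : V} (h : v ≠ w) : ex G w (gen G v) = 0 := by
  simp [ex, expo_gen_of_ne G h]

theorem ex_eq_zero_of_mem_par {S : Set V} {w : V} (hw : w ∉ S) {g : RAAG G}
    (hg : g ∈ par G S) : ex G w g = 0 := by
  simp [ex, expo_eq_one_of_mem_par hw hg]

theorem ex_mul_ex_of_ne_zero {g h : RAAG G} (hc : Commute h g) {x y : V}
    (hadj : ¬G.Adj x y) (h0 : ex G x h ≠ 0) :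
    ex G x h * ex G y g = ex G x g * ex G y h := by
  have h1 : Commute h (g ^ ex G x h * h ^ (-ex G x g)) :=
    (hc.zpow_right _).mul_right ((Commute.refl h).zpow_right _)
  have h2 : ex G x (g ^ ex G x h * h ^ (-ex G x g)) = 0 := by
    rw [ex_mul, ex_zpow, ex_zpow]; ring
  obtain ⟨c, hc'⟩ := conj_into_link h1 h2 h0
  have h3 := ex_eq_zero_of_mem_par (w := y) hadj hc'
  rw [ex_conj, ex_mul, ex_zpow, ex_zpow] at h3
  linarith

/-- Commuting elements have proportional exponents at non-adjacent vertices. -/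
theorem ex_minor_eq_zero {g h : RAAG G} (hc : Commute g h) {x y : V} (hadj : ¬G.Adj x y) :
    ex G x g * ex G y h - ex G y g * ex G x h = 0 := by
  by_cases h1 : ex G x h = 0
  · by_cases h2 : ex G x g = 0
    · simp [h1, h2]
    · have := ex_mul_ex_of_ne_zero hc hadj h2
      linarith
  · have := ex_mul_ex_of_ne_zero hc.symm hadj h1
    linarith

variable [Fintype V]

theorem ex_map (φ : RAAG G →* RAAG G) (a : V) (g : RAAG G) :
    ex G a (φ g) = ∑ k, ex G a (φ (gen G k)) * ex G k g := by
  classical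
  let K : Subgroup (RAAG G) :=
    { carrier := {g | ex G a (φ g) = ∑ k, ex G a (φ (gen G k)) * ex G k g}
      one_mem' := by simp [ex_one]
      mul_mem' := by
        intro g h (hg : _ = _) (hh : _ = _)
        change _ = _
        simp only [map_mul, ex_mul, hg, hh, mul_add, Finset.sum_add_distrib]
      inv_mem' := by
        intro g (hg : _ = _)
        change _ = _
        simp only [map_inv, ex_inv, hg, mul_neg, Finset.sum_neg_distrib] }
  refine mem_of_gen_mem (K := K) (fun v => ?_) g
  change _ = _
  rw [Finset.sum_eq_single v]
  · rw [ex_gen_self, mul_one]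
  · intro b _ hb
    rw [ex_gen_of_ne hb.symm, mul_zero]
  · simp

theorem sum_ex_mul_ex_symm (φ : MulAut (RAAG G)) (a b : V) :
    ∑ k, ex G a (φ (gen G k)) * ex G k (φ.symm (gen G b)) = ex G a (gen G b) := by
  refine (ex_map φ.toMonoidHom a (φ.symm (gen G b))).symm.trans ?_
  simp

theorem ex_mul_ex_symm_eq_zero (hdom : ∀ u v : V, u ≠ v → ¬Dominates G u v)
    (φ : MulAut (RAAG G)) {a b : V} (hab : a ≠ b) (k : V) :
    ex G a (φ (gen G k)) * ex G k (φ.symm (gen G b)) = 0 := by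
  obtain ⟨w, hbw, hw⟩ := Set.not_subset.mp (hdom a b hab)
  have hbw : G.Adj b w := hbw
  rw [mem_star, not_or] at hw
  have key : ∀ j, (ex G k (φ.symm (gen G b)) * ex G j (φ.symm (gen G w)) -
      ex G j (φ.symm (gen G b)) * ex G k (φ.symm (gen G w))) *
      (ex G a (φ (gen G k)) * ex G w (φ (gen G j)) -
        ex G w (φ (gen G k)) * ex G a (φ (gen G j))) = 0 := by
    intro j
    by_cases hkj : G.Adj k j
    · rw [ex_minor_eq_zero ((commute_gen hkj).map φ) hw.2, mul_zero]
    · rw [ex_minor_eq_zero ((commute_gen hbw).map φ.symm) hkj, zero_mul]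
  have hsum := Finset.sum_eq_zero (fun j (_ : j ∈ Finset.univ) => key j)
  have expand : ∀ j, (ex G k (φ.symm (gen G b)) * ex G j (φ.symm (gen G w)) -
      ex G j (φ.symm (gen G b)) * ex G k (φ.symm (gen G w))) *
      (ex G a (φ (gen G k)) * ex G w (φ (gen G j)) -
        ex G w (φ (gen G k)) * ex G a (φ (gen G j))) =
      ex G k (φ.symm (gen G b)) * ex G a (φ (gen G k)) *
          (ex G w (φ (gen G j)) * ex G j (φ.symm (gen G w))) -
        ex G k (φ.symm (gen G b)) * ex G w (φ (gen G k)) *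
          (ex G a (φ (gen G j)) * ex G j (φ.symm (gen G w))) -
        ex G k (φ.symm (gen G w)) * ex G a (φ (gen G k)) *
          (ex G w (φ (gen G j)) * ex G j (φ.symm (gen G b))) +
        ex G k (φ.symm (gen G w)) * ex G w (φ (gen G k)) *
          (ex G a (φ (gen G j)) * ex G j (φ.symm (gen G b))) := by
    intro j; ring
  simp only [expand, Finset.sum_add_distrib, Finset.sum_sub_distrib, ← Finset.mul_sum,
    sum_ex_mul_ex_symm] at hsum
  rw [ex_gen_self, ex_gen_of_ne hw.1, ex_gen_of_ne hbw.ne, ex_gen_of_ne hab.symm] at hsum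
  linarith

/-- Every automorphism of the RAAG acts on the abelianization by a diagonal matrix of signs. -/
theorem exists_signs (haut : TrivialAut G) (hdom : ∀ u v : V, u ≠ v → ¬Dominates G u v)
    (φ : MulAut (RAAG G)) : ∃ ε : V → ℤˣ, (∀ k, ex G k (φ (gen G k)) = ε k) ∧
      ∀ a k, a ≠ k → ex G a (φ (gen G k)) = 0 := by
  have hNM : ∀ k l, ∑ a, ex G k (φ.symm (gen G a)) * ex G a (φ (gen G l)) =
      ex G k (gen G l) := fun k l => sum_ex_mul_ex_symm φ.symm k l
  have hex : ∀ k, ∃ a, ex G k (φ.symm (gen G a)) * ex G a (φ (gen G k)) ≠ 0 := by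
    intro k
    by_contra! h
    have := hNM k k
    rw [Finset.sum_eq_zero (fun a _ => h a), ex_gen_self] at this
    exact zero_ne_one this
  choose σ hσ using hex
  have hM : ∀ a k, a ≠ σ k → ex G a (φ (gen G k)) = 0 := fun a k ha =>
    (mul_eq_zero.mp (ex_mul_ex_symm_eq_zero hdom φ ha k)).resolve_right
      (left_ne_zero_of_mul (hσ k))
  have hN : ∀ b k, b ≠ σ k → ex G k (φ.symm (gen G b)) = 0 := fun b k hb =>
    (mul_eq_zero.mp (ex_mul_ex_symm_eq_zero hdom φ hb.symm k)).resolve_left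
      (right_ne_zero_of_mul (hσ k))
  have hone : ∀ k l, ex G k (φ.symm (gen G (σ k))) * ex G (σ k) (φ (gen G l)) =
      ex G k (gen G l) := by
    intro k l
    rw [← hNM k l, Finset.sum_eq_single (σ k)]
    · intro b _ hb
      rw [hN b k hb, zero_mul]
    · simp
  have hinj : Function.Injective σ := by
    intro k l hkl
    by_contra hne
    have := hone k l
    rw [ex_gen_of_ne (Ne.symm hne)] at this
    rcases mul_eq_zero.mp this with h | h
    · exact left_ne_zero_of_mul (hσ k) h
    · rw [hkl] at h
      exact right_ne_zero_of_mul (hσ l) h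
  have hadj : ∀ u v, G.Adj (σ u) (σ v) ↔ G.Adj u v := by
    intro u v
    constructor
    · intro h
      by_contra huv
      have hne : σ u ≠ σ v := h.ne
      have := ex_minor_eq_zero ((commute_gen h).map φ.symm) huv
      rw [hN _ _ hne, zero_mul, sub_zero] at this
      rcases mul_eq_zero.mp this with h | h
      · exact left_ne_zero_of_mul (hσ u) h
      · exact left_ne_zero_of_mul (hσ v) h
    · intro h
      by_contra huv
      have hne : σ u ≠ σ v := fun h' => h.ne (hinj h')
      have := ex_minor_eq_zero ((commute_gen h).map φ) huv
      rw [hM _ _ hne, mul_zero, sub_zero] at this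
      rcases mul_eq_zero.mp this with h | h
      · exact right_ne_zero_of_mul (hσ u) h
      · exact right_ne_zero_of_mul (hσ v) h
  have hid : ∀ v, σ v = v := haut
    ⟨Equiv.ofBijective σ (Finite.injective_iff_bijective.mp hinj), fun {u v} => hadj u v⟩
  have hunit : ∀ k, IsUnit (ex G k (φ (gen G k))) := by
    intro k
    have := hone k k
    rw [hid, ex_gen_self] at this
    exact IsUnit.of_mul_eq_one_right _ this
  refine ⟨fun k => (hunit k).unit, fun k => rfl, fun a k h => hM a k ?_⟩
  rwa [hid]

/-- Every automorphism sends each generator to a conjugate of itself or its inverse. -/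
theorem exists_conj_gen (haut : TrivialAut G) (hdom : ∀ u v : V, u ≠ v → ¬Dominates G u v)
    (φ : MulAut (RAAG G)) : ∃ (ε : V → ℤˣ) (c : V → RAAG G),
      ∀ u, φ (gen G u) = c u * gen G u ^ (ε u : ℤ) * (c u)⁻¹ := by
  classical
  obtain ⟨ε, hε, hoff⟩ := exists_signs haut hdom φ
  have hlink : ∀ u w, G.Adj u w → ∃ c, c * φ (gen G u) * c⁻¹ ∈ par G (G.neighborSet w) := by
    intro u w h
    refine conj_into_link ((commute_gen h.symm).map φ) (hoff w u h.symm.ne) ?_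
    intro h0
    have h1 : ex G w (φ (gen G w)) = 0 := h0
    rw [hε] at h1
    exact (ε w).ne_zero h1
  have hfin : ∀ u (s : Finset V), (∀ w ∈ s, G.Adj u w) →
      ∃ c, c * φ (gen G u) * c⁻¹ ∈ par G {x | ∀ w ∈ s, G.Adj w x} := by
    intro u s
    induction s using Finset.induction_on with
    | empty => exact fun _ => ⟨1, par_mono (fun _ _ => by simp) (mem_par_univ _)⟩
    | insert w s _ ih =>
      intro h
      obtain ⟨c, hc⟩ := conj_into_inter (hlink u w (h w (Finset.mem_insert_self w s)))
        (ih fun v hv => h v (Finset.mem_insert_of_mem hv))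
      refine ⟨c, par_mono ?_ hc⟩
      rintro x ⟨h1, h2⟩ v hv
      rcases Finset.mem_insert.mp hv with rfl | hv
      · exact h1
      · exact h2 v hv
  have hconj : ∀ u, ∃ c, φ (gen G u) = c * gen G u ^ (ε u : ℤ) * c⁻¹ := by
    intro u
    obtain ⟨c, hc⟩ := hfin u (Finset.univ.filter (G.Adj u)) (by simp)
    have hsub : {x | ∀ w ∈ Finset.univ.filter (G.Adj u), G.Adj w x} ⊆ {u} := by
      intro x hx
      by_contra hxu
      refine hdom x u hxu fun w hw => mem_star.mpr (Or.inr ?_)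
      exact (hx w (by simpa using hw)).symm
    have hz : c * φ (gen G u) * c⁻¹ ∈ Subgroup.zpowers (gen G u) :=
      par_le (by rintro v rfl; exact Subgroup.mem_zpowers _) (par_mono hsub hc)
    obtain ⟨n, hn⟩ := hz
    have hn : gen G u ^ n = c * φ (gen G u) * c⁻¹ := hn
    have hn' : n = ε u := by
      have := congrArg (ex G u) hn
      rwa [ex_zpow, ex_gen_self, ex_conj, hε, mul_one] at this
    refine ⟨c⁻¹, ?_⟩
    rw [← hn', hn]
    group
  choose c hc using hconj
  exact ⟨ε, c, hc⟩

end Abelianization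

section Generation

variable {V : Type} (G : SimpleGraph V) (x : V)

/-- `Ball G x n g` says that `g` has a word with exactly `n` letters `x` or `x⁻¹`. -/
inductive Ball : ℕ → RAAG G → Prop
  | one : Ball 0 1
  | left {n : ℕ} {a g : RAAG G} : a ∈ par G {x}ᶜ → Ball n g → Ball n (a * g)
  | gen {n : ℕ} {g : RAAG G} : Ball n g → Ball (n + 1) (gen G x * g)
  | inv {n : ℕ} {g : RAAG G} : Ball n g → Ball (n + 1) ((_root_.gen G x)⁻¹ * g)

variable {G x}

theorem Ball.right {n : ℕ} {g b : RAAG G} (h : Ball G x n g) (hb : b ∈ par G {x}ᶜ) :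
    Ball G x n (g * b) := by
  induction h with
  | one => simpa using Ball.left hb Ball.one
  | left ha _ ih => rw [mul_assoc]; exact ih.left ha
  | gen _ ih => rw [mul_assoc]; exact ih.gen
  | inv _ ih => rw [mul_assoc]; exact ih.inv

theorem mem_par_of_ball_zero {g : RAAG G} (h : Ball G x 0 g) : g ∈ par G {x}ᶜ := by
  generalize hn : 0 = n at h
  induction h with
  | one => exact one_mem _
  | left ha _ ih => exact mul_mem ha (ih hn)
  | gen => simp at hn
  | inv => simp at hn

theorem exists_ball (g : RAAG G) : ∃ n, Ball G x n g := by
  let K : Subgroup (RAAG G) :=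
    { carrier := {h | ∀ g, (∃ n, Ball G x n (h * g)) ↔ ∃ n, Ball G x n g}
      one_mem' := by simp
      mul_mem' := by
        intro a b ha hb g
        rw [mul_assoc, ha, hb]
      inv_mem' := by
        intro a ha g
        rw [← ha, mul_inv_cancel_left] }
  have hK : g ∈ K := by
    refine mem_of_gen_mem (fun v h => ?_) g
    by_cases hv : v = x
    · subst hv
      refine ⟨fun ⟨n, hn⟩ => ⟨n + 1, ?_⟩, fun ⟨n, hn⟩ => ⟨n + 1, hn.gen⟩⟩
      simpa using hn.inv
    · have hm : gen G v ∈ par G {x}ᶜ := gen_mem_par hv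
      refine ⟨fun ⟨n, hn⟩ => ⟨n, ?_⟩, fun ⟨n, hn⟩ => ⟨n, hn.left hm⟩⟩
      simpa using hn.left (inv_mem hm)
  simpa using (hK 1).mpr ⟨0, Ball.one⟩

variable (G x) in
/-- The line of translates of `g` by powers of `x` comes closer than `m` to the identity. -/
def Near (m : ℕ) (g : RAAG G) : Prop := ∃ k : ℤ, ∃ j < m, Ball G x j (gen G x ^ k * g)

theorem near_zpow_mul (m : ℕ) (i : ℤ) (g : RAAG G) :
    Near G x m (gen G x ^ i * g) ↔ Near G x m g := by
  constructor
  · rintro ⟨k, j, hj, h⟩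
    refine ⟨k + i, j, hj, ?_⟩
    rwa [zpow_add, mul_assoc]
  · rintro ⟨k, j, hj, h⟩
    refine ⟨k - i, j, hj, ?_⟩
    rwa [← mul_assoc, ← zpow_add, sub_add_cancel]

theorem near_gen_mul_self (m : ℕ) (g : RAAG G) : Near G x m (gen G x * g) ↔ Near G x m g := by
  simpa using near_zpow_mul (x := x) m 1 g

theorem near_gen_inv_mul_self (m : ℕ) (g : RAAG G) :
    Near G x m ((gen G x)⁻¹ * g) ↔ Near G x m g := by
  simpa using near_zpow_mul (x := x) m (-1) g

theorem near_gen_mul {u : V} (hu : G.Adj x u) (m : ℕ) (g : RAAG G) :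
    Near G x m (gen G u * g) ↔ Near G x m g := by
  have hm : gen G u ∈ par G {x}ᶜ := gen_mem_par hu.symm.ne
  have hc : ∀ k : ℤ, gen G x ^ k * (gen G u * g) = gen G u * (gen G x ^ k * g) := by
    intro k
    rw [← mul_assoc, ((commute_gen hu).zpow_left k).eq, mul_assoc]
  constructor
  · rintro ⟨k, j, hj, h⟩
    refine ⟨k, j, hj, ?_⟩
    rw [hc] at h
    simpa using h.left (inv_mem hm)
  · rintro ⟨k, j, hj, h⟩
    refine ⟨k, j, hj, ?_⟩
    rw [hc]
    exact h.left hm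

theorem near_mul_right {m : ℕ} {g b : RAAG G} (h : Near G x m g) (hb : b ∈ par G {x}ᶜ) :
    Near G x m (g * b) := by
  obtain ⟨k, j, hj, h⟩ := h
  refine ⟨k, j, hj, ?_⟩
  rw [← mul_assoc]
  exact h.right hb

open Classical in
variable (G x) in
/-- Left multiplication by `x`, restricted to the lines that come close to the identity. -/
def truncPerm (m : ℕ) : Equiv.Perm (RAAG G) where
  toFun g := if Near G x m g then gen G x * g else g
  invFun g := if Near G x m g then (gen G x)⁻¹ * g else g
  left_inv g := by
    by_cases h : Near G x m g <;> simp [h, near_gen_mul_self]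
  right_inv g := by
    by_cases h : Near G x m g <;> simp [h, near_gen_inv_mul_self]

theorem truncPerm_apply_of_near {m : ℕ} {g : RAAG G} (h : Near G x m g) :
    truncPerm G x m g = gen G x * g := by simp [truncPerm, h]

theorem truncPerm_apply_of_not_near {m : ℕ} {g : RAAG G} (h : ¬Near G x m g) :
    truncPerm G x m g = g := by simp [truncPerm, h]

open Classical in
variable (G x) in
/-- The permutation action in which `x` acts by `truncPerm` and all other generators by left
multiplication. -/
def truncHom (m : ℕ) : RAAG G →* Equiv.Perm (RAAG G) :=
  lift (fun v => if v = x then truncPerm G x m else MulAction.toPermHom (RAAG G) (RAAG G) (gen G v))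
    (by
      have key : ∀ v, G.Adj x v →
          Commute (truncPerm G x m) (MulAction.toPermHom (RAAG G) (RAAG G) (gen G v)) := by
        intro v hv
        ext g
        have := (commute_gen hv).eq
        by_cases h : Near G x m g <;>
          simp [truncPerm, near_gen_mul hv, h, ← mul_assoc, this]
      intro u v h
      split_ifs with h1 h2 h2
      · exact Commute.refl _
      · exact key v (h1 ▸ h)
      · exact (key u (h2 ▸ h.symm)).symm
      · exact (commute_gen h).map _)

theorem truncHom_gen_self (m : ℕ) : truncHom G x m (gen G x) = truncPerm G x m := by
  simp [truncHom]

theorem truncHom_apply_of_mem {m : ℕ} {a : RAAG G} (ha : a ∈ par G {x}ᶜ) (g : RAAG G) :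
    truncHom G x m a g = a * g := by
  have : a ∈ (truncHom G x m).eqLocus (MulAction.toPermHom (RAAG G) (RAAG G)) := by
    refine par_le (fun v hv => ?_) ha
    have hv : v ≠ x := hv
    change truncHom G x m (gen G v) = _
    simp [truncHom, hv]
  exact DFunLike.congr_fun this g

theorem truncHom_apply_of_ball {m n : ℕ} {g b : RAAG G} (h : Ball G x n g) (hn : n ≤ m)
    (hb : b ∈ par G {x}ᶜ) : truncHom G x m g b = g * b := by
  induction h with
  | one => simp
  | left ha _ ih =>
    rw [map_mul, Equiv.Perm.mul_apply, ih hn, truncHom_apply_of_mem ha, mul_assoc]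
  | @gen n g h ih =>
    rw [map_mul, Equiv.Perm.mul_apply, ih (by omega), truncHom_gen_self, mul_assoc,
      truncPerm_apply_of_near]
    exact ⟨0, n, hn, by simpa using h.right hb⟩
  | @inv n g h ih =>
    rw [map_mul, Equiv.Perm.mul_apply, ih (by omega), map_inv, truncHom_gen_self,
      Equiv.Perm.inv_eq_iff_eq, mul_assoc, truncPerm_apply_of_near, mul_inv_cancel_left]
    rw [near_gen_inv_mul_self]
    exact ⟨0, n, hn, by simpa using h.right hb⟩

/-- If a conjugate of the generator `x` generates the RAAG together with the parabolic subgroup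
away from `x`, then the conjugator is trivial up to this subgroup and powers of `x`. -/
theorem exists_mul_zpow_mem_par {c : RAAG G}
    (hgen : ∀ K : Subgroup (RAAG G), par G {x}ᶜ ≤ K → c * gen G x * c⁻¹ ∈ K → ∀ g, g ∈ K) :
    ∃ k : ℤ, c * gen G x ^ k ∈ par G {x}ᶜ := by
  classical
  have hex : ∃ m, ∃ k : ℤ, Ball G x m (gen G x ^ k * c⁻¹) := by
    obtain ⟨m, hm⟩ := exists_ball (x := x) c⁻¹
    exact ⟨m, 0, by simpa using hm⟩
  obtain ⟨k, hk⟩ := Nat.find_spec hex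
  have hmin : ∀ j < Nat.find hex, ∀ k : ℤ, ¬Ball G x j (gen G x ^ k * c⁻¹) :=
    fun j hj k h => Nat.find_min hex hj ⟨k, h⟩
  set m := Nat.find hex
  rcases Nat.eq_zero_or_pos m with h0 | hpos
  · rw [h0] at hk
    refine ⟨-k, ?_⟩
    have := inv_mem (mem_par_of_ball_zero hk)
    rwa [mul_inv_rev, inv_inv, ← zpow_neg] at this
  exfalso
  set d := gen G x ^ k * c⁻¹ with hd
  have hcx : c * gen G x * c⁻¹ = d⁻¹ * gen G x * d := by
    rw [hd, mul_inv_rev, inv_inv]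
    group
  have hnear : ∀ b ∈ par G {x}ᶜ, ¬Near G x m (d * b) := by
    rintro b hb h
    have := near_mul_right h (inv_mem hb)
    rw [mul_inv_cancel_right, hd, near_zpow_mul] at this
    obtain ⟨i, j, hj, h⟩ := this
    exact hmin j hj i h
  have hfix : ∀ b ∈ par G {x}ᶜ, truncHom G x m (c * gen G x * c⁻¹) b = b := by
    intro b hb
    rw [hcx, map_mul, map_mul, Equiv.Perm.mul_apply, Equiv.Perm.mul_apply,
      truncHom_apply_of_ball hk le_rfl hb, truncHom_gen_self,
      truncPerm_apply_of_not_near (hnear b hb), map_inv, Equiv.Perm.inv_eq_iff_eq,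
      truncHom_apply_of_ball hk le_rfl hb]
  let K : Subgroup (RAAG G) :=
    { carrier := {g | ∀ b, truncHom G x m g b ∈ par G {x}ᶜ ↔ b ∈ par G {x}ᶜ}
      one_mem' := by simp
      mul_mem' := by
        intro a b ha hb g
        rw [map_mul, Equiv.Perm.mul_apply, ha, hb]
      inv_mem' := by
        intro a ha g
        rw [← ha, map_inv, ← Equiv.Perm.mul_apply, mul_inv_cancel, Equiv.Perm.one_apply] }
  have hK : gen G x ∈ K := by
    refine hgen K (fun a ha b => ?_) (fun b => ⟨fun h => ?_, fun h => ?_⟩) _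
    · rw [truncHom_apply_of_mem ha]
      exact (par G _).mul_mem_cancel_left ha
    · have := hfix _ h
      rwa [(truncHom G x m (c * gen G x * c⁻¹)).injective this] at h
    · rwa [hfix b h]
  have h1 := (hK 1).mpr (one_mem _)
  rw [truncHom_gen_self, truncPerm_apply_of_near ⟨0, 0, hpos, by simpa using Ball.one⟩,
    mul_one] at h1
  have := ex_eq_zero_of_mem_par (w := x) (by simp) h1
  rw [ex_gen_self] at this
  exact one_ne_zero this

end Generation

section Rigidity

variable {V : Type} {G : SimpleGraph V}

theorem notMem_star_comm {u v : V} : u ∉ _root_.star G v ↔ v ∉ _root_.star G u := by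
  rw [mem_star, mem_star, G.adj_comm, eq_comm]

theorem commute_retr_inv_mul {S : Set V} {v : V} (hv : v ∈ S) {g : RAAG G}
    (hg : g * gen G v * g⁻¹ ∈ par G S) : Commute (gen G v) ((retr G S g)⁻¹ * g) := by
  rw [mem_par, map_mul, map_mul, map_inv, retr_gen_of_mem hv] at hg
  change _ = _
  calc gen G v * ((retr G S g)⁻¹ * g)
      = (retr G S g)⁻¹ * (retr G S g * gen G v * (retr G S g)⁻¹) * g := by group
    _ = (retr G S g)⁻¹ * g * gen G v := by rw [hg]; group

theorem mem_par_compl_of_conj {x v : V} (hx : x ∉ _root_.star G v) {g : RAAG G}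
    (hg : g * gen G v * g⁻¹ ∈ par G {x}ᶜ) : g ∈ par G {x}ᶜ := by
  have hv : v ∈ ({x}ᶜ : Set V) := fun h => hx (mem_star.mpr (Or.inl h.symm))
  have h1 := par_mono (T := {x}ᶜ) (Set.subset_compl_singleton_iff.mpr hx)
    (mem_par_star_of_commute (commute_retr_inv_mul hv hg))
  exact ((par G _).mul_mem_cancel_left (inv_mem (retr_mem_par _ g))).mp h1

theorem mem_par_of_forall [Finite V] {S : Set V} {g : RAAG G}
    (h : ∀ x ∉ S, g ∈ par G {x}ᶜ) : g ∈ par G S := by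
  classical
  have := Fintype.ofFinite V
  have key : ∀ T : Finset V, (∀ x ∈ T, x ∉ S) → g ∈ par G (T : Set V)ᶜ := by
    intro T
    induction T using Finset.induction_on with
    | empty => exact fun _ => par_mono (fun _ _ => by simp) (mem_par_univ g)
    | insert x T _ ih =>
      intro hT
      refine par_mono ?_ (par_inter (h x (hT x (Finset.mem_insert_self x T)))
        (ih fun y hy => hT y (Finset.mem_insert_of_mem hy)))
      intro y
      simp
  refine par_mono ?_ (key (Finset.univ.filter (· ∉ S)) (by simp))
  intro x
  simp

/-- Cosets of the maximal standard parabolic subgroups that meet pairwise have a common point. -/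
theorem exists_mem_cosets [Finite V] (d : V → RAAG G)
    (hd : ∀ x y, x ≠ y → ∃ a ∈ par G {x}ᶜ, ∃ b ∈ par G {y}ᶜ, (d x)⁻¹ * d y = a * b) :
    ∃ g, ∀ x, (d x)⁻¹ * g ∈ par G {x}ᶜ := by
  classical
  have := Fintype.ofFinite V
  suffices ∀ S : Finset V, ∃ g, ∀ x ∈ S, (d x)⁻¹ * g ∈ par G {x}ᶜ by
    simpa using this Finset.univ
  intro S
  induction S using Finset.induction_on with
  | empty => exact ⟨1, by simp⟩
  | insert y S hy ih =>
    obtain ⟨g, hg⟩ := ih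
    set e := g⁻¹ * d y with he
    have hfac : ∀ x ∈ S, ∃ a ∈ par G {x}ᶜ, ∃ b ∈ par G {y}ᶜ, e = a * b := by
      intro x hx
      obtain ⟨a, ha, b, hb, hab⟩ := hd x y (fun h => hy (h ▸ hx))
      refine ⟨((d x)⁻¹ * g)⁻¹ * a, mul_mem (inv_mem (hg x hx)) ha, b, hb, ?_⟩
      rw [mul_assoc, ← hab, he]
      group
    have key : ∀ T ⊆ S, e⁻¹ * retr G (T : Set V)ᶜ e ∈ par G {y}ᶜ := by
      intro T
      induction T using Finset.induction_on with
      | empty =>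
        intro _
        have := mem_par.mp (mem_par_univ e)
        simp [this]
      | insert x T _ ihT =>
        intro hT
        obtain ⟨a, ha, b, hb, hab⟩ := hfac x (hT (Finset.mem_insert_self x T))
        have hq := ihT fun z hz => hT (Finset.mem_insert_of_mem hz)
        have hset : ((insert x T : Finset V) : Set V)ᶜ = {x}ᶜ ∩ (T : Set V)ᶜ := by
          ext z; simp
        rw [hset, ← retr_retr]
        set e' := retr G (T : Set V)ᶜ e
        have hb' : b * (e⁻¹ * e') ∈ par G {y}ᶜ := mul_mem hb hq
        have he' : e' = a * (b * (e⁻¹ * e')) := by rw [← mul_assoc, ← hab]; group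
        have hr : e⁻¹ * retr G {x}ᶜ e' = b⁻¹ * retr G {x}ᶜ (b * (e⁻¹ * e')) := by
          have hae : e⁻¹ * a = b⁻¹ := by rw [hab]; group
          conv_lhs => rw [he', map_mul, mem_par.mp ha, ← mul_assoc, hae]
        rw [hr]
        exact mul_mem (inv_mem hb) (retr_mem_par_of_mem _ hb')
    refine ⟨g * retr G (S : Set V)ᶜ e, fun x hx => ?_⟩
    rcases Finset.mem_insert.mp hx with rfl | hx
    · have := key S subset_rfl
      rwa [he, mul_inv_rev, inv_inv, mul_assoc] at this
    · rw [← mul_assoc]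
      refine mul_mem (hg x hx) (par_mono ?_ (retr_mem_par _ e))
      simpa using hx

section Conjugators

variable {φ : MulAut (RAAG G)} {c : V → RAAG G}

theorem conj_map_mem_par_star (hφ : ∀ v, φ (gen G v) = c v * gen G v * (c v)⁻¹) {u v : V}
    (huv : u ∈ _root_.star G v) : (c v)⁻¹ * φ (gen G u) * c v ∈ par G (_root_.star G v) := by
  rcases mem_star.mp huv with rfl | h
  · rw [hφ]
    convert gen_mem_par huv using 1
    group
  · have := ((commute_gen h).map φ).map (MulAut.conj (c v)⁻¹)
    rw [hφ v] at this
    refine mem_par_star_of_commute ?_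
    convert this using 1
    · simp only [MulAut.conj_apply]
      group
    · simp

theorem conjugator_mem_par (hφ : ∀ v, φ (gen G v) = c v * gen G v * (c v)⁻¹) {x u v : V}
    (hu : x ∉ _root_.star G u) (hv : x ∉ _root_.star G v)
    (hconn : (G.induce (_root_.star G x)ᶜ).Connected) : (c v)⁻¹ * c u ∈ par G {x}ᶜ := by
  have key : ∀ (p q : ((_root_.star G x)ᶜ : Set V)) (_ : (G.induce (_root_.star G x)ᶜ).Walk p q),
      (c p)⁻¹ * c q ∈ par G {x}ᶜ := by
    intro p q w
    induction w with
    | nil => simp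
    | @cons p r q h _ ih =>
      have hadj : G.Adj p r := h
      have hp : x ∉ _root_.star G p := notMem_star_comm.mp p.2
      have hr : x ∉ _root_.star G r := notMem_star_comm.mp r.2
      have h1 : (c p)⁻¹ * φ (gen G r) * c p ∈ par G {x}ᶜ :=
        par_mono (Set.subset_compl_singleton_iff.mpr hp)
          (conj_map_mem_par_star hφ (mem_star.mpr (Or.inr hadj)))
      have h2 : (c p)⁻¹ * c r ∈ par G {x}ᶜ := by
        refine mem_par_compl_of_conj hr ?_
        convert h1 using 1
        rw [hφ]
        group
      convert mul_mem h2 ih using 1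
      group
  obtain ⟨w⟩ := hconn.preconnected ⟨v, notMem_star_comm.mp hv⟩ ⟨u, notMem_star_comm.mp hu⟩
  exact key _ _ w

/-- The conjugator at `x` can be corrected by a power of `x` so that it is compatible with the
conjugators of all vertices not adjacent to `x`. -/
theorem exists_conjugator_mul_zpow (hφ : ∀ v, φ (gen G v) = c v * gen G v * (c v)⁻¹)
    (hdom : ∀ u v : V, u ≠ v → ¬Dominates G u v) (x : V)
    (hconn : (G.induce (_root_.star G x)ᶜ).Connected) :
    ∃ k : ℤ, (∀ v, x ∉ _root_.star G v → (c x * gen G x ^ k)⁻¹ * c v ∈ par G {x}ᶜ) ∧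
      ∀ y, y ≠ x → (c x * gen G x ^ k)⁻¹ * φ (gen G y) * (c x * gen G x ^ k) ∈ par G {x}ᶜ := by
  obtain ⟨v₀, hv₀⟩ := hconn.nonempty
  have hv₀ : x ∉ _root_.star G v₀ := notMem_star_comm.mp hv₀
  have hmem : ∀ y, y ≠ x → (c v₀)⁻¹ * φ (gen G y) * c v₀ ∈ par G {x}ᶜ := by
    intro y hy
    have hex : ∃ v, x ∉ _root_.star G v ∧ y ∈ _root_.star G v := by
      obtain ⟨v, hyv, hv⟩ := Set.not_subset.mp (hdom x y hy.symm)
      exact ⟨v, notMem_star_comm.mp hv, mem_star.mpr (Or.inr (SimpleGraph.Adj.symm hyv))⟩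
    obtain ⟨v, hv, hyv⟩ := hex
    have h1 := conjugator_mem_par hφ hv hv₀ hconn
    have h2 := par_mono (Set.subset_compl_singleton_iff.mpr hv) (conj_map_mem_par_star hφ hyv)
    convert mul_mem (mul_mem h1 h2) (inv_mem h1) using 1
    group
  have hgen : ∀ K : Subgroup (RAAG G), par G {x}ᶜ ≤ K →
      (c v₀)⁻¹ * c x * gen G x * ((c v₀)⁻¹ * c x)⁻¹ ∈ K → ∀ g, g ∈ K := by
    intro K hK hx g
    have h1 := mem_of_gen_mem (K := K.comap (((MulAut.conj (c v₀)⁻¹) * φ).toMonoidHom))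
      (fun v => ?_) (φ.symm (c v₀ * g * (c v₀)⁻¹))
    · simpa [mul_assoc] using h1
    · by_cases hv : v = x
      · subst hv
        simpa [hφ v, mul_assoc] using hx
      · simpa using hK (hmem v hv)
  obtain ⟨k, hk⟩ := exists_mul_zpow_mem_par hgen
  refine ⟨k, fun v hv => ?_, fun y hy => ?_⟩
  · convert mul_mem (inv_mem hk) (conjugator_mem_par hφ hv hv₀ hconn) using 1
    group
  · convert mul_mem (mul_mem (inv_mem hk) (hmem y hy)) hk using 1
    group

/-- An automorphism sending every generator to a conjugate of itself is inner. -/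
theorem exists_eq_conj [Finite V] (hφ : ∀ v, φ (gen G v) = c v * gen G v * (c v)⁻¹)
    (hdom : ∀ u v : V, u ≠ v → ¬Dominates G u v)
    (hconn : ∀ v, (G.induce (_root_.star G v)ᶜ).Connected) : ∃ g, φ = MulAut.conj g := by
  choose k hk1 hk2 using fun x => exists_conjugator_mul_zpow hφ hdom x (hconn x)
  set d : V → RAAG G := fun x => c x * gen G x ^ k x with hd
  have hkd : ∀ x y, y ≠ x → (d x)⁻¹ * φ (gen G y) * d x ∈ par G {x}ᶜ := hk2
  have hφd : ∀ v, φ (gen G v) = d v * gen G v * (d v)⁻¹ := by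
    intro v
    rw [hφ, hd]
    group
  obtain ⟨g, hg⟩ := exists_mem_cosets d (by
    intro x y hxy
    by_cases h : x ∈ _root_.star G y
    · have h1 : (d x)⁻¹ * d y * gen G y * ((d x)⁻¹ * d y)⁻¹ ∈ par G {x}ᶜ := by
        convert hkd x y hxy.symm using 1
        rw [hφd]
        group
      obtain ⟨n, hn⟩ := exists_zpow_mul_mem_par (commute_retr_inv_mul hxy.symm h1)
      have hy : gen G y ∈ par G {x}ᶜ := gen_mem_par hxy.symm
      refine ⟨_, mul_mem (retr_mem_par {x}ᶜ ((d x)⁻¹ * d y)) (zpow_mem hy (-n)), _,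
        par_mono ?_ hn, by group⟩
      exact Set.subset_compl_singleton_iff.mpr (G.loopless.irrefl y)
    · have hy : gen G y ∈ par G {x}ᶜ := gen_mem_par hxy.symm
      refine ⟨_, mul_mem (hk1 x y h) (zpow_mem hy (k y)), 1, one_mem _, ?_⟩
      simp only [hd]
      group)
  refine ⟨g, ?_⟩
  have hhom : φ.toMonoidHom = (MulAut.conj g).toMonoidHom := by
    refine hom_ext fun v => ?_
    change φ (gen G v) = g * gen G v * g⁻¹
    have h1 : g⁻¹ * φ (gen G v) * g ∈ par G {v} := by
      refine mem_par_of_forall fun x hx => ?_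
      convert mul_mem (mul_mem (inv_mem (hg x)) (hkd x v (Ne.symm hx))) (hg x) using 1
      group
    obtain ⟨n, hn⟩ : g⁻¹ * φ (gen G v) * g ∈ Subgroup.zpowers (gen G v) :=
      par_le (by rintro u rfl; exact Subgroup.mem_zpowers _) h1
    have hn : gen G v ^ n = g⁻¹ * φ (gen G v) * g := hn
    have hn1 : n = 1 := by
      have := congrArg (ex G v) hn
      rw [hφ, ex_zpow, ex_gen_self, mul_one, ex_mul, ex_mul, ex_conj, ex_gen_self, ex_inv] at this
      linarith
    rw [hn1, zpow_one] at hn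
    calc φ (gen G v) = g * (g⁻¹ * φ (gen G v) * g) * g⁻¹ := by group
      _ = g * gen G v * g⁻¹ := by rw [← hn]
  exact MulEquiv.ext fun h => DFunLike.congr_fun hhom h

end Conjugators

end Rigidity

section OuterAutomorphisms

variable {V : Type} (G : SimpleGraph V)

/-- The endomorphism raising each generator to the power given by a sign. -/
def signHom (ε : V → ℤˣ) : RAAG G →* RAAG G :=
  lift (fun v => gen G v ^ (ε v : ℤ))
    (fun _ _ h => ((commute_gen h).zpow_left _).zpow_right _)

theorem signHom_gen (ε : V → ℤˣ) (v : V) : signHom G ε (gen G v) = gen G v ^ (ε v : ℤ) :=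
  lift_gen _ _ v

theorem signHom_signHom (ε δ : V → ℤˣ) (g : RAAG G) :
    signHom G ε (signHom G δ g) = signHom G (ε * δ) g := by
  have : (signHom G ε).comp (signHom G δ) = signHom G (ε * δ) :=
    hom_ext fun v => by
      rw [MonoidHom.comp_apply, signHom_gen, map_zpow, signHom_gen, ← zpow_mul, signHom_gen,
        Pi.mul_apply, Units.val_mul]
  exact DFunLike.congr_fun this g

theorem signHom_one (g : RAAG G) : signHom G 1 g = g := by
  have : signHom G 1 = MonoidHom.id _ := hom_ext fun v => by simp [signHom]
  exact DFunLike.congr_fun this g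

/-- The action of the group of signs on the RAAG by products of inversions. -/
def signAut : (V → ℤˣ) →* MulAut (RAAG G) where
  toFun ε :=
    { signHom G ε with
      invFun := signHom G ε⁻¹
      left_inv := fun g => by simp [signHom_signHom, signHom_one]
      right_inv := fun g => by simp [signHom_signHom, signHom_one] }
  map_one' := by ext g; exact signHom_one G g
  map_mul' ε δ := by ext g; exact (signHom_signHom G ε δ g).symm

theorem signAut_gen (ε : V → ℤˣ) (v : V) :
    signAut G ε (gen G v) = gen G v ^ (ε v : ℤ) :=
  signHom_gen G ε v

/-- The semidirect product of a RAAG with its group of inversions. -/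
abbrev SignSemi := RAAG G ⋊[signAut G] (V → ℤˣ)

/-- The homomorphism from the semidirect product to the automorphism group of the RAAG. -/
def toAut : SignSemi G →* MulAut (RAAG G) :=
  SemidirectProduct.lift MulAut.conj (signAut G) (by
    intro ε
    ext g h
    simp)

variable {G}

theorem eq_one_of_forall_commute [Finite V] (hne : ∀ x, (_root_.star G x)ᶜ.Nonempty)
    {g : RAAG G} (hg : ∀ v, Commute (gen G v) g) : g = 1 := by
  refine par_empty (mem_par_of_forall fun x _ => ?_)
  obtain ⟨v, hv⟩ := hne x
  exact par_mono (Set.subset_compl_singleton_iff.mpr (notMem_star_comm.mp hv))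
    (mem_par_star_of_commute (hg v))

theorem toAut_injective [Finite V] (hne : ∀ x, (_root_.star G x)ᶜ.Nonempty) :
    Function.Injective (toAut G) := by
  rw [injective_iff_map_eq_one]
  intro b hb
  have h : ∀ v, b.left * gen G v ^ (b.right v : ℤ) * b.left⁻¹ = gen G v := by
    intro v
    rw [← signAut_gen]
    exact DFunLike.congr_fun hb (gen G v)
  have hr : b.right = 1 := by
    funext v
    have := congrArg (ex G v) (h v)
    rw [ex_conj, ex_zpow, ex_gen_self, mul_one] at this
    exact Units.ext this
  have hl : b.left = 1 := by
    refine eq_one_of_forall_commute hne fun v => ?_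
    have := h v
    rw [hr] at this
    exact (mul_inv_eq_iff_eq_mul.mp (by simpa using this)).symm
  exact SemidirectProduct.ext hl hr

theorem toAut_surjective [Fintype V] (hA : Austere G) : Function.Surjective (toAut G) := by
  intro φ
  obtain ⟨ε, c, hφ⟩ := exists_conj_gen hA.1 hA.2.1 φ
  have h : ∀ v, (φ * signAut G ε) (gen G v) = c v * gen G v * (c v)⁻¹ := by
    intro v
    rw [MulAut.mul_apply, signAut_gen, map_zpow, hφ, conj_zpow, ← zpow_mul, ← Units.val_mul,
      Int.units_mul_self, Units.val_one, zpow_one]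
  obtain ⟨g, hg⟩ := exists_eq_conj h hA.2.1 hA.2.2
  refine ⟨⟨g, ε⁻¹⟩, ?_⟩
  change MulAut.conj g * signAut G ε⁻¹ = φ
  rw [← hg, map_inv, mul_inv_cancel_right]

/-- The automorphism group of an austere RAAG as a semidirect product. -/
def autEquiv [Fintype V] (hA : Austere G) : SignSemi G ≃* MulAut (RAAG G) :=
  MulEquiv.ofBijective (toAut G)
    ⟨toAut_injective fun x => Set.nonempty_coe_sort.mp (hA.2.2 x).nonempty, toAut_surjective hA⟩

theorem commute_inr_inl {ε : V → ℤˣ} {v : V} (h : ε v = 1) :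
    Commute (SemidirectProduct.inr ε : SignSemi G) (SemidirectProduct.inl (gen G v)) := by
  ext <;> simp [signAut_gen, h]

section Twist

variable (T : V → V → ℤˣ) (hT : ∀ v, ∀ u ∈ _root_.star G v, T v u = 1)

/-- The restriction of `twistHom` to the RAAG. -/
def twistBase : RAAG G →* SignSemi G :=
  lift (fun v => SemidirectProduct.inl (gen G v) * SemidirectProduct.inr (T v)) (by
    intro u v h
    have huv := commute_inr_inl (G := G) (hT u v (mem_star.mpr (Or.inr h)))
    have hvu := commute_inr_inl (G := G) (hT v u (mem_star.mpr (Or.inr h.symm)))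
    exact (((commute_gen h).map _).mul_right hvu.symm).mul_left
      (huv.mul_right ((Commute.all (T u) (T v)).map _)))

theorem twistBase_gen (v : V) : twistBase T hT (gen G v) =
    SemidirectProduct.inl (gen G v) * SemidirectProduct.inr (T v) :=
  lift_gen _ _ v

/-- The endomorphism multiplying each generator `v` by the product of inversions `T v`. -/
def twistHom : SignSemi G →* SignSemi G :=
  SemidirectProduct.lift (twistBase T hT) SemidirectProduct.inr (by
    intro ε
    refine hom_ext fun v => ?_
    have hc := commute_inr_inl (G := G) (hT v v (mem_star.mpr (Or.inl rfl)))
    have hinv : (T v)⁻¹ = T v := by funext u; exact Int.units_inv_eq_self _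
    have hcomm := ((Commute.all ε (T v)).map
      (SemidirectProduct.inr : (V → ℤˣ) →* SignSemi G)).inv_left
    change twistBase T hT (signAut G ε (gen G v)) =
      SemidirectProduct.inr ε * twistBase T hT (gen G v) * (SemidirectProduct.inr ε)⁻¹
    rw [signAut_gen, map_zpow, twistBase_gen, mul_assoc, mul_assoc, ← hcomm.eq, ← mul_assoc,
      ← mul_assoc, ← map_inv, ← SemidirectProduct.inl_aut, signAut_gen, hc.symm.mul_zpow,
      map_zpow]
    congr 1
    rcases Int.units_eq_one_or (ε v) with h | h
    · simp [h]
    · simp [h, ← map_inv, hinv])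

theorem twistHom_inl_gen (v : V) : twistHom T hT (SemidirectProduct.inl (gen G v)) =
    SemidirectProduct.inl (gen G v) * SemidirectProduct.inr (T v) := by
  simp [twistHom, twistBase_gen]

theorem twistHom_inr (ε : V → ℤˣ) :
    twistHom T hT (SemidirectProduct.inr ε) = SemidirectProduct.inr ε := by
  simp [twistHom]

theorem twistHom_twistHom (b : SignSemi G) : twistHom T hT (twistHom T hT b) = b := by
  have : (twistHom T hT).comp (twistHom T hT) = MonoidHom.id _ := by
    refine SemidirectProduct.hom_ext (hom_ext fun v => ?_) (MonoidHom.ext fun ε => ?_)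
    · have hsq : T v * T v = 1 := by funext u; exact Int.units_mul_self _
      simp only [MonoidHom.comp_apply, MonoidHom.id_apply]
      rw [twistHom_inl_gen, map_mul, twistHom_inl_gen, twistHom_inr, mul_assoc, ← map_mul, hsq,
        map_one, mul_one]
    · simp [twistHom_inr]
  exact DFunLike.congr_fun this b

/-- The involution underlying `twistHom`. -/
def twistAut : MulAut (SignSemi G) :=
  { twistHom T hT with
    invFun := twistHom T hT
    left_inv := twistHom_twistHom T hT
    right_inv := twistHom_twistHom T hT }

theorem twistAut_inl_gen (v : V) : twistAut T hT (SemidirectProduct.inl (gen G v)) =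
    SemidirectProduct.inl (gen G v) * SemidirectProduct.inr (T v) :=
  twistHom_inl_gen T hT v

end Twist

/-- Twists representing the same outer automorphism are equal. -/
theorem twist_eq_of_mk_eq {A : Type} [Group A] (e : SignSemi G ≃* A) {T T' : V → V → ℤˣ}
    {hT : ∀ v, ∀ u ∈ _root_.star G v, T v u = 1} {hT' : ∀ v, ∀ u ∈ _root_.star G v, T' v u = 1}
    (h : (QuotientGroup.mk (MulAut.congr e (twistAut T hT)) : Out A) =
      QuotientGroup.mk (MulAut.congr e (twistAut T' hT'))) : T = T' := by
  obtain ⟨c, hc⟩ := QuotientGroup.eq.mp h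
  funext v
  have h1 := DFunLike.congr_fun (eq_inv_mul_iff_mul_eq.mp hc)
    (e (SemidirectProduct.inl (gen G v)))
  have h2 := congrArg (fun a => (SemidirectProduct.rightHom (e.symm a))) h1
  simpa [MulAut.congr, twistAut_inl_gen] using h2

end OuterAutomorphisms

end RaagAut

/-- Theorem B: if `Γ` is austere with `n > 1` vertices then `|Out(Aut(A_Γ))| ≥ 2^n`. -/
theorem stmt1 {V : Type} [Fintype V] (G : SimpleGraph V) (hA : Austere G)
    (hn : 1 < Nat.card V) :
    (2 : Cardinal) ^ (Nat.card V) ≤ Cardinal.mk (Out (MulAut (RAAG G))) := by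
  classical
  have hne : ∀ v, ∃ w, w ∉ _root_.star G v := fun v =>
    Set.nonempty_coe_sort.mp (hA.2.2 v).nonempty
  choose w hw using hne
  have hT : ∀ δ : V → ℤˣ, ∀ v, ∀ u ∈ _root_.star G v,
      (Pi.mulSingle (w v) (δ v) : V → ℤˣ) u = 1 := fun δ v u hu =>
    Pi.mulSingle_eq_of_ne (by rintro rfl; exact hw v hu) _
  have hinj : Function.Injective fun δ : V → ℤˣ =>
      (QuotientGroup.mk (MulAut.congr (RaagAut.autEquiv hA) (RaagAut.twistAut _ (hT δ))) :
        Out (MulAut (RAAG G))) := by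
    intro δ δ' h
    funext v
    exact Pi.mulSingle_injective (w v) (congrFun (RaagAut.twist_eq_of_mk_eq _ h) v)
  have := Cardinal.mk_le_of_injective hinj
  simpa using this
end
end
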